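/- Let ε > 0 and let X ⊂ ℙ³ be a del Pezzo surface of degree 3 over the number field k (a non-singular cubic surface), containing three coplanar lines each defined over k. Let U ⊂ X be the complement of the 27 lines on X, and let N(U,k,B) = #{x ∈ U(k) : H_k(x) ≤ B}, where H_k is the height on ℙ³(k). Then there exists a constant C = C(ε, X, k) such that N(U,k,B) ≤ C·B^{4/3+ε} for all B ≥ 1. -/

import Mathlib

open NumberField

/-- The normalized absolute value `∥x∥_w = |x|_w^{d_w}` at an infinite place `w`. -/
noncomputable def plNorm {k : Type*} [Field k] [NumberField k]
    (w : InfinitePlace k) (x : k) : ℝ := w x ^ w.mult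

/-- The height `H_k` of the projective point with integral homogeneous coordinates `y`:
`H_k = N(⟨y_0, …, y_n⟩)⁻¹ · ∏_{w | ∞} max_i ∥y_i∥_w`; this is independent of the choice
of integral representative. -/
noncomputable def heightFn {k : Type*} [Field k] [NumberField k] {m : ℕ}
    (y : Fin m → 𝓞 k) : ℝ :=
  (Ideal.absNorm (Ideal.span (Set.range y)) : ℝ)⁻¹ *
    ∏ w : InfinitePlace k, ⨆ i, plNorm w (y i)

/-- The point with homogeneous coordinates `ξ ≠ 0` (over a field `K`) lies on a
projective line contained in the zero locus of the polynomial `P`. -/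
def liesOnLineIn {K : Type*} [Field K] {m : ℕ}
    (P : MvPolynomial (Fin m) K) (ξ : Fin m → K) : Prop :=
  ∃ w : Fin m → K, (∀ c : K, w ≠ c • ξ) ∧
    ∀ s t : K, MvPolynomial.eval (s • ξ + t • w) P = 0

namespace CubicSurface

open Height Function

/-- All places of a number field. -/
abbrev Pl (K : Type*) [Field K] [NumberField K] := InfinitePlace K ⊕ FinitePlace K

/-- The normalized absolute value at a place. -/
noncomputable def nrm {K : Type*} [Field K] [NumberField K] : Pl K → K →*₀ ℝ
  | .inl w => { toFun := fun x => w x ^ w.mult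
                map_zero' := by simp [w.mult_ne_zero]
                map_one' := by simp
                map_mul' := fun x y => by rw [map_mul, mul_pow] }
  | .inr v => { toFun := fun x => v x
                map_zero' := by simp
                map_one' := by simp
                map_mul' := fun x y => by rw [map_mul] }

section Places

variable {K : Type*} [Field K] [NumberField K]

/-- The constant in the quasi-ultrametric inequality. -/
def kap : Pl K → ℝ
  | .inl _ => 4
  | .inr _ => 1

lemma one_le_kap (ν : Pl K) : 1 ≤ kap ν := by
  rcases ν with w | v <;> norm_num [kap]

lemma kap_pos (ν : Pl K) : 0 < kap ν := lt_of_lt_of_le one_pos (one_le_kap ν)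

@[simp] lemma nrm_inl (w : InfinitePlace K) (x : K) : nrm (.inl w : Pl K) x = w x ^ w.mult := rfl

@[simp] lemma nrm_inr (v : FinitePlace K) (x : K) : nrm (.inr v : Pl K) x = v x := rfl

lemma nrm_nonneg (ν : Pl K) (x : K) : 0 ≤ nrm ν x := by
  rcases ν with w | v
  · exact pow_nonneg (apply_nonneg w x) _
  · exact apply_nonneg v x

lemma nrm_pos (ν : Pl K) {x : K} (hx : x ≠ 0) : 0 < nrm ν x :=
  lt_of_le_of_ne (nrm_nonneg ν x) (Ne.symm ((map_ne_zero (nrm ν)).2 hx))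

lemma nrm_neg (ν : Pl K) (x : K) : nrm ν (-x) = nrm ν x := by
  rcases ν with w | v
  · exact congrArg (fun t : ℝ => t ^ w.mult) (map_neg_eq_map w.1 x)
  · simp [map_neg_eq_map v]

lemma nrm_add_le (ν : Pl K) (x y : K) : nrm ν (x + y) ≤ kap ν * max (nrm ν x) (nrm ν y) := by
  rcases ν with w | v
  · simp only [nrm_inl, kap]
    have h1 : w (x + y) ≤ 2 * max (w x) (w y) := by
      have : w (x + y) ≤ w x + w y := map_add_le_add w.1 x y
      have h2 := le_max_left (w x) (w y)
      have h3 := le_max_right (w x) (w y)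
      linarith
    have h0 : 0 ≤ max (w x) (w y) := le_max_of_le_left (apply_nonneg w x)
    have hm : max (w x ^ w.mult) (w y ^ w.mult) = (max (w x) (w y)) ^ w.mult := by
      rcases le_total (w x) (w y) with h | h
      · rw [max_eq_right h, max_eq_right (pow_le_pow_left₀ (apply_nonneg w x) h _)]
      · rw [max_eq_left h, max_eq_left (pow_le_pow_left₀ (apply_nonneg w y) h _)]
    rw [hm]
    calc w (x + y) ^ w.mult ≤ (2 * max (w x) (w y)) ^ w.mult :=
          pow_le_pow_left₀ (apply_nonneg w _) h1 _
      _ = 2 ^ w.mult * max (w x) (w y) ^ w.mult := by rw [mul_pow]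
      _ ≤ 4 * max (w x) (w y) ^ w.mult := by
          gcongr
          rcases (Nat.le_of_lt_succ (show w.mult < 3 by unfold InfinitePlace.mult; split <;> omega)).lt_or_eq with h | h
          · interval_cases w.mult <;> norm_num
          · rw [h]; norm_num
  · simp only [nrm_inr, kap, one_mul]
    exact FinitePlace.add_le v x y

lemma nrm_sub_le (ν : Pl K) (x y : K) : nrm ν (x - y) ≤ kap ν * max (nrm ν x) (nrm ν y) := by
  rw [sub_eq_add_neg, ← nrm_neg ν y]; exact nrm_add_le ν x (-y)

lemma nrm_add_le_of_le (ν : Pl K) {x y : K} {a : ℝ} (hx : nrm ν x ≤ a) (hy : nrm ν y ≤ a) :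
    nrm ν (x + y) ≤ kap ν * a :=
  (nrm_add_le ν x y).trans (mul_le_mul_of_nonneg_left (max_le hx hy) (kap_pos ν).le)

lemma hasFinite_of_inr {φ : Pl K → ℝ} (h : HasFiniteMulSupport fun v => φ (.inr v)) :
    HasFiniteMulSupport φ := by
  have h1 : mulSupport φ ⊆
      Set.range Sum.inl ∪ Set.image Sum.inr (mulSupport fun v => φ (.inr v)) := by
    rintro (w | v) hν
    · exact Or.inl ⟨w, rfl⟩
    · exact Or.inr ⟨v, hν, rfl⟩
  exact ((Set.finite_range _).union (Set.Finite.image _ h)).subset h1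

lemma hasFinite_inr {φ : Pl K → ℝ} (h : HasFiniteMulSupport φ) :
    HasFiniteMulSupport fun v => φ (.inr v) :=
  Set.Finite.preimage Sum.inr_injective.injOn h

lemma hasFinite_nrm {x : K} (hx : x ≠ 0) : HasFiniteMulSupport fun ν : Pl K => nrm ν x :=
  hasFinite_of_inr (FinitePlace.hasFiniteMulSupport hx)

lemma hasFinite_kap : HasFiniteMulSupport (kap : Pl K → ℝ) :=
  hasFinite_of_inr (by simp [kap, HasFiniteMulSupport])

lemma gprod_eq {φ : Pl K → ℝ} (h : HasFiniteMulSupport φ) :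
    ∏ᶠ ν, φ ν = (∏ w, φ (.inl w)) * ∏ᶠ v, φ (.inr v) := by
  classical
  have hs : mulSupport φ ⊆ ((Finset.univ : Finset (InfinitePlace K)).disjSum
      (hasFinite_inr h).toFinset : Finset (Pl K)) := by
    rintro (w | v) hν
    · simp
    · exact Finset.mem_coe.2 (Finset.inr_mem_disjSum.2 ((Set.Finite.mem_toFinset _).2 hν))
  rw [finprod_eq_prod_of_mulSupport_subset φ hs, Finset.prod_disjSum,
    finprod_eq_prod _ (hasFinite_inr h)]

lemma gprod_le {φ ψ : Pl K → ℝ} (h : HasFiniteMulSupport φ) (h' : HasFiniteMulSupport ψ)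
    (h0 : ∀ ν, 0 ≤ φ ν) (hle : ∀ ν, φ ν ≤ ψ ν) : ∏ᶠ ν, φ ν ≤ ∏ᶠ ν, ψ ν := by
  classical
  rw [finprod_eq_prod_of_mulSupport_subset φ (s := h.toFinset ∪ h'.toFinset)
    (fun x hx => Finset.mem_coe.2 (Finset.mem_union_left _ ((Set.Finite.mem_toFinset _).2 hx))),
    finprod_eq_prod_of_mulSupport_subset ψ (s := h.toFinset ∪ h'.toFinset)
    (fun x hx => Finset.mem_coe.2 (Finset.mem_union_right _ ((Set.Finite.mem_toFinset _).2 hx)))]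
  exact Finset.prod_le_prod (fun i _ => h0 i) fun i _ => hle i

lemma gprod_pos {φ : Pl K → ℝ} (h0 : ∀ ν, 0 < φ ν) : 0 < ∏ᶠ ν, φ ν :=
  finprod_induction (fun x => 0 < x) one_pos (fun _ _ => mul_pos) h0

lemma product_formula {x : K} (hx : x ≠ 0) : ∏ᶠ ν : Pl K, nrm ν x = 1 := by
  rw [gprod_eq (hasFinite_nrm hx)]
  simpa using NumberField.prod_abs_eq_one hx

/-- The local sup norm of a tuple. -/
noncomputable def lsup {ι : Type*} (ν : Pl K) (x : ι → K) : ℝ := ⨆ i, nrm ν (x i)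

lemma nrm_le_lsup {ι : Type*} [Finite ι] (ν : Pl K) (x : ι → K) (i : ι) : nrm ν (x i) ≤ lsup ν x :=
  le_ciSup (f := fun i => nrm ν (x i)) (Set.finite_range _).bddAbove i

lemma lsup_nonneg {ι : Type*} (ν : Pl K) (x : ι → K) : 0 ≤ lsup ν x :=
  Real.iSup_nonneg fun i => nrm_nonneg ν (x i)

lemma exists_lsup_eq {ι : Type*} [Finite ι] [Nonempty ι] (ν : Pl K) (x : ι → K) :
    ∃ i, lsup ν x = nrm ν (x i) := by
  obtain ⟨i, hi⟩ := exists_eq_ciSup_of_finite (f := fun i => nrm ν (x i))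
  exact ⟨i, hi.symm⟩

lemma hasFinite_lsup {ι : Type*} [Finite ι] {x : ι → K} (hx : x ≠ 0) :
    HasFiniteMulSupport fun ν : Pl K => lsup ν x := by
  have hne : Nonempty {i // x i ≠ 0} := by
    obtain ⟨i, hi⟩ := Function.ne_iff.1 hx
    exact ⟨⟨i, hi⟩⟩
  have h : (fun ν : Pl K => lsup ν x) = fun ν => ⨆ i : {i // x i ≠ 0}, nrm ν (x i) := by
    ext ν
    refine le_antisymm ?_ ?_
    · have : Nonempty ι := ⟨hne.some.1⟩
      refine ciSup_le fun i => ?_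
      by_cases hi : x i = 0
      · rw [hi, map_zero]; exact Real.iSup_nonneg fun i => nrm_nonneg _ _
      · exact le_ciSup (f := fun i : {i // x i ≠ 0} => nrm ν (x i)) (Set.finite_range _).bddAbove ⟨i, hi⟩
    · exact ciSup_le fun i => nrm_le_lsup ν x i
  rw [h]
  exact HasFiniteMulSupport.iSup fun i => hasFinite_nrm i.2

lemma mulHeight_eq_gprod {ι : Type*} [Finite ι] {x : ι → K} (hx : x ≠ 0) :
    mulHeight x = ∏ᶠ ν : Pl K, lsup ν x := by
  have : Nonempty ι := by
    obtain ⟨i, hi⟩ := Function.ne_iff.1 hx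
    exact ⟨i⟩
  rw [gprod_eq (hasFinite_lsup hx), NumberField.mulHeight_eq hx]
  congr 1
  refine Finset.prod_congr rfl fun w _ => ?_
  rw [Real.iSup_pow fun i => apply_nonneg w (x i)]
  rfl

lemma hasFinite_max_one (x : K) : HasFiniteMulSupport fun ν : Pl K => max 1 (nrm ν x) := by
  by_cases hx : x = 0
  · simp [hx, HasFiniteMulSupport]
  · exact HasFiniteMulSupport.max (by simp [HasFiniteMulSupport]) (hasFinite_nrm hx)

lemma mulHeight₁_eq_gprod (x : K) : mulHeight₁ x = ∏ᶠ ν : Pl K, max 1 (nrm ν x) := by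
  rw [gprod_eq (hasFinite_max_one x), NumberField.mulHeight₁_eq]
  congr 1
  · refine Finset.prod_congr rfl fun w _ => ?_
    simp only [nrm_inl]
    rcases le_total (w x) 1 with h | h
    · rw [max_eq_right h, max_eq_left (pow_le_one₀ (apply_nonneg w x) h), one_pow]
    · rw [max_eq_left h, max_eq_right (one_le_pow₀ h)]
  · exact finprod_congr fun v => max_comm _ _

lemma hasFinite_min_one {x : K} (hx : x ≠ 0) : HasFiniteMulSupport fun ν : Pl K => min 1 (nrm ν x) :=
  HasFiniteMulSupport.min (by simp [HasFiniteMulSupport]) (hasFinite_nrm hx)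

lemma gprod_min_one {x : K} (hx : x ≠ 0) :
    ∏ᶠ ν : Pl K, min 1 (nrm ν x) = (mulHeight₁ x)⁻¹ := by
  rw [← mulHeight₁_inv, mulHeight₁_eq_gprod, ← finprod_inv_distrib]
  refine finprod_congr fun ν => ?_
  rw [map_inv₀]
  have h := nrm_pos ν hx
  rcases le_total (nrm ν x) 1 with h1 | h1
  · rw [min_eq_right h1, max_eq_right ((one_le_inv₀ h).2 h1), inv_inv]
  · rw [min_eq_left h1, max_eq_left (inv_le_one_of_one_le₀ h1), inv_one]

lemma heightFn_eq_mulHeight {m : ℕ} {y : Fin m → 𝓞 K} (hy : y ≠ 0) :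
    heightFn y = mulHeight fun i => (y i : K) := by
  have hy' : (fun i => (y i : K)) ≠ 0 := by
    intro h; apply hy; ext i; simpa using congrFun h i
  have : Nonempty (Fin m) := by
    obtain ⟨i, hi⟩ := Function.ne_iff.1 hy
    exact ⟨i⟩
  rw [heightFn, NumberField.mulHeight_eq hy', mul_comm]
  congr 1
  · refine Finset.prod_congr rfl fun w _ => ?_
    rw [Real.iSup_pow fun i => apply_nonneg w _]
    rfl
  · have := NumberField.absNorm_mul_finprod_finitePlace_eq_one hy
    exact (eq_inv_of_mul_eq_one_right this).symm

end Places

section Extension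

lemma exists_integral_scaling {k : Type*} [Field k] [NumberField k] {ι : Type*} [Finite ι]
    (x : ι → k) : ∃ (c : 𝓞 k) (y : ι → 𝓞 k), c ≠ 0 ∧ ∀ i, (y i : k) = (c : k) * x i := by
  obtain ⟨b, hb⟩ := IsLocalization.exist_integer_multiples_of_finite (nonZeroDivisors (𝓞 k)) x
  choose y hy using hb
  refine ⟨b, y, nonZeroDivisors.coe_ne_zero b, fun i => ?_⟩
  exact (hy i).trans (Algebra.smul_def _ _)

variable {k K : Type*} [Field k] [NumberField k] [Field K] [NumberField K] [Algebra k K]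

lemma prod_infinitePlace_eq_prod_embeddings (g : InfinitePlace k → ℝ) :
    ∏ w, g w ^ w.mult = ∏ φ : k →+* ℂ, g (InfinitePlace.mk φ) := by
  classical
  rw [← Finset.prod_fiberwise (s := Finset.univ) (g := fun φ : k →+* ℂ => InfinitePlace.mk φ)]
  refine Finset.prod_congr rfl fun w _ => ?_
  rw [Finset.prod_congr rfl (g := fun _ => g w) (fun φ hφ => by rw [(Finset.mem_filter.1 hφ).2]),
    Finset.prod_const, InfinitePlace.card_filter_mk_eq]

lemma card_embeddings_extending (ψ : k →+* ℂ) :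
    Nat.card {φ : K →+* ℂ // φ.comp (algebraMap k K) = ψ} = Module.finrank k K := by
  let _ : Algebra k ℂ := ψ.toAlgebra
  have : FiniteDimensional k K := Module.Finite.of_restrictScalars_finite ℚ k K
  rw [← AlgHom.card k K ℂ, ← Nat.card_eq_fintype_card]
  exact Nat.card_congr
    { toFun := fun φ => { φ.1 with commutes' := fun r => RingHom.congr_fun φ.2 r }
      invFun := fun φ => ⟨φ.toRingHom, RingHom.ext fun r => φ.commutes r⟩
      left_inv := fun φ => rfl
      right_inv := fun φ => rfl }

lemma prod_comap_infinitePlace (g : InfinitePlace k → ℝ) :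
    ∏ w : InfinitePlace K, g (w.comap (algebraMap k K)) ^ w.mult =
      (∏ w, g w ^ w.mult) ^ Module.finrank k K := by
  classical
  rw [prod_infinitePlace_eq_prod_embeddings (fun w : InfinitePlace K => g (w.comap (algebraMap k K))),
    prod_infinitePlace_eq_prod_embeddings, ← Finset.prod_pow,
    ← Finset.prod_fiberwise (s := Finset.univ) (g := fun φ : K →+* ℂ => φ.comp (algebraMap k K))]
  refine Finset.prod_congr rfl fun ψ _ => ?_
  rw [Finset.prod_congr rfl (g := fun _ => g (InfinitePlace.mk ψ)) (fun φ hφ => by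
    rw [InfinitePlace.comap_mk, (Finset.mem_filter.1 hφ).2]), Finset.prod_const,
    ← card_embeddings_extending (K := K) ψ, Nat.card_eq_fintype_card, Fintype.card_subtype]

lemma mulHeight_algebraMap {ι : Type*} [Finite ι] {x : ι → k} (hx : x ≠ 0) :
    mulHeight (fun i => algebraMap k K (x i)) = mulHeight x ^ Module.finrank k K := by
  obtain ⟨c, y, hc, hy⟩ := exists_integral_scaling x
  have hck : (c : k) ≠ 0 := by exact_mod_cast hc
  have hcK : algebraMap k K (c : k) ≠ 0 := by simpa using hc
  have hyx : (fun i => (y i : k)) = (c : k) • x := by ext i; simp [hy]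
  have hyne : y ≠ 0 := by
    obtain ⟨i, hi⟩ := Function.ne_iff.1 hx
    intro h
    have := hy i
    rw [h] at this
    simp only [Pi.zero_apply, map_zero] at this
    exact mul_ne_zero hck hi this.symm
  let yK : ι → 𝓞 K := fun i => algebraMap (𝓞 k) (𝓞 K) (y i)
  have hyK : ∀ i, (yK i : K) = algebraMap k K (y i : k) := fun i => rfl
  have h1 : (fun i => (yK i : K)) = algebraMap k K (c : k) • fun i => algebraMap k K (x i) := by
    ext i; simp [hyK, hy]
  have hyk0 : (fun i => (y i : k)) ≠ 0 := by
    rw [hyx]; exact smul_ne_zero hck hx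
  have hinj : Function.Injective (algebraMap (𝓞 k) (𝓞 K)) := by
    intro a b hab
    have h2 : algebraMap k K (a : k) = algebraMap k K (b : k) :=
      congrArg (fun t : 𝓞 K => (t : K)) hab
    exact RingOfIntegers.ext ((algebraMap k K).injective h2)
  have hyKne : yK ≠ 0 := by
    obtain ⟨i, hi⟩ := Function.ne_iff.1 hyne
    intro h
    exact hi (hinj (by simpa [yK] using congrFun h i))
  have hyK0 : (fun i => (yK i : K)) ≠ 0 := by
    intro h; apply hyKne; ext i; simpa using congrFun h i
  rw [← mulHeight_smul_eq_mulHeight (x := x) hck,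
    ← mulHeight_smul_eq_mulHeight (x := fun i => algebraMap k K (x i)) hcK, ← hyx, ← h1,
    NumberField.mulHeight_eq hyK0, NumberField.mulHeight_eq hyk0, mul_pow]
  congr 1
  · exact prod_comap_infinitePlace (K := K) (fun w : InfinitePlace k => ⨆ i, w (y i : k))
  · rw [eq_inv_of_mul_eq_one_right (NumberField.absNorm_mul_finprod_finitePlace_eq_one hyne),
      eq_inv_of_mul_eq_one_right (NumberField.absNorm_mul_finprod_finitePlace_eq_one hyKne),
      inv_pow]
    have h3 : Ideal.span (Set.range yK) =
        (Ideal.span (Set.range y)).map (algebraMap (𝓞 k) (𝓞 K)) := by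
      rw [Ideal.map_span, ← Set.range_comp]; rfl
    rw [h3, Ideal.absNorm_algebraMap, Nat.cast_pow]
    congr 2
    exact (IsFractionRing.finrank_eq (𝓞 k) k (𝓞 K) K).symm

lemma mulHeight₁_algebraMap (x : k) :
    mulHeight₁ (algebraMap k K x) = mulHeight₁ x ^ Module.finrank k K := by
  rw [mulHeight₁_eq_mulHeight, mulHeight₁_eq_mulHeight, ← mulHeight_algebraMap (K := K)
    (by intro h; simpa using congrFun h 1)]
  congr 1
  ext i
  fin_cases i <;> simp

end Extension

section Counting

variable {k : Type*} [Field k] [NumberField k]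

lemma finite_units_height_le (T : ℝ) : {u : (𝓞 k)ˣ | mulHeight₁ ((u : 𝓞 k) : k) ≤ T}.Finite := by
  refine Set.Finite.preimage (f := fun u : (𝓞 k)ˣ => ((u : 𝓞 k) : k)) ?_
    (NumberField.finite_setOfPred_mulHeight₁_le k T)
  intro a _ b _ h
  exact Units.ext (RingOfIntegers.ext h)

lemma units_sq_finite : Finite ((𝓞 k)ˣ ⧸ (powMonoidHom 2 : (𝓞 k)ˣ →* (𝓞 k)ˣ).range) := by
  have : Group.FG ((𝓞 k)ˣ ⧸ (powMonoidHom 2 : (𝓞 k)ˣ →* (𝓞 k)ˣ).range) := by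
    have : Group.FG (𝓞 k)ˣ := Group.fg_iff_monoid_fg.2 inferInstance
    exact QuotientGroup.fg _
  refine CommGroup.finite_of_fg_isMulTorsion _ ?_
  intro x
  obtain ⟨u, rfl⟩ := QuotientGroup.mk_surjective x
  refine isOfFinOrder_iff_pow_eq_one.2 ⟨2, by norm_num, ?_⟩
  rw [← QuotientGroup.mk_pow, QuotientGroup.eq_one_iff]
  exact ⟨u, rfl⟩

lemma exists_units_count_sqrt : ∃ c E : ℝ, 1 ≤ c ∧ 1 ≤ E ∧ ∀ T : ℝ, 1 ≤ T →
    (({u : (𝓞 k)ˣ | mulHeight₁ ((u : 𝓞 k) : k) ≤ T}.ncard : ℝ)) ≤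
      c * ({u : (𝓞 k)ˣ | mulHeight₁ ((u : 𝓞 k) : k) ≤ Real.sqrt (E * T)}.ncard : ℝ) := by
  classical
  have hfin := units_sq_finite (k := k)
  let Q := (𝓞 k)ˣ ⧸ (powMonoidHom 2 : (𝓞 k)ˣ →* (𝓞 k)ˣ).range
  have : Fintype Q := Fintype.ofFinite Q
  let E : ℝ := ∑ q : Q, mulHeight₁ ((q.out : 𝓞 k) : k)
  have hE : ∀ q : Q, mulHeight₁ ((q.out : 𝓞 k) : k) ≤ E := fun q =>
    Finset.single_le_sum (f := fun q : Q => mulHeight₁ ((q.out : 𝓞 k) : k))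
      (fun i _ => (zero_le_one.trans (one_le_mulHeight₁ _))) (Finset.mem_univ q)
  have hE1 : 1 ≤ E := (one_le_mulHeight₁ _).trans (hE 1)
  refine ⟨Fintype.card Q, E, ?_, hE1, fun T hT => ?_⟩
  · exact_mod_cast Fintype.card_pos
  have hsq : ∀ u : (𝓞 k)ˣ, ∃ w : (𝓞 k)ˣ, u = (QuotientGroup.mk u : Q).out * w ^ 2 := by
    intro u
    obtain ⟨⟨h, w, hw⟩, hh⟩ := QuotientGroup.mk_out_eq_mul
      (powMonoidHom 2 : (𝓞 k)ˣ →* (𝓞 k)ˣ).range u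
    refine ⟨w⁻¹, ?_⟩
    have hw' : w ^ 2 = h := hw
    change (QuotientGroup.mk u : Q).out = u * h at hh
    rw [hh, ← hw']; group
  choose w hw using hsq
  set A := {u : (𝓞 k)ˣ | mulHeight₁ ((u : 𝓞 k) : k) ≤ T} with hA
  set D := {u : (𝓞 k)ˣ | mulHeight₁ ((u : 𝓞 k) : k) ≤ Real.sqrt (E * T)} with hD
  have hDf : D.Finite := finite_units_height_le _
  have hmaps : ∀ u ∈ A, ((QuotientGroup.mk u : Q), w u) ∈ (Set.univ : Set Q) ×ˢ D := by
    intro u hu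
    refine ⟨trivial, Real.le_sqrt_of_sq_le ?_⟩
    rw [← mulHeight₁_pow]
    have h1 : (((w u : 𝓞 k) : k)) ^ 2 =
        ((((QuotientGroup.mk u : Q).out : 𝓞 k) : k))⁻¹ * ((u : 𝓞 k) : k) := by
      have h2 : ((u : 𝓞 k) : k) =
          ((((QuotientGroup.mk u : Q).out : 𝓞 k) : k)) * (((w u : 𝓞 k) : k)) ^ 2 := by
        conv_lhs => rw [hw u]
        simp
      rw [h2, inv_mul_cancel_left₀]
      simp
    rw [h1]
    refine (mulHeight₁_mul_le _ _).trans ?_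
    rw [mulHeight₁_inv]
    exact mul_le_mul (hE _) hu (zero_le_one.trans (one_le_mulHeight₁ _)) (zero_le_one.trans hE1)
  have hcard := Set.ncard_le_ncard_of_injOn (fun u => ((QuotientGroup.mk u : Q), w u)) hmaps
    (by
      intro a _ b _ hab
      simp only [Prod.mk.injEq] at hab
      rw [hw a, hw b, hab.1, hab.2]) (Set.finite_univ.prod hDf)
  rw [Set.ncard_prod, Set.ncard_univ, Nat.card_eq_fintype_card] at hcard
  exact_mod_cast hcard

lemma units_count_le {ε : ℝ} (hε : 0 < ε) : ∃ C : ℝ, 0 < C ∧ ∀ T : ℝ, 1 ≤ T →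
    ({u : (𝓞 k)ˣ | mulHeight₁ ((u : 𝓞 k) : k) ≤ T}.ncard : ℝ) ≤ C * T ^ ε := by
  obtain ⟨c, E, hc, hE, h⟩ := exists_units_count_sqrt (k := k)
  set f : ℝ → ℝ := fun T => ({u : (𝓞 k)ˣ | mulHeight₁ ((u : 𝓞 k) : k) ≤ T}.ncard : ℝ) with hf
  have hmono : Monotone f := fun a b hab => by
    simp only [hf]
    exact_mod_cast Set.ncard_le_ncard (fun u hu => le_trans hu hab) (finite_units_height_le b)
  set T₀ : ℝ := max (max (E ^ 3) (c ^ (3 / ε))) 2 with hT₀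
  have hT₀2 : 2 ≤ T₀ := le_max_right _ _
  have hstep : ∀ T, T₀ ≤ T → f T ≤ c * f (T ^ ((2 : ℝ) / 3)) := by
    intro T hT
    have hT1 : 1 ≤ T := by linarith
    refine (h T hT1).trans (mul_le_mul_of_nonneg_left (hmono ?_) (by linarith))
    rw [Real.sqrt_le_left (by positivity), ← Real.rpow_natCast, ← Real.rpow_mul (by linarith)]
    have h1 : E ≤ T ^ ((1 : ℝ) / 3) := by
      rw [Real.le_rpow_iff_log_le (by linarith) (by linarith)]
      have h2 : E ^ 3 ≤ T := ((le_max_left _ _).trans (le_max_left _ _)).trans hT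
      have h3 := Real.log_le_log (by positivity) h2
      rw [Real.log_pow] at h3
      push_cast at h3
      linarith
    calc E * T ≤ T ^ ((1 : ℝ) / 3) * T := by gcongr
      _ = T ^ ((1 : ℝ) / 3) * T ^ (1 : ℝ) := by rw [Real.rpow_one]
      _ = T ^ ((2 : ℝ) / 3 * ((2 : ℕ) : ℝ)) := by
        rw [← Real.rpow_add (by linarith)]; norm_num
  have hC0 : 0 ≤ f T₀ := by simp only [hf]; positivity
  have main : ∀ n : ℕ, ∀ T, 1 ≤ T → T ≤ T₀ ^ (((3 : ℝ) / 2) ^ n) → f T ≤ (f T₀ + 1) * T ^ ε := by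
    intro n
    induction n with
    | zero =>
      intro T h1 h2
      rw [pow_zero, Real.rpow_one] at h2
      have := hmono h2
      have h3 : 1 ≤ T ^ ε := Real.one_le_rpow h1 hε.le
      nlinarith
    | succ n ih =>
      intro T h1 h2
      by_cases hT : T ≤ T₀
      · have := hmono hT
        have h3 : 1 ≤ T ^ ε := Real.one_le_rpow h1 hε.le
        nlinarith
      · push Not at hT
        have h4 := ih (T ^ ((2 : ℝ) / 3)) (Real.one_le_rpow h1 (by norm_num)) (by
          calc T ^ ((2 : ℝ) / 3) ≤ (T₀ ^ (((3 : ℝ) / 2) ^ (n + 1))) ^ ((2 : ℝ) / 3) :=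
                Real.rpow_le_rpow (by linarith) h2 (by norm_num)
            _ = T₀ ^ (((3 : ℝ) / 2) ^ n) := by
                rw [← Real.rpow_mul (by linarith)]
                congr 1; rw [pow_succ]; ring)
        have hcT : c ≤ T ^ (ε / 3) := by
          rw [Real.le_rpow_iff_log_le (by linarith) (by linarith)]
          have h5 : c ^ (3 / ε) ≤ T := ((le_max_right _ _).trans (le_max_left _ _)).trans hT.le
          have h6 := Real.log_le_log (by positivity) h5
          rw [Real.log_rpow (by linarith), div_mul_eq_mul_div, div_le_iff₀ hε] at h6
          linarith
        have hpos : 0 < T := by linarith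
        calc f T ≤ c * f (T ^ ((2 : ℝ) / 3)) := hstep T hT.le
          _ ≤ T ^ (ε / 3) * ((f T₀ + 1) * (T ^ ((2 : ℝ) / 3)) ^ ε) := by
            apply mul_le_mul hcT h4 (by simp only [hf]; positivity) (by positivity)
          _ = (f T₀ + 1) * (T ^ (ε / 3) * T ^ ((2 : ℝ) / 3 * ε)) := by
            rw [← Real.rpow_mul hpos.le]; ring
          _ = (f T₀ + 1) * T ^ ε := by
            rw [← Real.rpow_add hpos]; congr 2; ring
  refine ⟨f T₀ + 1, by linarith, fun T hT => ?_⟩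
  have htend : Filter.Tendsto (fun n : ℕ => T₀ ^ (((3 : ℝ) / 2) ^ n)) Filter.atTop Filter.atTop :=
    (tendsto_rpow_atTop_of_base_gt_one T₀ (by linarith)).comp
      (tendsto_pow_atTop_atTop_of_one_lt (by norm_num))
  obtain ⟨n, hn⟩ := (htend.eventually_ge_atTop T).exists
  exact main n T hT hn

lemma finite_ideals (T : ℝ) : {I : Ideal (𝓞 k) | (Ideal.absNorm I : ℝ) ≤ T}.Finite := by
  refine (Ideal.finite_setOfPred_absNorm_le (S := 𝓞 k) ⌊T⌋₊).subset fun I hI => ?_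
  exact Nat.le_floor hI

lemma ideal_count_le : ∃ C : ℝ, 0 < C ∧ ∀ T : ℝ, 1 ≤ T →
    ({I : Ideal (𝓞 k) | (Ideal.absNorm I : ℝ) ≤ T}.ncard : ℝ) ≤ C * T := by
  set f : ℝ → ℝ := fun T => ({I : Ideal (𝓞 k) | (Ideal.absNorm I : ℝ) ≤ T}.ncard : ℝ) with hf
  have hmono : Monotone f := fun a b hab => by
    simp only [hf]
    exact_mod_cast Set.ncard_le_ncard (fun u hu => le_trans hu hab) (finite_ideals b)
  have h := NumberField.Ideal.tendsto_norm_le_div_atTop k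
  set c := ((2 ^ InfinitePlace.nrRealPlaces k * (2 * Real.pi) ^ InfinitePlace.nrComplexPlaces k *
    Units.regulator k * classNumber k) / (Units.torsionOrder k * Real.sqrt |discr k|))
  have h2 := h.eventually (gt_mem_nhds (lt_add_one c))
  obtain ⟨s₀, hs₀⟩ := Filter.eventually_atTop.1 h2
  have hC0 : ∀ T, 0 ≤ f T := fun T => by simp only [hf]; positivity
  refine ⟨|c + 1| + f s₀ + 1, by have := hC0 s₀; positivity, fun T hT => ?_⟩
  change f T ≤ _
  have h00 := hC0 s₀
  have habs := abs_nonneg (c + 1)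
  rcases le_total T s₀ with hle | hle
  · have := hmono hle
    nlinarith
  · have := hs₀ T hle
    rw [div_lt_iff₀ (by linarith)] at this
    have h3 : f T = (Nat.card {I : Ideal (𝓞 k) // (Ideal.absNorm I : ℝ) ≤ T} : ℝ) := rfl
    rw [h3]
    have := le_abs_self (c + 1)
    nlinarith

lemma absNorm_span_singleton_le (a : 𝓞 k) : ((Ideal.absNorm (Ideal.span {a}) : ℕ) : ℝ) =
    ∏ w : InfinitePlace k, w (a : k) ^ w.mult := by
  rw [InfinitePlace.prod_eq_abs_norm, Ideal.absNorm_span_singleton,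
    ← Algebra.coe_norm_int, Nat.cast_natAbs]
  simp

lemma exists_coprime_ideals {s : k} (hs : s ≠ 0) : ∃ (a b : 𝓞 k) (I 𝔞 𝔟 : Ideal (𝓞 k)),
    a ≠ 0 ∧ b ≠ 0 ∧ s = (a : k) / (b : k) ∧ I * 𝔞 = Ideal.span {a} ∧ I * 𝔟 = Ideal.span {b} ∧
    (Ideal.absNorm 𝔞 : ℝ) ≤ mulHeight₁ s ∧ (Ideal.absNorm 𝔟 : ℝ) ≤ mulHeight₁ s := by
  obtain ⟨a, b, hb, hab⟩ := IsFractionRing.div_surjective (A := 𝓞 k) s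
  have hb0 : b ≠ 0 := nonZeroDivisors.ne_zero hb
  have ha0 : a ≠ 0 := by
    rintro rfl
    rw [map_zero, zero_div] at hab
    exact hs hab.symm
  set y : Fin 2 → 𝓞 k := ![a, b] with hy
  have hy0 : y ≠ 0 := fun h => ha0 (by simpa [hy] using congrFun h 0)
  set I := Ideal.span (Set.range y) with hI
  have hmem : ∀ i, ∃ 𝔠, Ideal.span {y i} = I * 𝔠 := fun i =>
    Ideal.dvd_iff_le.2 ((Ideal.span_singleton_le_iff_mem _).2 (Ideal.subset_span ⟨i, rfl⟩))
  have hH : mulHeight₁ s = heightFn y := by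
    rw [heightFn_eq_mulHeight hy0, ← hab]
    rw [mulHeight₁_div_eq_mulHeight]
    congr 1
    ext i; fin_cases i <;> simp [hy]
  have hI0 : (Ideal.absNorm I : ℝ) ≠ 0 := by
    rw [Nat.cast_ne_zero, Ne, Ideal.absNorm_eq_zero_iff]
    intro h
    have : a ∈ I := Ideal.subset_span ⟨0, rfl⟩
    rw [h] at this
    exact ha0 (by simpa using this)
  have hIpos : (0 : ℝ) < Ideal.absNorm I := lt_of_le_of_ne (Nat.cast_nonneg _) hI0.symm
  have hbound : ∀ i 𝔠, Ideal.span {y i} = I * 𝔠 → (Ideal.absNorm 𝔠 : ℝ) ≤ mulHeight₁ s := by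
    intro i 𝔠 h
    rw [hH, heightFn, le_inv_mul_iff₀ hIpos, ← Nat.cast_mul, ← map_mul, ← h,
      absNorm_span_singleton_le]
    refine Finset.prod_le_prod (fun w _ => pow_nonneg (apply_nonneg w _) _) fun w _ => ?_
    exact le_ciSup (f := fun i => plNorm w (y i : k)) (Set.finite_range _).bddAbove i
  obtain ⟨𝔞, h𝔞⟩ := hmem 0
  obtain ⟨𝔟, h𝔟⟩ := hmem 1
  exact ⟨a, b, I, 𝔞, 𝔟, ha0, hb0, hab.symm, h𝔞.symm, h𝔟.symm, hbound 0 𝔞 h𝔞, hbound 1 𝔟 h𝔟⟩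

lemma finite_height_le (T : ℝ) : {s : k | mulHeight₁ s ≤ T}.Finite :=
  NumberField.finite_setOfPred_mulHeight₁_le k T

/-- The number of elements of height at most `T` is `O(T ^ (2 + ε))`. -/
lemma count_height_le {ε : ℝ} (hε : 0 < ε) : ∃ C : ℝ, 0 < C ∧ ∀ T : ℝ, 1 ≤ T →
    ({s : k | mulHeight₁ s ≤ T}.ncard : ℝ) ≤ C * T ^ (2 + ε) := by
  classical
  obtain ⟨c₁, hc₁, h₁⟩ := units_count_le (k := k) (ε := ε / 2) (by positivity)
  obtain ⟨c₂, hc₂, h₂⟩ := ideal_count_le (k := k)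
  have hex : ∀ s : k, ∃ (d : (𝓞 k × 𝓞 k) × (Ideal (𝓞 k) × Ideal (𝓞 k)) × Ideal (𝓞 k)), s ≠ 0 →
    d.1.1 ≠ 0 ∧ d.1.2 ≠ 0 ∧ s = (d.1.1 : k) / (d.1.2 : k) ∧ d.2.2 * d.2.1.1 = Ideal.span {d.1.1} ∧
    d.2.2 * d.2.1.2 = Ideal.span {d.1.2} ∧
    (Ideal.absNorm d.2.1.1 : ℝ) ≤ mulHeight₁ s ∧ (Ideal.absNorm d.2.1.2 : ℝ) ≤ mulHeight₁ s := by
    intro s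
    by_cases hs : s = 0
    · exact ⟨((0, 0), (⊥, ⊥), ⊥), fun h => absurd hs h⟩
    · obtain ⟨a, b, I, 𝔞, 𝔟, h⟩ := exists_coprime_ideals hs
      exact ⟨((a, b), (𝔞, 𝔟), I), fun _ => h⟩
  choose d hd using hex
  refine ⟨c₁ * (c₂ * c₂) + 1, by positivity, fun T hT => ?_⟩
  set A : Finset k := (finite_height_le (k := k) T).toFinset.erase 0 with hA
  set J : Finset (Ideal (𝓞 k)) := (finite_ideals (k := k) T).toFinset with hJ
  have hAm : ∀ s ∈ A, s ≠ 0 ∧ mulHeight₁ s ≤ T := fun s hs => by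
    simpa [hA] using hs
  set Un : Finset (𝓞 k)ˣ := (finite_units_height_le (k := k) (T ^ 2)).toFinset with hUn
  have himg : A.image (fun s => (d s).2.1) ⊆ J ×ˢ J := by
    intro x hx
    obtain ⟨s, hs, rfl⟩ := Finset.mem_image.1 hx
    obtain ⟨hs0, hsT⟩ := hAm s hs
    obtain ⟨-, -, -, -, -, h5, h6⟩ := hd s hs0
    rw [Finset.mem_product]
    exact ⟨by simpa [hJ] using h5.trans hsT, by simpa [hJ] using h6.trans hsT⟩
  have hfib : ∀ x ∈ A.image (fun s => (d s).2.1), (A.filter fun s => (d s).2.1 = x).card ≤ Un.card := by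
    intro x hx
    obtain ⟨s, hs, rfl⟩ := Finset.mem_image.1 hx
    obtain ⟨hs0, hsT⟩ := hAm s hs
    obtain ⟨ha, hb, hsab, hIa, hIb, -, -⟩ := hd s hs0
    have hu : ∀ t ∈ A.filter (fun t => (d t).2.1 = (d s).2.1), ∃ u ∈ Un, t = s * ((u : 𝓞 k) : k) := by
      intro t ht
      rw [Finset.mem_filter] at ht
      obtain ⟨ht0, htT⟩ := hAm t ht.1
      obtain ⟨ha', hb', htab, hIa', hIb', -, -⟩ := hd t ht0
      have hass : Associated ((d s).1.1 * (d t).1.2) ((d t).1.1 * (d s).1.2) := by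
        rw [← Ideal.span_singleton_eq_span_singleton, ← Ideal.span_singleton_mul_span_singleton,
          ← Ideal.span_singleton_mul_span_singleton, ← hIa, ← hIb, ← hIa', ← hIb', ht.2]
        ring
      obtain ⟨u, hu⟩ := hass
      have htu : t = s * ((u : 𝓞 k) : k) := by
        have hu' := congrArg (fun z : 𝓞 k => (z : k)) hu
        simp only [map_mul] at hu'
        rw [htab, hsab]
        have hbk : ((d s).1.2 : k) ≠ 0 := by simpa using hb
        have hbk' : ((d t).1.2 : k) ≠ 0 := by simpa using hb'
        field_simp
        linear_combination -hu'
      refine ⟨u, ?_, htu⟩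
      have h3 : ((u : 𝓞 k) : k) = s⁻¹ * t := by rw [htu, inv_mul_cancel_left₀ hs0]
      have h4 : mulHeight₁ ((u : 𝓞 k) : k) ≤ T ^ 2 := by
        rw [h3, sq]
        refine (mulHeight₁_mul_le _ _).trans ?_
        rw [mulHeight₁_inv]
        exact mul_le_mul hsT htT (zero_le_one.trans (one_le_mulHeight₁ _)) (by linarith)
      simpa [hUn] using h4
    calc _ ≤ (Un.image fun u : (𝓞 k)ˣ => s * ((u : 𝓞 k) : k)).card := by
          refine Finset.card_le_card fun t ht => ?_
          obtain ⟨u, hu1, hu2⟩ := hu t ht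
          exact Finset.mem_image.2 ⟨u, hu1, hu2.symm⟩
      _ ≤ Un.card := Finset.card_image_le
  have hAc : A.card ≤ Un.card * (J.card * J.card) := by
    refine (Finset.card_le_mul_card_image A Un.card hfib).trans ?_
    refine Nat.mul_le_mul_left _ ((Finset.card_le_card himg).trans ?_)
    rw [Finset.card_product]
  have hUc : (Un.card : ℝ) ≤ c₁ * T ^ ε := by
    have := h₁ (T ^ 2) (one_le_pow₀ hT)
    rw [Set.ncard_eq_toFinset_card _ (finite_units_height_le (k := k) (T ^ 2))] at this
    have h5 : (T ^ 2) ^ (ε / 2) = T ^ ε := by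
      rw [← Real.rpow_natCast, ← Real.rpow_mul (by linarith)]
      congr 1; push_cast; ring
    rwa [h5] at this
  have hJc : (J.card : ℝ) ≤ c₂ * T := by
    have := h₂ T hT
    rwa [Set.ncard_eq_toFinset_card _ (finite_ideals (k := k) T)] at this
  have hS : ({s : k | mulHeight₁ s ≤ T}.ncard) ≤ A.card + 1 := by
    rw [Set.ncard_eq_toFinset_card _ (finite_height_le (k := k) T), hA]
    have := Finset.pred_card_le_card_erase (s := (finite_height_le (k := k) T).toFinset) (a := 0)
    omega
  have hpos : 0 < T := by linarith
  have h1T : 1 ≤ T ^ (2 + ε) := Real.one_le_rpow hT (by positivity)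
  calc ({s : k | mulHeight₁ s ≤ T}.ncard : ℝ) ≤ A.card + 1 := by exact_mod_cast hS
    _ ≤ (Un.card : ℝ) * (J.card * J.card) + 1 := by
      have : (A.card : ℝ) ≤ (Un.card : ℝ) * (J.card * J.card) := by exact_mod_cast hAc
      linarith
    _ ≤ (c₁ * T ^ ε) * ((c₂ * T) * (c₂ * T)) + 1 := by gcongr
    _ = c₁ * (c₂ * c₂) * (T ^ (2 : ℝ) * T ^ ε) + 1 := by rw [Real.rpow_two]; ring
    _ = c₁ * (c₂ * c₂) * T ^ (2 + ε) + 1 := by rw [← Real.rpow_add hpos]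
    _ ≤ (c₁ * (c₂ * c₂) + 1) * T ^ (2 + ε) := by linarith

end Counting

/-- Coefficients of a conic bundle `q_s(x, y, z)` of the shape coming from a cubic form containing
the line `x₀ = x₁ = 0`. -/
structure Cf (R : Type*) where
  (a0 a1 a2 a3 b0 b1 b2 c0 c1 c2 d0 d1 e0 e1 f0 f1 : R)

namespace Cf

variable {R : Type*} [CommRing R] (c : Cf R)

def A (s : R) : R := c.a0 + c.a1 * s + c.a2 * s ^ 2 + c.a3 * s ^ 3
def B (s : R) : R := c.b0 + c.b1 * s + c.b2 * s ^ 2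
def C (s : R) : R := c.c0 + c.c1 * s + c.c2 * s ^ 2
def D (s : R) : R := c.d0 + c.d1 * s
def E (s : R) : R := c.e0 + c.e1 * s
def F (s : R) : R := c.f0 + c.f1 * s

/-- The conic at parameter `s`. -/
def q (s x y z : R) : R :=
  c.A s * x ^ 2 + c.B s * x * y + c.C s * x * z + c.D s * y ^ 2 + c.E s * y * z + c.F s * z ^ 2

/-- The discriminant of the conic at parameter `s`. -/
def disc (s : R) : R :=
  4 * c.A s * c.D s * c.F s + c.B s * c.C s * c.E s - c.A s * c.E s ^ 2 - c.C s ^ 2 * c.D s -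
    c.B s ^ 2 * c.F s

/-- Coefficients of the difference quotient `(q_s - q_r) / (s - r)` as a quadratic form
in `1, s, y, z`. -/
def diffCoef (r : R) : Fin 4 × Fin 4 → R := fun i => (!![
  c.a1 + c.a2 * r + c.a3 * r ^ 2, c.a2 + c.a3 * r, c.b1 + c.b2 * r, c.c1 + c.c2 * r;
  0, c.a3, c.b2, c.c2;
  0, 0, c.d1, c.e1;
  0, 0, 0, c.f1] : Matrix (Fin 4) (Fin 4) R) i.1 i.2

lemma q_sub_q (s r y z : R) : c.q s 1 y z - c.q r 1 y z =
    (s - r) * ∑ i : Fin 4 × Fin 4, c.diffCoef r i * ((![1, s, y, z] : Fin 4 → R) i.1 *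
      (![1, s, y, z] : Fin 4 → R) i.2) := by
  rw [Fintype.sum_prod_type]
  simp [Fin.sum_univ_four, diffCoef, q, A, B, C, D, E, F]
  ring

end Cf

/-- A splitting of four distinct degenerate fibres of a conic bundle into pairs of distinct lines. -/
structure Splitting {K : Type*} [Field K] (c : Cf K) where
  r : Fin 4 → K
  inj : Function.Injective r
  L : Fin 4 → Matrix (Fin 3) (Fin 3) K
  det_ne : ∀ j, (L j).det ≠ 0
  fac : ∀ j x y z, c.q (r j) x y z = (L j).mulVec ![x, y, z] 0 * (L j).mulVec ![x, y, z] 1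
  disc_zero : ∀ j, c.disc (r j) = 0

section Local

variable {K : Type*} [Field K] [NumberField K]

lemma nrm_sum_le (ν : Pl K) {ι : Type*} (S : Finset ι) (x : ι → K) {a : ℝ} (ha : 0 ≤ a)
    (h : ∀ i ∈ S, nrm ν (x i) ≤ a) : nrm ν (∑ i ∈ S, x i) ≤ kap ν ^ S.card * a := by
  classical
  induction S using Finset.induction_on with
  | empty => simpa using ha
  | insert i S hi ih =>
    rw [Finset.sum_insert hi, Finset.card_insert_of_notMem hi, pow_succ', mul_assoc]
    have hk : 1 ≤ kap ν ^ S.card := one_le_pow₀ (one_le_kap ν)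
    refine nrm_add_le_of_le ν ((h i (Finset.mem_insert_self _ _)).trans ?_)
      (ih fun j hj => h j (Finset.mem_insert_of_mem hj))
    nlinarith

lemma nrm_det_le (ν : Pl K) (N : Matrix (Fin 3) (Fin 3) K) {a : ℝ} (ha : 0 ≤ a)
    (h : ∀ σ : Equiv.Perm (Fin 3), nrm ν (∏ i, N (σ i) i) ≤ a) :
    nrm ν N.det ≤ kap ν ^ 6 * a := by
  rw [Matrix.det_apply]
  have := nrm_sum_le ν (Finset.univ : Finset (Equiv.Perm (Fin 3)))
    (fun σ => Equiv.Perm.sign σ • ∏ i, N (σ i) i) ha (fun σ _ => by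
      rcases Int.units_eq_one_or (Equiv.Perm.sign σ) with h1 | h1
      · rw [h1, one_smul]; exact h σ
      · rw [h1, Units.smul_def, Units.val_neg, Units.val_one, neg_one_smul, nrm_neg]; exact h σ)
  rwa [Finset.card_univ, Fintype.card_perm, Fintype.card_fin] at this

lemma prod_le_of_pairwise_max {ι : Type*} [Fintype ι] [Nonempty ι] [DecidableEq ι] (t : ι → ℝ) {c C T : ℝ}
    (hc : 0 < c) (hC : 0 ≤ C) (ht : ∀ i, 0 < t i) (hpair : ∀ i j, i ≠ j → c ≤ max (t i) (t j))
    (hT : ∀ i, T ≤ C * t i) : T * c ^ (Fintype.card ι - 1) ≤ C * ∏ i, t i := by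
  obtain ⟨i, hi⟩ := Finite.exists_min t
  rw [← Finset.mul_prod_erase _ _ (Finset.mem_univ i), ← mul_assoc]
  have h1 : c ^ (Fintype.card ι - 1) ≤ ∏ j ∈ Finset.univ.erase i, t j := by
    rw [← Finset.card_univ, ← Finset.card_erase_of_mem (Finset.mem_univ i), ← Finset.prod_const]
    refine Finset.prod_le_prod (fun _ _ => hc.le) fun j hj => ?_
    have := hpair i j (Finset.ne_of_mem_erase hj).symm
    rwa [max_eq_right (hi j)] at this
  calc T * c ^ (Fintype.card ι - 1) ≤ (C * t i) * c ^ (Fintype.card ι - 1) := by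
        gcongr; exact hT i
    _ ≤ _ := by
        have := mul_nonneg hC (ht i).le
        gcongr

/-- The affine point with coordinates `(1, s, y, z)`. -/
abbrev pt (s y z : K) : Fin 4 → K := ![1, s, y, z]

lemma pt_ne_zero (s y z : K) : pt s y z ≠ 0 := fun h => by simpa using congrFun h 0

lemma one_le_lsup_pt (ν : Pl K) (s y z : K) : 1 ≤ lsup ν (pt s y z) := by
  simpa using nrm_le_lsup ν (pt s y z) 0

variable {c : Cf K} (P : Splitting c)

/-- The relative size of the first linear factor of the `j`-th degenerate fibre, truncated to
`[min 1 |s - r_j|, 1]`. -/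
noncomputable def Splitting.size (ν : Pl K) (j : Fin 4) (s y z : K) : ℝ :=
  min 1 (max (nrm ν ((P.L j).mulVec ![1, y, z] 0) / lsup ν (pt s y z)) (min 1 (nrm ν (s - P.r j))))

lemma truncated_bounds {X M D u u' : ℝ} (hX : 0 < X) (hM : 1 ≤ M) (hD : 0 ≤ D)
    (hu' : 0 ≤ u') (h1 : u ≤ M * X) (h2 : u' ≤ M * X) (h3 : u * u' ≤ M * D * (X * X)) :
    u ≤ M * X * min 1 (max (u / X) (min 1 D)) ∧
      u' * min 1 (max (u / X) (min 1 D)) ≤ M * X * min 1 D := by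
  have hMX : 0 < M * X := by positivity
  rcases le_total 1 D with hD1 | hD1
  · rw [min_eq_left hD1, min_eq_left (le_max_right _ _)]
    constructor <;> linarith
  · rw [min_eq_right hD1]
    rcases le_total 1 (u / X) with h | h
    · rw [min_eq_left (h.trans (le_max_left _ _))]
      refine ⟨by linarith, ?_⟩
      have hXu : X ≤ u := by rwa [le_div_iff₀ hX, one_mul] at h
      have : X * u' ≤ X * (M * X * D) := by nlinarith
      simpa using le_of_mul_le_mul_left this hX
    · rw [min_eq_right (max_le h hD1)]
      constructor
      · calc u = X * (u / X) := by field_simp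
          _ ≤ X * max (u / X) D := by gcongr; exact le_max_left _ _
          _ ≤ M * X * max (u / X) D := by
            have : 0 ≤ max (u / X) D := le_max_of_le_right hD
            nlinarith [mul_nonneg hX.le this]
      · rcases le_total (u / X) D with h4 | h4
        · rw [max_eq_right h4]; nlinarith
        · rw [max_eq_left h4]
          have : u' * (u / X) = (u * u') / X := by ring
          rw [this, div_le_iff₀ hX]
          nlinarith

/-- Elements of `K` controlling all local constants of a splitting. -/
noncomputable def Splitting.consts : Option ((Fin 4 × (Fin 4 × Fin 4)) ⊕ (Fin 4 × Fin 3 × Fin 3) ⊕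
    (Fin 4 ⊕ Fin 4 ⊕ (Fin 4 × Fin 4))) → K
  | none => 1
  | some (.inl i) => c.diffCoef (P.r i.1) i.2
  | some (.inr (.inl i)) => P.L i.1 i.2.1 i.2.2
  | some (.inr (.inr (.inl j))) => P.r j
  | some (.inr (.inr (.inr (.inl j)))) => ((P.L j).det)⁻¹
  | some (.inr (.inr (.inr (.inr i)))) => (P.r i.1 - P.r i.2)⁻¹

noncomputable def Splitting.M (ν : Pl K) : ℝ := lsup ν P.consts

lemma Splitting.one_le_M (ν : Pl K) : 1 ≤ P.M ν := by
  have h := nrm_le_lsup ν P.consts none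
  simp only [Splitting.consts, map_one] at h
  exact h

lemma Splitting.hasFinite_M : HasFiniteMulSupport P.M :=
  hasFinite_lsup fun h => by simpa [Splitting.consts] using congrFun h none

lemma Splitting.nrm_L_mulVec_le (ν : Pl K) (j : Fin 4) (i : Fin 3) (s y z : K) :
    nrm ν ((P.L j).mulVec ![1, y, z] i) ≤ kap ν ^ 3 * P.M ν * lsup ν (pt s y z) := by
  have h := nrm_sum_le ν (Finset.univ : Finset (Fin 3)) (fun l => P.L j i l * ![1, y, z] l)
    (a := P.M ν * lsup ν (pt s y z)) (mul_nonneg (lsup_nonneg _ _) (lsup_nonneg _ _)) (fun l _ => by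
      rw [map_mul]
      refine mul_le_mul (nrm_le_lsup ν P.consts (some (.inr (.inl (j, i, l))))) ?_ (nrm_nonneg _ _)
        (lsup_nonneg _ _)
      fin_cases l
      · exact nrm_le_lsup ν (pt s y z) 0
      · exact nrm_le_lsup ν (pt s y z) 2
      · exact nrm_le_lsup ν (pt s y z) 3)
  rw [Finset.card_univ, Fintype.card_fin] at h
  rw [mul_assoc]
  exact h

lemma Splitting.nrm_mul_le (ν : Pl K) (j : Fin 4) {s y z : K} (hq : c.q s 1 y z = 0) :
    nrm ν ((P.L j).mulVec ![1, y, z] 0) * nrm ν ((P.L j).mulVec ![1, y, z] 1) ≤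
      kap ν ^ 16 * P.M ν * nrm ν (s - P.r j) * (lsup ν (pt s y z) * lsup ν (pt s y z)) := by
  have h0 := c.q_sub_q s (P.r j) y z
  rw [hq, zero_sub, P.fac] at h0
  have hX := lsup_nonneg ν (pt s y z)
  rw [← map_mul, ← nrm_neg, h0, map_mul]
  have h := nrm_sum_le ν (Finset.univ : Finset (Fin 4 × Fin 4)) (fun i => c.diffCoef (P.r j) i *
      (pt s y z i.1 * pt s y z i.2))
    (a := P.M ν * (lsup ν (pt s y z) * lsup ν (pt s y z)))
    (mul_nonneg (lsup_nonneg _ _) (mul_nonneg hX hX)) (fun i _ => by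
      rw [map_mul, map_mul]
      refine mul_le_mul (nrm_le_lsup ν P.consts (some (.inl (j, i)))) ?_
        (mul_nonneg (nrm_nonneg _ _) (nrm_nonneg _ _)) (lsup_nonneg _ _)
      exact mul_le_mul (nrm_le_lsup ν _ _) (nrm_le_lsup ν _ _) (nrm_nonneg _ _) hX)
  rw [Finset.card_univ, Fintype.card_prod, Fintype.card_fin] at h
  calc _ ≤ nrm ν (s - P.r j) * (kap ν ^ 16 * (P.M ν * (lsup ν (pt s y z) * lsup ν (pt s y z)))) :=
        mul_le_mul_of_nonneg_left h (nrm_nonneg _ _)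
    _ = _ := by ring

lemma Splitting.size_bounds (ν : Pl K) (j : Fin 4) {s y z : K} (hq : c.q s 1 y z = 0) :
    nrm ν ((P.L j).mulVec ![1, y, z] 0) ≤
      (kap ν ^ 16 * P.M ν) * lsup ν (pt s y z) * P.size ν j s y z ∧
    nrm ν ((P.L j).mulVec ![1, y, z] 1) * P.size ν j s y z ≤
      (kap ν ^ 16 * P.M ν) * lsup ν (pt s y z) * min 1 (nrm ν (s - P.r j)) := by
  have hk := one_le_kap ν
  have hM := P.one_le_M ν
  have hX := one_le_lsup_pt ν s y z
  have h16 : kap ν ^ 3 * P.M ν * lsup ν (pt s y z) ≤ kap ν ^ 16 * P.M ν * lsup ν (pt s y z) := by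
    gcongr
    norm_num
  exact truncated_bounds (by linarith) (one_le_mul_of_one_le_of_one_le (one_le_pow₀ hk) hM)
    (nrm_nonneg _ _) (nrm_nonneg _ _)
    ((P.nrm_L_mulVec_le ν j 0 s y z).trans h16) ((P.nrm_L_mulVec_le ν j 1 s y z).trans h16)
    (P.nrm_mul_le ν j hq)

lemma Splitting.size_pos (ν : Pl K) (j : Fin 4) {s : K} (y z : K) (hs : s ≠ P.r j) :
    0 < P.size ν j s y z :=
  lt_min one_pos (lt_max_of_lt_right (lt_min one_pos (nrm_pos ν (sub_ne_zero.2 hs))))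

/-- The matrix whose columns are the vectors `(1, y_i, z_i)`. -/
def colMat (y z : Fin 3 → K) : Matrix (Fin 3) (Fin 3) K := Matrix.of ![1, y, z]

lemma Splitting.det_bound (ν : Pl K) (j : Fin 4) {s : K} {y z : Fin 3 → K} (hs : s ≠ P.r j)
    (hq : ∀ i, c.q s 1 (y i) (z i) = 0)
    (hsz : ∀ i i', P.size ν j s (y i) (z i) ≤ kap ν * P.size ν j s (y i') (z i')) :
    nrm ν (colMat y z).det ≤ (kap ν ^ 16 * P.M ν) ^ 5 * (∏ i, lsup ν (pt s (y i) (z i))) *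
      min 1 (nrm ν (s - P.r j)) := by
  set N := kap ν ^ 16 * P.M ν with hN
  have hk := one_le_kap ν
  have hM := P.one_le_M ν
  have hN1 : 1 ≤ N := one_le_mul_of_one_le_of_one_le (one_le_pow₀ hk) hM
  have hk16 : kap ν ^ 7 ≤ N := by
    calc kap ν ^ 7 ≤ kap ν ^ 16 := pow_le_pow_right₀ hk (by norm_num)
      _ ≤ _ := le_mul_of_one_le_right (by positivity) hM
  have hMN : P.M ν ≤ N := le_mul_of_one_le_left (by linarith) (one_le_pow₀ hk)
  set X : Fin 3 → ℝ := fun i => lsup ν (pt s (y i) (z i)) with hX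
  have hX1 : ∀ i, 1 ≤ X i := fun i => one_le_lsup_pt _ _ _ _
  have hX0 : ∀ i, 0 ≤ X i := fun i => zero_le_one.trans (hX1 i)
  set δ := min 1 (nrm ν (s - P.r j)) with hδ
  have hδ0 : 0 ≤ δ := le_min zero_le_one (nrm_nonneg _ _)
  set W := P.L j * colMat y z with hW
  have hcol : ∀ a i, W a i = (P.L j).mulVec ![1, y i, z i] a := by
    intro a i
    simp only [hW, Matrix.mul_apply, Matrix.mulVec, dotProduct, Fin.sum_univ_three, colMat]
    simp
  have hb0 : ∀ i, nrm ν (W 0 i) ≤ N * X i * P.size ν j s (y i) (z i) := fun i => by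
    rw [hcol]; exact (P.size_bounds ν j (hq i)).1
  have hb1 : ∀ i, nrm ν (W 1 i) * P.size ν j s (y i) (z i) ≤ N * X i * δ := fun i => by
    rw [hcol]; exact (P.size_bounds ν j (hq i)).2
  have hb2 : ∀ i, nrm ν (W 2 i) ≤ N * X i := fun i => by
    rw [hcol]
    refine (P.nrm_L_mulVec_le ν j 2 s (y i) (z i)).trans ?_
    have := hX0 i
    simp only [hX] at this ⊢
    rw [hN]
    gcongr
    norm_num
  have hb01 : ∀ i i', nrm ν (W 0 i) * nrm ν (W 1 i') ≤ kap ν * (N * X i) * (N * X i') * δ := by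
    intro i i'
    have hp := P.size_pos ν j (y i') (z i') hs
    have h0 := (hb0 i).trans (mul_le_mul_of_nonneg_left (hsz i i') (mul_nonneg (by linarith) (hX0 i)))
    have h1 := hb1 i'
    calc nrm ν (W 0 i) * nrm ν (W 1 i') ≤
        (N * X i * (kap ν * P.size ν j s (y i') (z i'))) * nrm ν (W 1 i') :=
          mul_le_mul_of_nonneg_right h0 (nrm_nonneg _ _)
      _ = (kap ν * (N * X i)) * (nrm ν (W 1 i') * P.size ν j s (y i') (z i')) := by ring
      _ ≤ (kap ν * (N * X i)) * (N * X i' * δ) := by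
          refine mul_le_mul_of_nonneg_left h1 (mul_nonneg (by linarith) (mul_nonneg (by linarith) (hX0 i)))
      _ = _ := by ring
  have hterm : ∀ i i' i'', nrm ν (W 0 i) * nrm ν (W 1 i') * nrm ν (W 2 i'') ≤
      kap ν * N ^ 3 * (X i * X i' * X i'') * δ := by
    intro i i' i''
    calc _ ≤ (kap ν * (N * X i) * (N * X i') * δ) * (N * X i'') := by
          refine mul_le_mul (hb01 i i') (hb2 i'') (nrm_nonneg _ _) ?_
          have := hX0 i; have := hX0 i'
          have : 0 ≤ kap ν := by linarith
          have : 0 ≤ N := by linarith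
          positivity
      _ = _ := by ring
  have hN0 : 0 ≤ N := by linarith
  have hk0 : 0 ≤ kap ν := by linarith
  have hPX : 0 ≤ ∏ i, X i := Finset.prod_nonneg fun i _ => hX0 i
  have hWdet : nrm ν W.det ≤ kap ν ^ 6 * (kap ν * N ^ 3 * (∏ i, X i) * δ) := by
    rw [← Matrix.det_transpose]
    refine nrm_det_le ν W.transpose (by positivity) fun σ => ?_
    rw [map_prod, Fin.prod_univ_three]
    simp only [Matrix.transpose_apply]
    refine (hterm (σ 0) (σ 1) (σ 2)).trans (le_of_eq ?_)
    have : X (σ 0) * X (σ 1) * X (σ 2) = ∏ i, X i := by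
      rw [← Equiv.prod_comp σ X, Fin.prod_univ_three]
    rw [this]
  have hdet : (colMat y z).det = ((P.L j).det)⁻¹ * W.det := by
    rw [hW, Matrix.det_mul, inv_mul_cancel_left₀ (P.det_ne j)]
  rw [hdet, map_mul]
  have hinv : nrm ν ((P.L j).det)⁻¹ ≤ N :=
    (nrm_le_lsup ν P.consts (some (.inr (.inr (.inr (.inl j)))))).trans hMN
  calc _ ≤ N * (kap ν ^ 6 * (kap ν * N ^ 3 * (∏ i, X i) * δ)) :=
        mul_le_mul hinv hWdet (nrm_nonneg _ _) hN0
    _ = kap ν ^ 7 * (N ^ 4 * (∏ i, X i) * δ) := by ring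
    _ ≤ N * (N ^ 4 * (∏ i, X i) * δ) := by gcongr
    _ = _ := by ring

end Local

section Global

variable {K : Type*} [Field K] [NumberField K] {c : Cf K} (P : Splitting c)

lemma nrm_det_le_trivial (ν : Pl K) (s : K) (y z : Fin 3 → K) :
    nrm ν (colMat y z).det ≤
      kap ν ^ 6 * ((max 1 (nrm ν s))⁻¹ * ∏ i, lsup ν (pt s (y i) (z i))) := by
  set X : Fin 3 → ℝ := fun i => lsup ν (pt s (y i) (z i)) with hX
  have hX0 : ∀ i, 0 ≤ X i := fun i => lsup_nonneg _ _
  have hm : (0 : ℝ) < max 1 (nrm ν s) := lt_of_lt_of_le one_pos (le_max_left _ _)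
  have hone : ∀ i, 1 ≤ (max 1 (nrm ν s))⁻¹ * X i := fun i => by
    rw [inv_mul_eq_div, le_div_iff₀ hm, one_mul]
    exact max_le (one_le_lsup_pt _ _ _ _) (nrm_le_lsup ν (pt s (y i) (z i)) 1)
  set w : Fin 3 → ℝ := ![(max 1 (nrm ν s))⁻¹, 1, 1] with hw
  have hent : ∀ a i, nrm ν (colMat y z a i) ≤ w a * X i := by
    intro a i
    fin_cases a
    · simpa [colMat, hw] using hone i
    · simpa [colMat, hw] using nrm_le_lsup ν (pt s (y i) (z i)) 2
    · simpa [colMat, hw] using nrm_le_lsup ν (pt s (y i) (z i)) 3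
  refine nrm_det_le ν _ (mul_nonneg (inv_nonneg.2 hm.le) (Finset.prod_nonneg fun i _ => hX0 i))
    fun σ => ?_
  rw [map_prod]
  refine (Finset.prod_le_prod (fun i _ => nrm_nonneg _ _) fun i _ => hent (σ i) i).trans
    (le_of_eq ?_)
  rw [Finset.prod_mul_distrib, Equiv.prod_comp σ w]
  simp [hw, Fin.prod_univ_three]

/-- The local constant in the determinant estimate. -/
noncomputable def Splitting.locConst (ν : Pl K) : ℝ :=
  (kap ν ^ 16 * P.M ν) ^ 5 * (kap ν * P.M ν) ^ 4

lemma Splitting.one_le_locConst (ν : Pl K) : 1 ≤ P.locConst ν := by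
  have hk := one_le_kap ν
  have hM := P.one_le_M ν
  exact one_le_mul_of_one_le_of_one_le
    (one_le_pow₀ (one_le_mul_of_one_le_of_one_le (one_le_pow₀ hk) hM))
    (one_le_pow₀ (one_le_mul_of_one_le_of_one_le hk hM))

lemma Splitting.hasFinite_locConst : HasFiniteMulSupport P.locConst := by
  have h1 : HasFiniteMulSupport fun ν : Pl K => kap ν := hasFinite_kap
  have h2 : HasFiniteMulSupport fun ν : Pl K => P.M ν := P.hasFinite_M
  exact (((h1.pow 16).mul h2).pow 5).mul ((h1.mul h2).pow 4)

/-- The value controlling proximity of `s` to infinity and to the roots. -/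
noncomputable def Splitting.prox (ν : Pl K) (s : K) : Option (Fin 4) → ℝ
  | none => (max 1 (nrm ν s))⁻¹
  | some j => min 1 (nrm ν (s - P.r j))

lemma Splitting.prox_pairwise (ν : Pl K) (s : K) (i j : Option (Fin 4)) (hij : i ≠ j) :
    (kap ν * P.M ν)⁻¹ ≤ max (P.prox ν s i) (P.prox ν s j) := by
  have hk := one_le_kap ν
  have hM := P.one_le_M ν
  have hkM : 1 ≤ kap ν * P.M ν := one_le_mul_of_one_le_of_one_le hk hM
  have key : ∀ j, (kap ν * P.M ν)⁻¹ ≤ max (P.prox ν s none) (P.prox ν s (some j)) := by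
    intro j
    by_contra! h
    obtain ⟨h1, h2⟩ := max_lt_iff.1 h
    simp only [Splitting.prox] at h1 h2
    have h3 : kap ν * P.M ν < max 1 (nrm ν s) :=
      (inv_lt_inv₀ (lt_of_lt_of_le one_pos (le_max_left _ _)) (by linarith)).1 h1
    have h4 : kap ν * P.M ν < nrm ν s := by
      rcases lt_max_iff.1 h3 with h | h
      · linarith
      · exact h
    have h5 : nrm ν s ≤ kap ν * max (nrm ν (s - P.r j)) (nrm ν (P.r j)) := by
      simpa using nrm_add_le ν (s - P.r j) (P.r j)
    have h6 : P.M ν < max (nrm ν (s - P.r j)) (nrm ν (P.r j)) :=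
      lt_of_mul_lt_mul_left (h4.trans_le h5) (kap_pos ν).le
    have h7 : nrm ν (P.r j) ≤ P.M ν :=
      nrm_le_lsup ν P.consts (some (.inr (.inr (.inl j))))
    have h8 : P.M ν < nrm ν (s - P.r j) := by
      rcases lt_max_iff.1 h6 with h | h
      · exact h
      · linarith
    rw [min_eq_left (by linarith)] at h2
    have := inv_le_one_of_one_le₀ hkM
    linarith
  rcases i with _ | i <;> rcases j with _ | j
  · exact absurd rfl hij
  · exact key j
  · rw [max_comm]; exact key i
  · have hij' : i ≠ j := fun h => hij (by rw [h])
    by_contra! h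
    obtain ⟨h1, h2⟩ := max_lt_iff.1 h
    simp only [Splitting.prox] at h1 h2
    have h0 := inv_le_one_of_one_le₀ hkM
    have h3 : nrm ν (s - P.r i) < (kap ν * P.M ν)⁻¹ := by
      rcases min_lt_iff.1 h1 with h | h
      · linarith
      · exact h
    have h4 : nrm ν (s - P.r j) < (kap ν * P.M ν)⁻¹ := by
      rcases min_lt_iff.1 h2 with h | h
      · linarith
      · exact h
    have hne : P.r i - P.r j ≠ 0 := sub_ne_zero.2 fun h => hij' (P.inj h)
    have h5 : nrm ν (P.r i - P.r j) ≤ kap ν * max (nrm ν (s - P.r j)) (nrm ν (s - P.r i)) := by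
      have := nrm_sub_le ν (s - P.r j) (s - P.r i)
      rwa [show s - P.r j - (s - P.r i) = P.r i - P.r j by ring] at this
    have h6 : nrm ν (P.r i - P.r j)⁻¹ ≤ P.M ν :=
      nrm_le_lsup ν P.consts (some (.inr (.inr (.inr (.inr (i, j))))))
    rw [map_inv₀] at h6
    have h7 := nrm_pos ν hne
    have h8 : (P.M ν)⁻¹ ≤ nrm ν (P.r i - P.r j) := inv_le_of_inv_le₀ h7 h6
    have h9 : kap ν * max (nrm ν (s - P.r j)) (nrm ν (s - P.r i)) < kap ν * (kap ν * P.M ν)⁻¹ :=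
      mul_lt_mul_of_pos_left (max_lt h4 h3) (kap_pos ν)
    rw [mul_inv, mul_inv_cancel_left₀ (kap_pos ν).ne'] at h9
    linarith

lemma Splitting.prox_pos (ν : Pl K) {s : K} (hs : ∀ j, s ≠ P.r j) (i : Option (Fin 4)) :
    0 < P.prox ν s i := by
  rcases i with _ | j
  · exact inv_pos.2 (lt_of_lt_of_le one_pos (le_max_left _ _))
  · exact lt_min one_pos (nrm_pos ν (sub_ne_zero.2 (hs j)))

lemma Splitting.det_bound_prox (ν : Pl K) {s : K} {y z : Fin 3 → K} (hs : ∀ j, s ≠ P.r j)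
    (hq : ∀ i, c.q s 1 (y i) (z i) = 0)
    (hsz : ∀ j i i', P.size ν j s (y i) (z i) ≤ kap ν * P.size ν j s (y i') (z i')) :
    nrm ν (colMat y z).det ≤
      P.locConst ν * ((∏ i, lsup ν (pt s (y i) (z i))) * ∏ i, P.prox ν s i) := by
  have hk := one_le_kap ν
  have hM := P.one_le_M ν
  have hkM : 1 ≤ kap ν * P.M ν := one_le_mul_of_one_le_of_one_le hk hM
  have hX0 : 0 ≤ ∏ i, lsup ν (pt s (y i) (z i)) := Finset.prod_nonneg fun i _ => lsup_nonneg _ _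
  have h := prod_le_of_pairwise_max (P.prox ν s) (c := (kap ν * P.M ν)⁻¹)
    (C := (kap ν ^ 16 * P.M ν) ^ 5 * ∏ i, lsup ν (pt s (y i) (z i)))
    (T := nrm ν (colMat y z).det) (by positivity)
    (mul_nonneg (by positivity) hX0) (P.prox_pos ν hs) (P.prox_pairwise ν s) (fun i => by
      rcases i with _ | j
      · refine (nrm_det_le_trivial ν s y z).trans ?_
        have : kap ν ^ 6 ≤ (kap ν ^ 16 * P.M ν) ^ 5 := by
          rw [mul_pow, ← pow_mul]
          calc kap ν ^ 6 ≤ kap ν ^ (16 * 5) := pow_le_pow_right₀ hk (by norm_num)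
            _ ≤ _ := le_mul_of_one_le_right (by positivity) (one_le_pow₀ hM)
        have hp := (P.prox_pos ν hs none).le
        simp only [Splitting.prox] at hp ⊢
        calc _ = kap ν ^ 6 * ((∏ i, lsup ν (pt s (y i) (z i))) * (max 1 (nrm ν s))⁻¹) := by ring
          _ ≤ (kap ν ^ 16 * P.M ν) ^ 5 *
              ((∏ i, lsup ν (pt s (y i) (z i))) * (max 1 (nrm ν s))⁻¹) := by gcongr
          _ = _ := by ring
      · exact P.det_bound ν j (hs j) hq (hsz j))
  rw [Fintype.card_option, Fintype.card_fin, Nat.add_sub_cancel, inv_pow, ← div_eq_mul_inv,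
    div_le_iff₀ (by positivity)] at h
  refine h.trans (le_of_eq ?_)
  rw [Splitting.locConst]; ring

/-- The local weight of an auxiliary prime. -/
noncomputable def auxW (p : ℕ) : Pl K → ℝ
  | .inl _ => 1
  | .inr v => v (p : K) ^ 3

lemma finitePlace_natCast_le_one (v : FinitePlace K) (p : ℕ) : v (p : K) ≤ 1 := by
  have h := FinitePlace.norm_le_one K v.maximalIdeal (p : 𝓞 K)
  rwa [FinitePlace.norm_embedding_eq, map_natCast] at h

lemma hasFinite_auxW {p : ℕ} (hp : p ≠ 0) : HasFiniteMulSupport (auxW p : Pl K → ℝ) :=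
  hasFinite_of_inr (by
    exact (FinitePlace.hasFiniteMulSupport (K := K) (x := (p : K)) (by exact_mod_cast hp)).pow 3)

lemma gprod_auxW {p : ℕ} (hp : p ≠ 0) :
    ∏ᶠ ν : Pl K, auxW p ν = ((p : ℝ) ^ (3 * Module.finrank ℚ K))⁻¹ := by
  rw [gprod_eq (hasFinite_auxW hp)]
  simp only [auxW, Finset.prod_const_one, one_mul]
  have hp' : (p : K) ≠ 0 := by exact_mod_cast hp
  rw [← finprod_pow (FinitePlace.hasFiniteMulSupport hp')]
  have h := FinitePlace.prod_eq_inv_abs_norm (K := K) hp'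
  rw [h, show (p : K) = algebraMap ℚ K p by simp, Algebra.norm_algebraMap]
  push_cast
  rw [abs_of_nonneg (by positivity), inv_pow, mul_comm 3, pow_mul]

theorem Splitting.det_inequality : ∃ C > 0, ∀ (s : K) (y z : Fin 3 → K) (p : ℕ), p ≠ 0 →
    (∀ j, s ≠ P.r j) → (∀ i, c.q s 1 (y i) (z i) = 0) → (colMat y z).det ≠ 0 →
    (∀ ν j i i', P.size ν j s (y i) (z i) ≤ kap ν * P.size ν j s (y i') (z i')) →
    (∀ v : FinitePlace K, v (p : K) < 1 →
      v (colMat y z).det ≤ v (p : K) ^ 3 * ∏ i, lsup (.inr v) (pt s (y i) (z i)) ∧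
        v s ≤ 1 ∧ ∀ j, v (s - P.r j) = 1) →
    mulHeight₁ s ^ 5 * (p : ℝ) ^ (3 * Module.finrank ℚ K) ≤
      C * ∏ i, mulHeight (pt s (y i) (z i)) := by
  set C₁ := ∏ᶠ ν, P.locConst ν with hC₁
  have hC₁0 : 0 < C₁ := gprod_pos fun ν => one_pos.trans_le (P.one_le_locConst ν)
  set t : ℝ := 2 ^ Module.finrank ℚ K with ht
  have ht0 : 0 < t := by positivity
  refine ⟨C₁ * ∏ j, (t * mulHeight₁ (P.r j)),
    mul_pos hC₁0 (Finset.prod_pos fun j _ => mul_pos ht0 (mulHeight₁_pos _)), ?_⟩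
  intro s y z p hp hs hq hdet hsz hpv
  have hfinX : HasFiniteMulSupport fun ν : Pl K => ∏ i, lsup ν (pt s (y i) (z i)) :=
    HasFiniteMulSupport.prod (fun i => hasFinite_lsup (pt_ne_zero _ _ _)) _
  have hfin1 : HasFiniteMulSupport fun ν : Pl K => (max 1 (nrm ν s))⁻¹ := (hasFinite_max_one s).inv
  have hfin2 : HasFiniteMulSupport fun ν : Pl K => ∏ j, min 1 (nrm ν (s - P.r j)) :=
    HasFiniteMulSupport.prod (fun j => hasFinite_min_one (sub_ne_zero.2 (hs j))) _
  have hprox : ∀ ν, ∏ i, P.prox ν s i = (max 1 (nrm ν s))⁻¹ * ∏ j, min 1 (nrm ν (s - P.r j)) :=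
    fun ν => Fintype.prod_option _
  have hfinA : HasFiniteMulSupport fun ν : Pl K => auxW p ν := hasFinite_auxW hp
  have hfinC : HasFiniteMulSupport fun ν : Pl K => P.locConst ν := P.hasFinite_locConst
  have hfin3 : HasFiniteMulSupport fun ν : Pl K => (max 1 (nrm ν s))⁻¹ *
    ∏ j, min 1 (nrm ν (s - P.r j)) := hfin1.mul hfin2
  have hfin4 : HasFiniteMulSupport fun ν : Pl K => (∏ i, lsup ν (pt s (y i) (z i))) *
    ((max 1 (nrm ν s))⁻¹ * ∏ j, min 1 (nrm ν (s - P.r j))) := hfinX.mul hfin3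
  have hfin5 : HasFiniteMulSupport fun ν : Pl K => auxW p ν * ((∏ i, lsup ν (pt s (y i) (z i))) *
    ((max 1 (nrm ν s))⁻¹ * ∏ j, min 1 (nrm ν (s - P.r j)))) := hfinA.mul hfin4
  have hfin6 : HasFiniteMulSupport fun ν : Pl K => P.locConst ν * (auxW p ν *
    ((∏ i, lsup ν (pt s (y i) (z i))) *
      ((max 1 (nrm ν s))⁻¹ * ∏ j, min 1 (nrm ν (s - P.r j))))) := hfinC.mul hfin5
  have hloc : ∀ ν, nrm ν (colMat y z).det ≤ P.locConst ν * (auxW p ν *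
      ((∏ i, lsup ν (pt s (y i) (z i))) *
        ((max 1 (nrm ν s))⁻¹ * ∏ j, min 1 (nrm ν (s - P.r j))))) := by
    intro ν
    rw [← hprox]
    have hgen := P.det_bound_prox ν hs hq (hsz ν)
    rcases ν with w | v
    · simpa [auxW] using hgen
    · rcases (finitePlace_natCast_le_one v p).lt_or_eq with hlt | heq
      · obtain ⟨h1, h2, h3⟩ := hpv v hlt
        rw [hprox]
        simp only [nrm_inr, h3, max_eq_left h2, min_self, Finset.prod_const_one, inv_one, mul_one]
        refine h1.trans (le_mul_of_one_le_left ?_ (P.one_le_locConst _))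
        exact mul_nonneg (pow_nonneg (apply_nonneg _ _) _)
          (Finset.prod_nonneg fun i _ => lsup_nonneg _ _)
      · simpa [auxW, heq] using hgen
  have hglob := gprod_le (hasFinite_nrm hdet) hfin6 (fun ν => nrm_nonneg _ _) hloc
  rw [product_formula hdet, finprod_mul_distrib hfinC hfin5,
    finprod_mul_distrib hfinA hfin4,
    finprod_mul_distrib hfinX hfin3, finprod_mul_distrib hfin1 hfin2,
    gprod_auxW hp, finprod_inv_distrib, ← mulHeight₁_eq_gprod,
    finprod_prod_comm _ _ fun j _ => hasFinite_min_one (sub_ne_zero.2 (hs j)),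
    finprod_prod_comm _ _ fun i _ => hasFinite_lsup (pt_ne_zero s (y i) (z i))] at hglob
  simp_rw [← mulHeight_eq_gprod (pt_ne_zero s _ _), gprod_min_one (sub_ne_zero.2 (hs _))] at hglob
  rw [Finset.prod_inv_distrib] at hglob
  have hH0 := mulHeight₁_pos s
  have hD0 : 0 < ∏ j, mulHeight₁ (s - P.r j) := Finset.prod_pos fun j _ => mulHeight₁_pos _
  have hpp : (0 : ℝ) < (p : ℝ) ^ (3 * Module.finrank ℚ K) := by
    have : (0 : ℝ) < p := by exact_mod_cast Nat.pos_of_ne_zero hp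
    positivity
  have h1 : (p : ℝ) ^ (3 * Module.finrank ℚ K) * (mulHeight₁ s * ∏ j, mulHeight₁ (s - P.r j)) ≤
      C₁ * ∏ i, mulHeight (pt s (y i) (z i)) := by
    have := mul_le_mul_of_nonneg_right hglob
      (mul_pos hpp (mul_pos hH0 hD0)).le
    rw [one_mul] at this
    refine this.trans (le_of_eq ?_)
    rw [hC₁]
    field_simp
  have h2 : mulHeight₁ s ^ 4 ≤ (∏ j, mulHeight₁ (s - P.r j)) * ∏ j, (t * mulHeight₁ (P.r j)) := by
    rw [← Finset.prod_mul_distrib]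
    have : mulHeight₁ s ^ 4 = ∏ _j : Fin 4, mulHeight₁ s := by simp
    rw [this]
    refine Finset.prod_le_prod (fun _ _ => hH0.le) fun j _ => ?_
    have := mulHeight₁_add_le (s - P.r j) (P.r j)
    rw [sub_add_cancel, totalWeight_eq_finrank] at this
    refine this.trans (le_of_eq ?_)
    rw [ht]; ring
  have hR0 : 0 ≤ ∏ j, (t * mulHeight₁ (P.r j)) :=
    Finset.prod_nonneg fun j _ => (mul_pos ht0 (mulHeight₁_pos _)).le
  calc mulHeight₁ s ^ 5 * (p : ℝ) ^ (3 * Module.finrank ℚ K)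
      = (p : ℝ) ^ (3 * Module.finrank ℚ K) * (mulHeight₁ s * mulHeight₁ s ^ 4) := by ring
    _ ≤ (p : ℝ) ^ (3 * Module.finrank ℚ K) * (mulHeight₁ s *
        ((∏ j, mulHeight₁ (s - P.r j)) * ∏ j, (t * mulHeight₁ (P.r j)))) := by gcongr
    _ = ((p : ℝ) ^ (3 * Module.finrank ℚ K) * (mulHeight₁ s * ∏ j, mulHeight₁ (s - P.r j))) *
        ∏ j, (t * mulHeight₁ (P.r j)) := by ring
    _ ≤ (C₁ * ∏ i, mulHeight (pt s (y i) (z i))) * ∏ j, (t * mulHeight₁ (P.r j)) := by gcongr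
    _ = _ := by ring

end Global

section Labels

variable {K : Type*} [Field K] [NumberField K] {c : Cf K} (P : Splitting c)

lemma exists_zpow_eq (v : FinitePlace K) {x : K} (hx : x ≠ 0) :
    ∃ n : ℤ, v x = (Ideal.absNorm v.maximalIdeal.asIdeal : ℝ) ^ n := by
  have hq : (Ideal.absNorm v.maximalIdeal.asIdeal : ℝ) ≠ 0 := by
    have := HeightOneSpectrum.one_lt_absNorm v.maximalIdeal
    positivity
  have h_integral : ∀ a : 𝓞 K, a ≠ 0 →
      ∃ n : ℤ, v (a : K) = (Ideal.absNorm v.maximalIdeal.asIdeal : ℝ) ^ n := fun a ha => by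
    have h := FinitePlace.apply_mul_absNorm_pow_eq_one v ha
    refine ⟨-(multiplicity v.maximalIdeal.asIdeal (Ideal.span {a}) : ℕ), ?_⟩
    rw [zpow_neg, zpow_natCast]
    exact eq_inv_of_mul_eq_one_left h
  obtain ⟨a, b, hb, rfl⟩ := IsFractionRing.div_surjective (A := 𝓞 K) x
  have hb0 : b ≠ 0 := nonZeroDivisors.ne_zero hb
  have ha0 : a ≠ 0 := fun h => hx (by rw [h, map_zero, zero_div])
  obtain ⟨n, hn⟩ := h_integral a ha0
  obtain ⟨m, hm⟩ := h_integral b hb0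
  refine ⟨n - m, ?_⟩
  rw [map_div₀, zpow_sub₀ hq, ← hn, ← hm]

/-- The base used to discretize sizes at a place. -/
noncomputable def base : Pl K → ℝ
  | .inl _ => 4
  | .inr v => Ideal.absNorm v.maximalIdeal.asIdeal

lemma two_le_base (ν : Pl K) : 2 ≤ base ν := by
  rcases ν with w | v
  · norm_num [base]
  · have := HeightOneSpectrum.one_lt_absNorm v.maximalIdeal
    simp only [base]
    exact_mod_cast this

/-- The discretized logarithm of a number in `(0, 1]`. -/
noncomputable def dlog (ν : Pl K) (t : ℝ) : ℕ := ⌊-Real.log t / Real.log (base ν)⌋₊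

lemma log_base_pos (ν : Pl K) : 0 < Real.log (base ν) :=
  Real.log_pos (by linarith [two_le_base ν])

lemma dlog_anti (ν : Pl K) {t u : ℝ} (ht : 0 < t) (h : t ≤ u) : dlog ν u ≤ dlog ν t := by
  refine Nat.floor_le_floor ?_
  have := log_base_pos ν
  have := Real.log_le_log ht h
  gcongr

lemma dlog_one (ν : Pl K) : dlog ν 1 = 0 := by simp [dlog]

lemma le_base_mul_of_dlog_eq (ν : Pl K) {t u : ℝ} (ht : 0 < t) (ht1 : t ≤ 1) (hu : 0 < u)
    (h : dlog ν t = dlog ν u) : t ≤ base ν * u ∧ t ≠ base ν * u := by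
  have hb := log_base_pos ν
  have hb0 : 0 < base ν := by linarith [two_le_base ν]
  have h1 : (dlog ν t : ℝ) ≤ -Real.log t / Real.log (base ν) :=
    Nat.floor_le (div_nonneg (neg_nonneg.2 (Real.log_nonpos ht.le ht1)) hb.le)
  have h2 : -Real.log u / Real.log (base ν) < dlog ν u + 1 := Nat.lt_floor_add_one _
  rw [h] at h1
  rw [le_div_iff₀ hb] at h1
  rw [div_lt_iff₀ hb] at h2
  have h3 : Real.log t < Real.log (base ν * u) := by
    rw [Real.log_mul hb0.ne' hu.ne']
    linarith
  have h4 := (Real.log_lt_log_iff ht (mul_pos hb0 hu)).1 h3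
  exact ⟨h4.le, h4.ne⟩

lemma Splitting.size_le_one (ν : Pl K) (j : Fin 4) (s y z : K) : P.size ν j s y z ≤ 1 :=
  min_le_left _ _

lemma Splitting.prox_le_size (ν : Pl K) (j : Fin 4) (s y z : K) :
    min 1 (nrm ν (s - P.r j)) ≤ P.size ν j s y z :=
  le_min (min_le_left _ _) (le_max_right _ _)

lemma Splitting.exists_size_eq (v : FinitePlace K) (j : Fin 4) {s : K} (hs : s ≠ P.r j)
    (y z : K) : ∃ t : K, t ≠ 0 ∧ P.size (.inr v) j s y z = v t := by
  have hpos := P.size_pos (.inr v) j y z hs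
  have : ∃ t : K, P.size (.inr v) j s y z = v t := by
    obtain ⟨i, hi⟩ := exists_lsup_eq (.inr v) (pt s y z)
    simp only [Splitting.size, hi, nrm_inr]
    rw [← map_div₀]
    rcases min_choice 1 (max (v ((P.L j).mulVec ![1, y, z] 0 / pt s y z i))
      (min 1 (v (s - P.r j)))) with h | h <;> rw [h]
    · exact ⟨1, by simp⟩
    · rcases max_choice (v ((P.L j).mulVec ![1, y, z] 0 / pt s y z i))
        (min 1 (v (s - P.r j))) with h | h <;> rw [h]
      · exact ⟨_, rfl⟩
      · rcases min_choice 1 (v (s - P.r j)) with h | h <;> rw [h]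
        · exact ⟨1, by simp⟩
        · exact ⟨_, rfl⟩
  obtain ⟨t, ht⟩ := this
  refine ⟨t, fun h => ?_, ht⟩
  rw [ht, h, map_zero] at hpos
  exact lt_irrefl _ hpos

lemma Splitting.size_le_of_dlog_eq (ν : Pl K) (j : Fin 4) {s : K} (hs : s ≠ P.r j)
    (y z y' z' : K) (h : dlog ν (P.size ν j s y z) = dlog ν (P.size ν j s y' z')) :
    P.size ν j s y z ≤ kap ν * P.size ν j s y' z' := by
  have key := le_base_mul_of_dlog_eq ν (P.size_pos ν j y z hs) (P.size_le_one ν j s y z)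
    (P.size_pos ν j y' z' hs) h
  rcases ν with w | v
  · exact key.1
  · obtain ⟨t, ht0, ht⟩ := P.exists_size_eq v j hs y z
    obtain ⟨u, hu0, hu⟩ := P.exists_size_eq v j hs y' z'
    obtain ⟨n, hn⟩ := exists_zpow_eq v ht0
    obtain ⟨m, hm⟩ := exists_zpow_eq v hu0
    have hb := two_le_base (.inr v : Pl K)
    rw [ht, hu, hn, hm] at key ⊢
    simp only [base, kap, one_mul] at key hb ⊢
    set b : ℝ := (Ideal.absNorm v.maximalIdeal.asIdeal : ℝ)
    have hb1 : 1 < b := by linarith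
    rw [← zpow_one_add₀ (by linarith : b ≠ 0)] at key
    have h1 := lt_of_le_of_ne key.1 key.2
    rw [zpow_lt_zpow_iff_right₀ hb1] at h1
    exact zpow_le_zpow_right₀ hb1.le (by omega)

/-- The constant bounding the number of discretized sizes. -/
noncomputable def labConst (ε : ℝ) (ν : Pl K) : ℝ :=
  if 2 ≤ base ν ^ ε then 1 else max 1 (ε * Real.log 2)⁻¹

lemma labConst_pos (ε : ℝ) (ν : Pl K) : 0 < labConst ε ν := by
  unfold labConst
  split_ifs
  · exact one_pos
  · exact lt_of_lt_of_le one_pos (le_max_left _ _)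

lemma hasFinite_labConst {ε : ℝ} (hε : 0 < ε) :
    HasFiniteMulSupport (labConst ε : Pl K → ℝ) := by
  refine hasFinite_of_inr ?_
  have hfin := (finite_ideals (k := K) ((2 : ℝ) ^ ε⁻¹)).preimage
    (f := fun v : FinitePlace K => v.maximalIdeal.asIdeal) (fun a _ b _ hab =>
      FinitePlace.maximalIdeal_injective (IsDedekindDomain.HeightOneSpectrum.ext hab))
  refine hfin.subset fun v hv => ?_
  simp only [mem_mulSupport, labConst] at hv
  have h2 : ¬ 2 ≤ base (.inr v : Pl K) ^ ε := fun h => hv (by rw [if_pos h])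
  have hb := two_le_base (.inr v : Pl K)
  push Not at h2
  have := Real.rpow_le_rpow (by positivity) h2.le (inv_nonneg.2 hε.le)
  rw [← Real.rpow_mul (by linarith), mul_inv_cancel₀ hε.ne', Real.rpow_one] at this
  exact this

lemma dlog_add_one_le {ε : ℝ} (hε : 0 < ε) (ν : Pl K) {t : ℝ} (ht : 0 < t) (ht1 : t ≤ 1) :
    (dlog ν t : ℝ) + 1 ≤ labConst ε ν * t⁻¹ ^ ε := by
  have hb := log_base_pos ν
  have hb0 : 0 < base ν := by linarith [two_le_base ν]
  have h1 : (dlog ν t : ℝ) ≤ -Real.log t / Real.log (base ν) :=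
    Nat.floor_le (div_nonneg (neg_nonneg.2 (Real.log_nonpos ht.le ht1)) hb.le)
  rw [le_div_iff₀ hb] at h1
  have h2 : (base ν ^ ε) ^ (dlog ν t) ≤ t⁻¹ ^ ε := by
    rw [← Real.rpow_natCast, ← Real.rpow_mul hb0.le, mul_comm, Real.rpow_mul hb0.le]
    refine Real.rpow_le_rpow (by positivity) ?_ hε.le
    rw [← Real.log_le_log_iff (by positivity) (inv_pos.2 ht), Real.log_inv,
      Real.log_rpow hb0]
    exact h1
  have h3 : 1 ≤ t⁻¹ ^ ε := Real.one_le_rpow ((one_le_inv₀ ht).2 ht1) hε.le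
  unfold labConst
  split_ifs with h
  · rw [one_mul]
    refine le_trans ?_ h2
    refine le_trans ?_ (pow_le_pow_left₀ (by norm_num) h _)
    exact_mod_cast Nat.lt_two_pow_self
  · have hl : 0 < ε * Real.log 2 := mul_pos hε (Real.log_pos (by norm_num))
    have h4 : 1 + (dlog ν t) * (ε * Real.log 2) ≤ t⁻¹ ^ ε := by
      refine le_trans ?_ h2
      have h5 : 1 + (-1 + base ν ^ ε) * (dlog ν t : ℝ) ≤ (1 + (-1 + base ν ^ ε)) ^ dlog ν t := by
        have := one_add_mul_le_pow (a := -1 + base ν ^ ε)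
          (by have : 0 < base ν ^ ε := by positivity
              linarith) (dlog ν t)
        linarith
      rw [add_neg_cancel_left] at h5
      refine le_trans ?_ h5
      have h6 : ε * Real.log 2 ≤ -1 + base ν ^ ε := by
        have h7 : ε * Real.log 2 ≤ ε * Real.log (base ν) := by
          gcongr; exact two_le_base ν
        have h8 := Real.add_one_le_exp (Real.log (base ν) * ε)
        rw [← Real.rpow_def_of_pos hb0] at h8
        linarith
      nlinarith [(Nat.cast_nonneg (dlog ν t) : (0 : ℝ) ≤ _)]
    calc (dlog ν t : ℝ) + 1 ≤ max 1 (ε * Real.log 2)⁻¹ * (1 + (dlog ν t) * (ε * Real.log 2)) := by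
          rw [mul_add, mul_one]
          have h9 : (dlog ν t : ℝ) = (ε * Real.log 2)⁻¹ * ((dlog ν t) * (ε * Real.log 2)) := by
            field_simp
          have h10 : (ε * Real.log 2)⁻¹ * ((dlog ν t) * (ε * Real.log 2)) ≤
              max 1 (ε * Real.log 2)⁻¹ * ((dlog ν t) * (ε * Real.log 2)) := by
            gcongr; exact le_max_right _ _
          have h11 := le_max_left 1 (ε * Real.log 2)⁻¹
          linarith
      _ ≤ _ := by gcongr

lemma gprod_rpow {φ : Pl K → ℝ} (h : HasFiniteMulSupport φ) (h0 : ∀ ν, 0 ≤ φ ν) (ε : ℝ) :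
    ∏ᶠ ν, φ ν ^ ε = (∏ᶠ ν, φ ν) ^ ε := by
  rw [finprod_eq_prod_of_mulSupport_subset φ (s := h.toFinset)
      (fun x hx => (Set.Finite.mem_toFinset h).2 hx),
    finprod_eq_prod_of_mulSupport_subset (fun ν => φ ν ^ ε) (s := h.toFinset) (fun x hx =>
      (Set.Finite.mem_toFinset h).2 fun h' => hx (by simp only [h', Real.one_rpow])),
    Real.finsetProd_rpow _ _ fun i _ => h0 i]

theorem Splitting.exists_labels {ε : ℝ} (hε : 0 < ε) : ∃ C > 0, ∀ s : K, (∀ j, s ≠ P.r j) →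
    ∃ (T : Finset (Pl K × Fin 4 →₀ ℕ)) (lab : K → K → (Pl K × Fin 4 →₀ ℕ)),
      (∀ y z, lab y z ∈ T) ∧ (T.card : ℝ) ≤ C * mulHeight₁ s ^ ε ∧
      ∀ y z y' z', lab y z = lab y' z' →
        ∀ ν j, P.size ν j s y z ≤ kap ν * P.size ν j s y' z' := by
  classical
  set η := ε / 4 with hη
  have hη0 : 0 < η := by positivity
  set A := ∏ᶠ ν : Pl K, labConst η ν with hA
  have hA0 : 0 < A := gprod_pos fun ν => labConst_pos η ν
  set t : ℝ := 2 ^ Module.finrank ℚ K with ht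
  have ht0 : 0 < t := by positivity
  refine ⟨∏ j, (A * (t * mulHeight₁ (P.r j)) ^ η), Finset.prod_pos fun j _ => mul_pos hA0
    (Real.rpow_pos_of_pos (mul_pos ht0 (mulHeight₁_pos _)) _), fun s hs => ?_⟩
  set δ : Pl K → Fin 4 → ℝ := fun ν j => min 1 (nrm ν (s - P.r j)) with hδ
  have hδ0 : ∀ ν j, 0 < δ ν j := fun ν j => lt_min one_pos (nrm_pos ν (sub_ne_zero.2 (hs j)))
  have hδ1 : ∀ ν j, δ ν j ≤ 1 := fun ν j => min_le_left _ _
  have hδf : ∀ j, HasFiniteMulSupport fun ν => δ ν j := fun j =>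
    hasFinite_min_one (sub_ne_zero.2 (hs j))
  set S : Finset (Pl K) := Finset.univ.biUnion fun j => (hδf j).toFinset with hS
  have hSm : ∀ ν ∉ S, ∀ j, δ ν j = 1 := fun ν hν j => by
    by_contra h
    exact hν (Finset.mem_biUnion.2 ⟨j, Finset.mem_univ _, (Set.Finite.mem_toFinset _).2 h⟩)
  have hzero : ∀ (f : Pl K × Fin 4 → ℝ), (∀ i, δ i.1 i.2 ≤ f i) → (∀ i, f i ≤ 1) →
      ∀ i, dlog i.1 (f i) ≠ 0 → i ∈ S ×ˢ (Finset.univ : Finset (Fin 4)) := by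
    intro f h1 h2 i hi
    rw [Finset.mem_product]
    refine ⟨?_, Finset.mem_univ _⟩
    by_contra h
    have h3 := h1 i
    rw [hSm i.1 h i.2] at h3
    exact hi (by rw [le_antisymm (h2 i) h3, dlog_one])
  set bnd : Pl K × Fin 4 →₀ ℕ := Finsupp.onFinset (S ×ˢ Finset.univ)
    (fun i => dlog i.1 (δ i.1 i.2)) (hzero _ (fun _ => le_rfl) (fun i => hδ1 _ _)) with hbnd
  refine ⟨Finset.Iic bnd, fun y z => Finsupp.onFinset (S ×ˢ Finset.univ)
    (fun i => dlog i.1 (P.size i.1 i.2 s y z))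
    (hzero (fun i => P.size i.1 i.2 s y z) (fun i => P.prox_le_size _ _ _ _ _)
      (fun i => P.size_le_one _ _ _ _ _)), ?_, ?_, ?_⟩
  · intro y z
    rw [Finset.mem_Iic]
    intro i
    simp only [hbnd, Finsupp.onFinset_apply]
    exact dlog_anti _ (hδ0 _ _) (P.prox_le_size _ _ _ _ _)
  · rw [Finsupp.card_Iic]
    have h1 : ∏ i ∈ bnd.support, (Finset.Iic (bnd i)).card =
        ∏ i ∈ S ×ˢ (Finset.univ : Finset (Fin 4)), (bnd i + 1) := by
      simp only [Nat.card_Iic]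
      refine Finset.prod_subset (fun i hi => Finsupp.support_onFinset_subset hi) fun i _ hi => ?_
      rw [Finsupp.notMem_support_iff.1 hi, zero_add]
    rw [h1]
    push_cast
    rw [Finset.prod_product_right]
    have hmul : mulHeight₁ s ^ ε = ∏ _j : Fin 4, mulHeight₁ s ^ η := by
      rw [Finset.prod_const, Finset.card_univ, Fintype.card_fin, ← Real.rpow_natCast,
        ← Real.rpow_mul (mulHeight₁_pos s).le, hη]
      norm_num
    rw [hmul, ← Finset.prod_mul_distrib]
    refine Finset.prod_le_prod (fun j _ => Finset.prod_nonneg fun i _ => by positivity) fun j _ => ?_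
    have hf1 : HasFiniteMulSupport fun ν : Pl K => (δ ν j)⁻¹ := (hδf j).inv
    have hf2 : HasFiniteMulSupport fun ν : Pl K => (δ ν j)⁻¹ ^ η :=
      hf1.subset fun ν hν h => hν (by simp only [h, Real.one_rpow])
    have hf3 : HasFiniteMulSupport fun ν : Pl K => labConst η ν := hasFinite_labConst hη0
    have hsub : (mulSupport fun ν => ((bnd (ν, j) : ℝ) + 1)) ⊆ S := by
      intro ν hν
      by_contra h
      refine hν ?_
      simp only [hbnd, Finsupp.onFinset_apply]
      rw [hSm ν h j, dlog_one]; simp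
    have hf4 : HasFiniteMulSupport fun ν => ((bnd (ν, j) : ℝ) + 1) :=
      S.finite_toSet.subset hsub
    rw [← finprod_eq_prod_of_mulSupport_subset _ hsub]
    have hf5 : HasFiniteMulSupport fun ν : Pl K => labConst η ν * (δ ν j)⁻¹ ^ η := hf3.mul hf2
    refine (gprod_le hf4 hf5 (fun ν => by positivity) fun ν =>
      dlog_add_one_le hη0 ν (hδ0 ν j) (hδ1 ν j)).trans ?_
    rw [finprod_mul_distrib hf3 hf2, gprod_rpow hf1 (fun ν => inv_nonneg.2 (hδ0 ν j).le),
      finprod_inv_distrib, gprod_min_one (sub_ne_zero.2 (hs j)), inv_inv, mul_assoc]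
    refine mul_le_mul_of_nonneg_left ?_ hA0.le
    rw [← Real.mul_rpow (mul_pos ht0 (mulHeight₁_pos _)).le (mulHeight₁_pos _).le]
    refine Real.rpow_le_rpow (mulHeight₁_pos _).le ?_ hη0.le
    have := mulHeight₁_sub_le s (P.r j)
    rw [totalWeight_eq_finrank] at this
    refine this.trans (le_of_eq ?_)
    rw [ht]; ring
  · intro y z y' z' h ν j
    refine P.size_le_of_dlog_eq ν j (hs j) y z y' z' ?_
    have := DFunLike.congr_fun h (ν, j)
    simpa only [Finsupp.onFinset_apply] using this

end Labels

section FiniteConic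

lemma quad_eq_zero {κ : Type*} [Field κ] {f g h : κ} (h0 : Polynomial.C f * Polynomial.X ^ 2 +
    Polynomial.C g * Polynomial.X + Polynomial.C h = 0) : f = 0 ∧ g = 0 ∧ h = 0 := by
  refine ⟨?_, ?_, ?_⟩
  · simpa [Polynomial.coeff_X, Polynomial.coeff_C] using congrArg (fun r => Polynomial.coeff r 2) h0
  · simpa [Polynomial.coeff_X, Polynomial.coeff_C] using congrArg (fun r => Polynomial.coeff r 1) h0
  · simpa [Polynomial.coeff_X, Polynomial.coeff_C] using congrArg (fun r => Polynomial.coeff r 0) h0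

/-- A non-degenerate affine conic over a finite field with `n` elements has at most `3 n` points. -/
lemma conic_count {κ : Type*} [Field κ] [Fintype κ] [DecidableEq κ] (a b c d e f : κ)
    (h : 4 * a * d * f + b * c * e - a * e ^ 2 - c ^ 2 * d - b ^ 2 * f ≠ 0) :
    (Finset.univ.filter fun w : κ × κ =>
      a + b * w.1 + c * w.2 + d * w.1 ^ 2 + e * w.1 * w.2 + f * w.2 ^ 2 = 0).card ≤
      3 * Fintype.card κ := by
  classical
  set S := Finset.univ.filter fun w : κ × κ =>
      a + b * w.1 + c * w.2 + d * w.1 ^ 2 + e * w.1 * w.2 + f * w.2 ^ 2 = 0 with hS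
  have h1 : S.card = ∑ y : κ, (S.filter fun w => w.1 = y).card :=
    Finset.card_eq_sum_card_fiberwise fun _ _ => Finset.mem_coe.2 (Finset.mem_univ _)
  obtain ⟨y0, hy0⟩ : ∃ y0 : κ, ∀ y, y ≠ y0 → ¬ (f = 0 ∧ c + e * y = 0 ∧ a + b * y + d * y ^ 2 = 0) := by
    by_cases he : e = 0
    · refine ⟨0, fun y _ ⟨h1, h2, h3⟩ => h ?_⟩
      rw [h1, he] at *
      have : c = 0 := by linear_combination h2
      rw [this]; ring
    · refine ⟨-c / e, fun y hy ⟨h1, h2, h3⟩ => hy ?_⟩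
      rw [eq_div_iff he]; linear_combination h2
  have h2 : ∀ y : κ, (S.filter fun w => w.1 = y).card ≤ 2 + if y = y0 then Fintype.card κ else 0 := by
    intro y
    have hinj : (S.filter fun w => w.1 = y).card = ((S.filter fun w => w.1 = y).image Prod.snd).card := by
      rw [Finset.card_image_of_injOn]
      rintro ⟨w1, w2⟩ hw ⟨w1', w2'⟩ hw' heq
      simp only [Finset.mem_coe, Finset.mem_filter] at hw hw' heq
      rw [Prod.mk.injEq]
      exact ⟨hw.2.trans hw'.2.symm, heq⟩
    rw [hinj]
    split_ifs with hy
    · exact (Finset.card_le_univ _).trans (by omega)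
    · set p : Polynomial κ := Polynomial.C f * Polynomial.X ^ 2 + Polynomial.C (c + e * y) * Polynomial.X +
        Polynomial.C (a + b * y + d * y ^ 2) with hp
      have hp0 : p ≠ 0 := by
        intro h0
        exact hy0 y hy (quad_eq_zero h0)
      have hsub : ((S.filter fun w => w.1 = y).image Prod.snd) ⊆ p.roots.toFinset := by
        intro z hz
        obtain ⟨⟨w1, w2⟩, hw, rfl⟩ := Finset.mem_image.1 hz
        simp only [hS, Finset.mem_filter, Finset.mem_univ, true_and] at hw
        obtain ⟨hw, rfl⟩ := hw
        rw [Multiset.mem_toFinset, Polynomial.mem_roots hp0, Polynomial.IsRoot]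
        simp only [hp, Polynomial.eval_add, Polynomial.eval_mul, Polynomial.eval_C,
          Polynomial.eval_pow, Polynomial.eval_X]
        linear_combination hw
      calc _ ≤ p.roots.toFinset.card := Finset.card_le_card hsub
        _ ≤ Multiset.card p.roots := Multiset.toFinset_card_le _
        _ ≤ p.natDegree := Polynomial.card_roots' _
        _ ≤ 2 := Polynomial.natDegree_quadratic_le
  rw [h1]
  refine (Finset.sum_le_sum fun y _ => h2 y).trans ?_
  rw [Finset.sum_add_distrib]
  simp only [Finset.sum_const, Finset.card_univ, Finset.sum_ite_eq', Finset.mem_univ, if_true,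
    smul_eq_mul]
  omega

namespace Cf

variable {R S : Type*} [CommRing R] [CommRing S]

/-- Image of the coefficients under a ring homomorphism. -/
def map (f : R →+* S) (c : Cf R) : Cf S :=
  ⟨f c.a0, f c.a1, f c.a2, f c.a3, f c.b0, f c.b1, f c.b2, f c.c0, f c.c1, f c.c2, f c.d0, f c.d1,
    f c.e0, f c.e1, f c.f0, f c.f1⟩

lemma map_q (f : R →+* S) (c : Cf R) (s x y z : R) :
    (c.map f).q (f s) (f x) (f y) (f z) = f (c.q s x y z) := by
  simp [map, q, A, B, C, D, E, F]

lemma map_disc (f : R →+* S) (c : Cf R) (s : R) : (c.map f).disc (f s) = f (c.disc s) := by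
  simp [map, disc, A, B, C, D, E, F, map_ofNat]

lemma map_map {T : Type*} [CommRing T] (g : S →+* T) (f : R →+* S) (c : Cf R) :
    (c.map f).map g = c.map (g.comp f) := rfl

/-- The conic evaluated at a vector. -/
def qv (c : Cf R) (s : R) (u : Fin 3 → R) : R := c.q s (u 0) (u 1) (u 2)

lemma qv_smul (c : Cf R) (s t : R) (u : Fin 3 → R) : c.qv s (t • u) = t ^ 2 * c.qv s u := by
  simp [qv, q]; ring

/-- The polar bilinear form of the conic. -/
def polar (c : Cf R) (s : R) (u v : Fin 3 → R) : R :=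
  2 * c.A s * u 0 * v 0 + c.B s * (u 0 * v 1 + u 1 * v 0) + c.C s * (u 0 * v 2 + u 2 * v 0) +
    2 * c.D s * u 1 * v 1 + c.E s * (u 1 * v 2 + u 2 * v 1) + 2 * c.F s * u 2 * v 2

lemma qv_sub (c : Cf R) (s : R) (u v : Fin 3 → R) :
    c.qv s (u - v) = c.qv s u + c.qv s v - c.polar s u v := by
  simp [qv, q, polar]; ring

/-- The determinant of the Gram matrix of three vectors. -/
lemma gram (c : Cf R) (s : R) (u v w : Fin 3 → R) :
    4 * c.qv s u * c.qv s v * c.qv s w + c.polar s u v * c.polar s u w * c.polar s v w -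
      c.qv s u * c.polar s v w ^ 2 - c.qv s v * c.polar s u w ^ 2 - c.qv s w * c.polar s u v ^ 2 =
    c.disc s * (Matrix.of ![u, v, w]).det ^ 2 := by
  rw [Matrix.det_fin_three]
  simp only [qv, q, polar, disc, Matrix.of_apply, Matrix.cons_val_zero, Matrix.cons_val_one,
    Matrix.cons_val]
  generalize c.A s = A
  generalize c.B s = B
  generalize c.C s = C
  generalize c.D s = D
  generalize c.E s = E
  generalize c.F s = F
  ring

end Cf

open Classical in
lemma conic_chart_count {κ : Type*} [Field κ] [Fintype κ] (c : Cf κ) (s : κ) (h : c.disc s ≠ 0)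
    (i : Fin 3) : (Finset.univ.filter fun u : Fin 3 → κ => u i = 1 ∧ c.qv s u = 0).card ≤
      3 * Fintype.card κ := by
  fin_cases i
  · refine le_trans ?_ (conic_count (c.A s) (c.B s) (c.C s) (c.D s) (c.E s) (c.F s) h)
    refine Finset.card_le_card_of_injOn (fun u => (u 1, u 2)) (fun u hu => ?_) fun u hu v hv huv => ?_
    · rw [Finset.mem_coe, Finset.mem_filter] at hu ⊢
      simp only [Finset.mem_univ, true_and, Fin.zero_eta, Cf.qv, Cf.q] at hu ⊢
      have h1 := hu.2
      rw [hu.1] at h1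
      linear_combination h1
    · simp only [Finset.mem_coe, Finset.mem_filter, Finset.mem_univ, true_and, Fin.zero_eta,
        Prod.mk.injEq] at hu hv huv
      ext j; fin_cases j
      · exact hu.1.trans hv.1.symm
      · exact huv.1
      · exact huv.2
  · refine le_trans ?_ (conic_count (c.D s) (c.B s) (c.E s) (c.A s) (c.C s) (c.F s) (fun h' => h ?_))
    · refine Finset.card_le_card_of_injOn (fun u => (u 0, u 2)) (fun u hu => ?_) fun u hu v hv huv => ?_
      · rw [Finset.mem_coe, Finset.mem_filter] at hu ⊢
        simp only [Finset.mem_univ, true_and, Fin.mk_one, Cf.qv, Cf.q] at hu ⊢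
        have h1 := hu.2
        rw [hu.1] at h1
        linear_combination h1
      · simp only [Finset.mem_coe, Finset.mem_filter, Finset.mem_univ, true_and, Fin.mk_one,
          Prod.mk.injEq] at hu hv huv
        ext j; fin_cases j
        · exact huv.1
        · exact hu.1.trans hv.1.symm
        · exact huv.2
    · rw [← h', Cf.disc]; ring
  · refine le_trans ?_ (conic_count (c.F s) (c.C s) (c.E s) (c.A s) (c.B s) (c.D s) (fun h' => h ?_))
    · refine Finset.card_le_card_of_injOn (fun u => (u 0, u 1)) (fun u hu => ?_) fun u hu v hv huv => ?_
      · rw [Finset.mem_coe, Finset.mem_filter] at hu ⊢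
        simp only [Finset.mem_univ, true_and, Fin.reduceFinMk, Cf.qv, Cf.q] at hu ⊢
        have h1 := hu.2
        rw [hu.1] at h1
        linear_combination h1
      · simp only [Finset.mem_coe, Finset.mem_filter, Finset.mem_univ, true_and, Fin.reduceFinMk,
          Prod.mk.injEq] at hu hv huv
        ext j; fin_cases j
        · exact huv.1
        · exact huv.2
        · exact hu.1.trans hv.1.symm
    · rw [← h', Cf.disc]; ring

open Classical in
lemma conic_charts_count {κ : Type*} [Field κ] [Fintype κ] (c : Cf κ) (s : κ) (h : c.disc s ≠ 0) :
    (Finset.univ.filter fun w : Fin 3 × (Fin 3 → κ) => w.2 w.1 = 1 ∧ c.qv s w.2 = 0).card ≤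
      9 * Fintype.card κ := by
  rw [Finset.card_eq_sum_card_fiberwise (f := Prod.fst) (t := Finset.univ)
    fun _ _ => Finset.mem_coe.2 (Finset.mem_univ _)]
  have : ∀ i : Fin 3, ((Finset.univ.filter fun w : Fin 3 × (Fin 3 → κ) => w.2 w.1 = 1 ∧
      c.qv s w.2 = 0).filter fun w => w.1 = i).card ≤ 3 * Fintype.card κ := fun i => by
    refine le_trans ?_ (conic_chart_count c s h i)
    refine Finset.card_le_card_of_injOn Prod.snd (fun w hw => ?_) fun w hw w' hw' he => ?_
    · simp only [Finset.mem_coe, Finset.mem_filter, Finset.mem_univ, true_and] at hw ⊢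
      rw [← hw.2]; exact hw.1
    · simp only [Finset.mem_coe, Finset.mem_filter, Finset.mem_univ, true_and] at hw hw'
      exact Prod.ext (hw.2.trans hw'.2.symm) he
  refine (Finset.sum_le_sum fun i _ => this i).trans ?_
  simp only [Finset.sum_const, Finset.card_univ, Fintype.card_fin, smul_eq_mul]
  omega

end FiniteConic

section LocalLabel

open IsLocalRing

lemma ValuationSubring.exists_maximal {k : Type*} [Field k] (A : ValuationSubring k)
    {u : Fin 3 → k} (hu : u ≠ 0) : ∃ i, u i ≠ 0 ∧ ∀ j, u j / u i ∈ A := by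
  obtain ⟨i, hi⟩ := Finite.exists_max fun j => A.valuation (u j)
  have hi0 : u i ≠ 0 := by
    intro h0
    refine hu (funext fun j => ?_)
    have := hi j
    rw [h0, map_zero] at this
    exact (map_eq_zero _).1 (le_antisymm this zero_le)
  refine ⟨i, hi0, fun j => (A.valuation_le_one_iff _).1 ?_⟩
  rw [map_div₀]
  exact div_le_one_of_le₀ (hi j) zero_le

lemma exists_local_label {k : Type*} [Field k] (A : ValuationSubring k) [Finite (ResidueField A)]
    (c : Cf A) (s : A) (h : IsUnit (c.disc s)) :
    ∃ (lab : (Fin 3 → k) → ℕ) (idx : ℕ → Fin 3), ∀ u : Fin 3 → k, u ≠ 0 →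
      (c.map A.subtype).qv s u = 0 → lab u < 9 * Nat.card (ResidueField A) ∧
      u (idx (lab u)) ≠ 0 ∧ (∀ j, u j / u (idx (lab u)) ∈ A) ∧
      ∀ u', u' ≠ 0 → (c.map A.subtype).qv s u' = 0 → lab u = lab u' →
        ∀ j, A.valuation (u j / u (idx (lab u)) - u' j / u' (idx (lab u))) < 1 := by
  classical
  have := Fintype.ofFinite (ResidueField A)
  have hd : (c.map (residue A)).disc (residue A s) ≠ 0 := by
    rw [Cf.map_disc]
    exact (residue_ne_zero_iff_isUnit _).2 h
  have hT := conic_charts_count _ _ hd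
  set T := Finset.univ.filter fun w : Fin 3 × (Fin 3 → ResidueField A) => w.2 w.1 = 1 ∧
    (c.map (residue A)).qv (residue A s) w.2 = 0 with hTdef
  choose! i hi0 hiA using fun (u : Fin 3 → k) (hu : u ≠ 0) => ValuationSubring.exists_maximal A hu
  set red : (Fin 3 → k) → Fin 3 → ResidueField A := fun u j =>
    if h : u j / u (i u) ∈ A then residue A ⟨_, h⟩ else 0 with hred
  have hred' : ∀ u, u ≠ 0 → ∀ j, ∃ h : u j / u (i u) ∈ A, red u j = residue A ⟨_, h⟩ :=
    fun u hu j => ⟨hiA u hu j, by simp only [hred, dif_pos (hiA u hu j)]⟩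
  have hmem : ∀ u, u ≠ 0 → (c.map A.subtype).qv s u = 0 → (i u, red u) ∈ T := by
    intro u hu hq
    simp only [hTdef, Finset.mem_filter, Finset.mem_univ, true_and]
    constructor
    · obtain ⟨h1, h2⟩ := hred' u hu (i u)
      rw [h2, ← map_one (residue A)]
      congr 1
      exact Subtype.ext (div_self (hi0 u hu))
    · obtain ⟨h0, h0'⟩ := hred' u hu 0
      obtain ⟨h1, h1'⟩ := hred' u hu 1
      obtain ⟨h2, h2'⟩ := hred' u hu 2
      rw [Cf.qv, h0', h1', h2', Cf.map_q]
      have : c.q s ⟨_, h0⟩ ⟨_, h1⟩ ⟨_, h2⟩ = 0 := by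
        apply A.subtype_injective
        rw [← Cf.map_q, map_zero]
        have h3 := (c.map A.subtype).qv_smul s (u (i u))⁻¹ u
        rw [hq, mul_zero] at h3
        rw [← h3, Cf.qv]
        simp only [ValuationSubring.subtype_apply, Pi.smul_apply, smul_eq_mul, div_eq_inv_mul]
      rw [this, map_zero]
  set idx : ℕ → Fin 3 := fun n => if h : n < T.card then (T.equivFin.symm ⟨n, h⟩).1.1 else 0
  set lab : (Fin 3 → k) → ℕ := fun u => if h : (i u, red u) ∈ T then T.equivFin ⟨_, h⟩ else 0
  have hlab : ∀ u, u ≠ 0 → (c.map A.subtype).qv s u = 0 →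
      ∃ h : (i u, red u) ∈ T, lab u = T.equivFin ⟨_, h⟩ :=
    fun u hu hq => ⟨hmem u hu hq, by simp only [lab, dif_pos (hmem u hu hq)]⟩
  have hidx : ∀ u, u ≠ 0 → (c.map A.subtype).qv s u = 0 → idx (lab u) = i u := by
    intro u hu hq
    obtain ⟨h1, h2⟩ := hlab u hu hq
    simp only [idx, h2, Fin.is_lt, dite_true, Fin.eta, Equiv.symm_apply_apply]
  refine ⟨lab, idx, fun u hu hq => ⟨?_, ?_, ?_, ?_⟩⟩
  · obtain ⟨h1, h2⟩ := hlab u hu hq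
    rw [h2, Nat.card_eq_fintype_card]
    exact (Fin.is_lt _).trans_le hT
  · rw [hidx u hu hq]; exact hi0 u hu
  · rw [hidx u hu hq]; exact hiA u hu
  · intro u' hu' hq' hl j
    have hi : i u = i u' := by rw [← hidx u hu hq, hl, hidx u' hu' hq']
    have hr : red u = red u' := by
      obtain ⟨h1, h2⟩ := hlab u hu hq
      obtain ⟨h1', h2'⟩ := hlab u' hu' hq'
      rw [h2, h2'] at hl
      have := T.equivFin.injective (Fin.ext hl)
      exact (Prod.ext_iff.1 (Subtype.ext_iff.1 this)).2
    rw [hidx u hu hq]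
    nth_rewrite 2 [hi]
    obtain ⟨h1, h2⟩ := hred' u hu j
    obtain ⟨h1', h2'⟩ := hred' u' hu' j
    have h3 := congrFun hr j
    rw [h2, h2', ← sub_eq_zero, ← map_sub, residue_eq_zero_iff, A.valuation_lt_one_iff] at h3
    exact h3

end LocalLabel

section PrimeLabel

namespace Cf

variable {R : Type*} [CommRing R] (c : Cf R)

lemma sub_dvd_disc_sub (s r : R) : s - r ∣ c.disc s - c.disc r := by
  have h := Polynomial.sub_dvd_eval_sub s r ((c.map Polynomial.C).disc Polynomial.X)
  have he : ∀ t : R, Polynomial.eval t ((c.map Polynomial.C).disc Polynomial.X) = c.disc t := by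
    intro t
    have := Cf.map_disc (Polynomial.evalRingHom t) (c.map Polynomial.C) Polynomial.X
    rw [map_map] at this
    simp only [Polynomial.coe_evalRingHom, Polynomial.eval_X] at this
    rw [← this]
    congr 1
    simp [map]
  rwa [he, he] at h

lemma pow_dvd_disc_mul_det {s p : R} {u w : Fin 3 → Fin 3 → R} (hq : ∀ i, c.qv s (u i) = 0)
    (h0 : u 0 - u 1 = p • w 0) (h1 : u 0 - u 2 = p • w 1) (h2 : u 1 - u 2 = p • w 2) :
    p ^ 6 ∣ c.disc s * (Matrix.of u).det ^ 2 := by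
  have hp : ∀ i j l, u i - u j = p • w l → c.polar s (u i) (u j) = - (p ^ 2 * c.qv s (w l)) := by
    intro i j l h
    have h3 := c.qv_sub s (u i) (u j)
    rw [hq, hq, h, qv_smul] at h3
    linear_combination h3
  have hg := c.gram s (u 0) (u 1) (u 2)
  have hu : ![u 0, u 1, u 2] = u := by
    ext i; fin_cases i <;> rfl
  rw [hu, hq, hq, hq, hp _ _ _ h0, hp _ _ _ h1, hp _ _ _ h2] at hg
  rw [← hg]
  exact ⟨-(c.qv s (w 0) * c.qv s (w 1) * c.qv s (w 2)), by ring⟩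

end Cf

variable {k : Type*} [Field k] [NumberField k]

open IsDedekindDomain IsLocalRing HeightOneSpectrum

lemma card_residueField_atPrime (v : HeightOneSpectrum (𝓞 k)) :
    Nat.card (ResidueField (valuationSubringAtPrime k v)) = Ideal.absNorm v.asIdeal := by
  have e := IsLocalization.AtPrime.equivQuotMaximalIdeal v.asIdeal (valuationSubringAtPrime k v)
  rw [Ideal.absNorm_apply, Submodule.cardQuot_apply]
  exact Nat.card_congr e.symm.toEquiv

lemma mem_valuationSubringAtPrime (v : HeightOneSpectrum (𝓞 k)) (x : k) :
    x ∈ valuationSubringAtPrime k v ↔ v.valuation k x ≤ 1 := by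
  rw [valuationSubringAtPrime_eq_valuationSubring]; rfl

lemma valuation_lt_one_of_atPrime (v : HeightOneSpectrum (𝓞 k)) (x : k)
    (h : (valuationSubringAtPrime k v).valuation x < 1) : v.valuation k x < 1 := by
  by_cases hx : x = 0
  · rw [hx, map_zero]; exact zero_lt_one
  by_contra! h1
  have h2 : x⁻¹ ∈ valuationSubringAtPrime k v := by
    rw [mem_valuationSubringAtPrime, map_inv₀]
    exact inv_le_one_of_one_le₀ h1
  have h3 := (ValuationSubring.valuation_le_one_iff _ _).2 h2
  rw [map_inv₀] at h3
  have h4 : (valuationSubringAtPrime k v).valuation x ≠ 0 := (map_ne_zero _).2 hx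
  have := (inv_le_one₀ (zero_lt_iff.2 h4)).1 h3
  exact absurd h (not_lt.2 this)

lemma exists_prime_label (v : HeightOneSpectrum (𝓞 k)) (c : Cf (𝓞 k)) (s : k)
    (hs : v.valuation k s ≤ 1)
    (hd : v.valuation k ((c.map (algebraMap (𝓞 k) k)).disc s) = 1) :
    ∃ (lab : (Fin 3 → k) → ℕ) (idx : ℕ → Fin 3), ∀ u : Fin 3 → k, u ≠ 0 →
      (c.map (algebraMap (𝓞 k) k)).qv s u = 0 → lab u < 9 * Ideal.absNorm v.asIdeal ∧
      u (idx (lab u)) ≠ 0 ∧ (∀ j, v.valuation k (u j / u (idx (lab u))) ≤ 1) ∧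
      ∀ u', u' ≠ 0 → (c.map (algebraMap (𝓞 k) k)).qv s u' = 0 → lab u = lab u' →
        ∀ j, v.valuation k (u j / u (idx (lab u)) - u' j / u' (idx (lab u))) < 1 := by
  set A := valuationSubringAtPrime k v with hA
  have : Finite (ResidueField A) := by
    apply Nat.finite_of_card_ne_zero
    rw [card_residueField_atPrime]
    exact fun h => v.ne_bot (Ideal.absNorm_eq_zero_iff.1 h)
  have hc : (c.map (algebraMap (𝓞 k) A)).map A.subtype = c.map (algebraMap (𝓞 k) k) := rfl
  set s' : A := ⟨s, (mem_valuationSubringAtPrime v s).2 hs⟩ with hs'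
  have hdisc : A.subtype ((c.map (algebraMap (𝓞 k) A)).disc s') =
      (c.map (algebraMap (𝓞 k) k)).disc s := by
    rw [← Cf.map_disc, hc]; rfl
  have hu : IsUnit ((c.map (algebraMap (𝓞 k) A)).disc s') := by
    have hne : (c.map (algebraMap (𝓞 k) k)).disc s ≠ 0 := fun h => by simp [h] at hd
    have hinv : ((c.map (algebraMap (𝓞 k) k)).disc s)⁻¹ ∈ A := by
      rw [mem_valuationSubringAtPrime, map_inv₀, hd, inv_one]
    refine IsUnit.of_mul_eq_one ⟨_, hinv⟩ (A.subtype_injective ?_)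
    rw [map_mul, hdisc, map_one]
    exact mul_inv_cancel₀ hne
  obtain ⟨lab, idx, h⟩ := exists_local_label A (c.map (algebraMap (𝓞 k) A)) s' hu
  refine ⟨lab, idx, fun u hu hq => ?_⟩
  obtain ⟨h1, h2, h3, h4⟩ := h u hu hq
  rw [card_residueField_atPrime] at h1
  exact ⟨h1, h2, fun j => (mem_valuationSubringAtPrime v _).1 (h3 j), fun u' hu' hq' hl j =>
    valuation_lt_one_of_atPrime v _ (h4 u' hu' hq' hl j)⟩

variable {K : Type*} [Field K] [NumberField K] [Algebra k K]

/-- The prime of `k` below a finite place of `K`. -/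
noncomputable def below (k : Type*) [Field k] [NumberField k] [Algebra k K] (v : FinitePlace K) :
    HeightOneSpectrum (𝓞 k) :=
  HeightOneSpectrum.under (𝓞 k) v.maximalIdeal

lemma mem_below {v : FinitePlace K} {x : 𝓞 k} :
    x ∈ (below k v).asIdeal ↔ algebraMap (𝓞 k) (𝓞 K) x ∈ v.maximalIdeal.asIdeal := Iff.rfl

lemma finitePlace_le_one (v : FinitePlace K) (x : 𝓞 K) : v (x : K) ≤ 1 := by
  rw [← FinitePlace.norm_embedding_eq]; exact FinitePlace.norm_le_one K v.maximalIdeal x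

lemma finitePlace_lt_one_iff (v : FinitePlace K) (x : 𝓞 K) :
    v (x : K) < 1 ↔ x ∈ v.maximalIdeal.asIdeal := by
  rw [← FinitePlace.norm_embedding_eq]; exact FinitePlace.norm_lt_one_iff_mem K v.maximalIdeal x

lemma below_le_one (v : FinitePlace K) {x : k} (hx : (below k v).valuation k x ≤ 1) :
    v (algebraMap k K x) ≤ 1 := by
  obtain ⟨n, d, h⟩ := (below k v).exists_primeCompl_mul_eq_of_integer x hx
  have hd : v (algebraMap (𝓞 k) (𝓞 K) d : K) = 1 := by
    refine le_antisymm (finitePlace_le_one v _) ?_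
    by_contra! h1
    exact d.2 (mem_below.2 ((finitePlace_lt_one_iff v _).1 h1))
  have h2 : algebraMap k K x * (algebraMap (𝓞 k) (𝓞 K) d : K) = (algebraMap (𝓞 k) (𝓞 K) n : K) := by
    have := congrArg (algebraMap k K) h
    rwa [map_mul] at this
  have h3 := congrArg v h2
  rw [map_mul, hd, mul_one] at h3
  rw [h3]
  exact finitePlace_le_one v _

lemma below_lt_one (v : FinitePlace K) {x : k} (hx : (below k v).valuation k x < 1) :
    v (algebraMap k K x) < 1 := by
  obtain ⟨n, d, h⟩ := (below k v).exists_primeCompl_mul_eq_of_integer x hx.le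
  have hd : v (algebraMap (𝓞 k) (𝓞 K) d : K) = 1 := by
    refine le_antisymm (finitePlace_le_one v _) ?_
    by_contra! h1
    exact d.2 (mem_below.2 ((finitePlace_lt_one_iff v _).1 h1))
  have h2 : algebraMap k K x * (algebraMap (𝓞 k) (𝓞 K) d : K) = (algebraMap (𝓞 k) (𝓞 K) n : K) := by
    have := congrArg (algebraMap k K) h
    rwa [map_mul] at this
  have h3 := congrArg v h2
  rw [map_mul, hd, mul_one] at h3
  rw [h3, finitePlace_lt_one_iff, ← mem_below, ← valuation_lt_one_iff_mem (K := k)]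
  change (below k v).valuation k (algebraMap (𝓞 k) k n) < 1
  rw [← h, map_mul]
  exact mul_lt_one_of_lt_of_le hx (valuation_le_one _ _)

/-- The valuation ring of a finite place. -/
def placeRing (v : FinitePlace K) : Subring K where
  carrier := {x | v x ≤ 1}
  mul_mem' {a b} ha hb := by
    simp only [Set.mem_ofPred_eq, map_mul] at *
    exact mul_le_one₀ ha (apply_nonneg _ _) hb
  one_mem' := by simp
  add_mem' {a b} ha hb := (FinitePlace.add_le v a b).trans (max_le ha hb)
  zero_mem' := by simp
  neg_mem' {a} ha := by
    have := nrm_neg (.inr v) a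
    simp only [nrm_inr] at this
    simpa only [Set.mem_ofPred_eq, this] using ha

lemma mem_placeRing {v : FinitePlace K} {x : K} : x ∈ placeRing v ↔ v x ≤ 1 := Iff.rfl

/-- The integers of `k` in the valuation ring of a place above. -/
noncomputable def toPlaceRing (k : Type*) [Field k] [NumberField k] [Algebra k K]
    (v : FinitePlace K) : 𝓞 k →+* placeRing v :=
  ((algebraMap k K).comp (algebraMap (𝓞 k) k)).codRestrict (placeRing v) fun x =>
    finitePlace_le_one v (algebraMap (𝓞 k) (𝓞 K) x)

lemma map_toPlaceRing (c : Cf (𝓞 k)) (v : FinitePlace K) :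
    (c.map (toPlaceRing k v)).map (placeRing v).subtype =
      (c.map (algebraMap (𝓞 k) k)).map (algebraMap k K) := rfl

lemma disc_toPlaceRing (c : Cf (𝓞 k)) (v : FinitePlace K) (s : k)
    (hs : v (algebraMap k K s) ≤ 1) :
    (((c.map (toPlaceRing k v)).disc ⟨algebraMap k K s, hs⟩ : placeRing v) : K) =
      algebraMap k K ((c.map (algebraMap (𝓞 k) k)).disc s) := by
  have := Cf.map_disc (placeRing v).subtype (c.map (toPlaceRing k v)) ⟨algebraMap k K s, hs⟩
  rw [map_toPlaceRing] at this
  rw [← Cf.map_disc]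
  exact this.symm

lemma finitePlace_eq_one_of_below (v : FinitePlace K) {x : k}
    (hx : (below k v).valuation k x = 1) : v (algebraMap k K x) = 1 := by
  have h1 := below_le_one v hx.le
  have h2 : v (algebraMap k K x⁻¹) ≤ 1 := below_le_one v (by rw [map_inv₀, hx, inv_one])
  rw [map_inv₀, map_inv₀] at h2
  have h0 : x ≠ 0 := fun h => by simp [h] at hx
  have h3 : 0 < v (algebraMap k K x) := nrm_pos (.inr v) ((map_ne_zero _).2 h0)
  exact le_antisymm h1 ((inv_le_one₀ h3).1 h2)

lemma sub_root_eq_one (c : Cf (𝓞 k)) (v : FinitePlace K) {s : k} {r : K}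
    (hs : (below k v).valuation k s ≤ 1)
    (hd : (below k v).valuation k ((c.map (algebraMap (𝓞 k) k)).disc s) = 1)
    (hr : v r ≤ 1) (hr0 : ((c.map (algebraMap (𝓞 k) k)).map (algebraMap k K)).disc r = 0) :
    v (algebraMap k K s - r) = 1 := by
  have hs' := below_le_one v hs
  have hd' := finitePlace_eq_one_of_below v hd
  obtain ⟨g, hg⟩ := (c.map (toPlaceRing k v)).sub_dvd_disc_sub ⟨algebraMap k K s, hs'⟩ ⟨r, hr⟩
  have h1 : (((c.map (toPlaceRing k v)).disc ⟨r, hr⟩ : placeRing v) : K) = 0 := by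
    rw [← hr0, ← map_toPlaceRing]
    exact (Cf.map_disc (placeRing v).subtype (c.map (toPlaceRing k v)) ⟨r, hr⟩).symm
  have h2 := congrArg (fun x : placeRing v => v (x : K)) hg
  simp only [AddSubgroupClass.coe_sub, Subring.coe_mul, h1, disc_toPlaceRing, sub_zero, map_mul, hd'] at h2
  have h3 : v (algebraMap k K s - r) ≤ 1 :=
    mem_placeRing.1 (sub_mem (mem_placeRing.2 hs') (mem_placeRing.2 hr))
  have h4 : v (g : K) ≤ 1 := g.2
  refine le_antisymm h3 ?_
  have h5 : 0 ≤ v (algebraMap k K s - r) := apply_nonneg _ _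
  nlinarith

lemma det_le_of_labels (c : Cf (𝓞 k)) (v : FinitePlace K) {p : ℕ} (hp : p ≠ 0)
    (hram : ∀ x : K, v x < 1 → v x ≤ v (p : K)) {s : k}
    (hs : (below k v).valuation k s ≤ 1)
    (hd : (below k v).valuation k ((c.map (algebraMap (𝓞 k) k)).disc s) = 1)
    (y z : Fin 3 → k) (i : Fin 3)
    (hq : ∀ a, (c.map (algebraMap (𝓞 k) k)).q s 1 (y a) (z a) = 0)
    (hne : ∀ a, ![1, y a, z a] i ≠ 0)
    (hle : ∀ a j, (below k v).valuation k (![1, y a, z a] j / ![1, y a, z a] i) ≤ 1)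
    (hlt : ∀ a b j, (below k v).valuation k
      (![1, y a, z a] j / ![1, y a, z a] i - ![1, y b, z b] j / ![1, y b, z b] i) < 1) :
    v (colMat (fun a => algebraMap k K (y a)) fun a => algebraMap k K (z a)).det ≤
      v (p : K) ^ 3 * ∏ a, lsup (.inr v)
        (pt (algebraMap k K s) (algebraMap k K (y a)) (algebraMap k K (z a))) := by
  have hs' := below_le_one v hs
  have hp0 : (p : K) ≠ 0 := Nat.cast_ne_zero.2 hp
  have hvp : 0 < v (p : K) := nrm_pos (.inr v) hp0
  set u : Fin 3 → Fin 3 → placeRing v := fun a j =>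
    ⟨algebraMap k K (![1, y a, z a] j / ![1, y a, z a] i), below_le_one v (hle a j)⟩ with hu
  have hw : ∀ a b, ∃ w : Fin 3 → placeRing v, u a - u b = (p : placeRing v) • w := by
    intro a b
    refine ⟨fun j => ⟨((u a j : K) - u b j) / p, ?_⟩, ?_⟩
    · rw [mem_placeRing, map_div₀, div_le_one hvp]
      refine hram _ ?_
      rw [hu, ← map_sub]
      exact below_lt_one v (hlt a b j)
    · ext j
      simp only [Pi.sub_apply, AddSubgroupClass.coe_sub, Pi.smul_apply, smul_eq_mul, Subring.coe_mul,
        Subring.coe_natCast]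
      field_simp
  obtain ⟨w0, h0⟩ := hw 0 1
  obtain ⟨w1, h1⟩ := hw 0 2
  obtain ⟨w2, h2⟩ := hw 1 2
  have hq' : ∀ a, (c.map (toPlaceRing k v)).qv ⟨algebraMap k K s, hs'⟩ (u a) = 0 := by
    intro a
    apply Subtype.val_injective
    change (placeRing v).subtype ((c.map (toPlaceRing k v)).qv ⟨algebraMap k K s, hs'⟩ (u a)) = 0
    rw [Cf.qv, ← Cf.map_q, map_toPlaceRing]
    change ((c.map (algebraMap (𝓞 k) k)).map (algebraMap k K)).q (algebraMap k K s)
      (algebraMap k K _) (algebraMap k K _) (algebraMap k K _) = 0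
    rw [Cf.map_q]
    have h3 := (c.map (algebraMap (𝓞 k) k)).qv_smul s (![1, y a, z a] i)⁻¹ ![1, y a, z a]
    rw [show (c.map (algebraMap (𝓞 k) k)).qv s ![1, y a, z a] = 0 from hq a, mul_zero] at h3
    simp only [Cf.qv, Pi.smul_apply, smul_eq_mul] at h3
    simp only [div_eq_inv_mul]
    rw [h3, map_zero]
  obtain ⟨g, hg⟩ := (c.map (toPlaceRing k v)).pow_dvd_disc_mul_det (w := ![w0, w1, w2]) hq' h0 h1 h2
  have h3 := congrArg (fun x : placeRing v => v (x : K)) hg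
  simp only [Subring.coe_mul, Subring.coe_pow, disc_toPlaceRing, map_mul, map_pow,
    finitePlace_eq_one_of_below v hd, one_mul, Subring.coe_natCast] at h3
  have h4 : v (g : K) ≤ 1 := g.2
  have h5 : v ((Matrix.of u).det : K) ≤ v (p : K) ^ 3 := by
    refine le_of_sq_le_sq ?_ (by positivity)
    rw [h3, ← pow_mul]
    exact mul_le_of_le_one_right (pow_pos hvp 6).le h4
  have h6 : (colMat (fun a => algebraMap k K (y a)) fun a => algebraMap k K (z a)).det =
      (∏ a, algebraMap k K (![1, y a, z a] i)) * ((Matrix.of u).det : K) := by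
    have h7 : (((Matrix.of u).det : placeRing v) : K) =
        ((Matrix.of u).map (placeRing v).subtype).det :=
      RingHom.map_det (placeRing v).subtype (Matrix.of u)
    rw [h7, ← Matrix.det_transpose, ← Matrix.det_mul_column]
    congr 1
    ext a j
    have h8 : algebraMap k K (![1, y a, z a] i) ≠ 0 := (map_ne_zero _).2 (hne a)
    have h9 : algebraMap k K (![1, y a, z a] i) * algebraMap k K (![1, y a, z a] j / ![1, y a, z a] i) =
      algebraMap k K (![1, y a, z a] j) := by rw [← map_mul, mul_div_cancel₀ _ (hne a)]
    refine Eq.trans ?_ h9.symm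
    fin_cases j <;> simp [colMat]
  rw [h6, map_mul, map_prod, mul_comm]
  refine mul_le_mul h5 (Finset.prod_le_prod (fun _ _ => apply_nonneg _ _) fun a _ => ?_)
    (Finset.prod_nonneg fun _ _ => apply_nonneg _ _) (by positivity)
  have h10 := fun j => nrm_le_lsup (.inr v)
    (pt (algebraMap k K s) (algebraMap k K (y a)) (algebraMap k K (z a))) j
  simp only [nrm_inr] at h10
  fin_cases i
  · simpa using h10 0
  · simpa using h10 2
  · simpa using h10 3

end PrimeLabel

section GoodPrimes

open IsDedekindDomain

variable {K : Type*} [Field K] [NumberField K]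

lemma dvd_absNorm_of_lt_one {v : FinitePlace K} {p : ℕ} (hp : p.Prime) (h : v (p : K) < 1) :
    p ∣ Ideal.absNorm v.maximalIdeal.asIdeal := by
  have h1 : (p : 𝓞 K) ∈ v.maximalIdeal.asIdeal := by
    rw [← finitePlace_lt_one_iff]; simpa using h
  by_contra hn
  have hc : IsCoprime (p : ℤ) (Ideal.absNorm v.maximalIdeal.asIdeal : ℤ) :=
    Nat.isCoprime_iff_coprime.2 ((Nat.Prime.coprime_iff_not_dvd hp).2 hn)
  obtain ⟨a, b, hab⟩ := hc
  refine v.maximalIdeal.isPrime.ne_top ((Ideal.eq_top_iff_one _).2 ?_)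
  have h2 := congrArg (fun n : ℤ => (n : 𝓞 K)) hab
  simp only [Int.cast_add, Int.cast_mul, Int.cast_natCast, Int.cast_one] at h2
  rw [← h2]
  exact add_mem (Ideal.mul_mem_left _ _ h1) (Ideal.mul_mem_left _ _ (Ideal.absNorm_mem _))

lemma le_natCast_of_not_dvd_different {v : FinitePlace K} {p : ℕ} (hp : p.Prime)
    (hv : ¬ v.maximalIdeal.asIdeal ∣ differentIdeal ℤ (𝓞 K)) (x : K)
    (hx : v x < 1) : v x ≤ v (p : K) := by
  set Q := v.maximalIdeal.asIdeal with hQ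
  have hN : (1 : ℝ) < Ideal.absNorm Q := by
    exact_mod_cast HeightOneSpectrum.one_lt_absNorm v.maximalIdeal
  have hp0 : (p : 𝓞 K) ≠ 0 := Nat.cast_ne_zero.2 hp.ne_zero
  have h1 := FinitePlace.apply_mul_absNorm_pow_eq_one v hp0
  set m := multiplicity Q (Ideal.span {(p : 𝓞 K)}) with hm
  have hm1 : m ≤ 1 := by
    by_contra! h2
    apply hv
    have h3 : Q ^ 2 ∣ (Ideal.span {(p : ℤ)}).map (algebraMap ℤ (𝓞 K)) := by
      rw [Ideal.map_span, Set.image_singleton, map_natCast]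
      exact pow_dvd_of_le_multiplicity h2
    have : (Ideal.span {(p : ℤ)}).IsMaximal :=
      PrincipalIdealRing.isMaximal_of_irreducible (Nat.prime_iff_prime_int.1 hp).irreducible
    have h4 := pow_sub_one_dvd_differentIdeal ℤ Q 2 (p := Ideal.span {(p : ℤ)})
      (by simpa using hp.ne_zero) h3
    simpa using h4
  by_cases hx0 : x = 0
  · rw [hx0, map_zero]; exact apply_nonneg _ _
  obtain ⟨n, hn⟩ := exists_zpow_eq v hx0
  rw [← hQ] at hn
  have hn0 : n ≤ -1 := by
    by_contra! h2
    rw [hn] at hx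
    exact absurd hx (not_lt.2 (one_le_zpow₀ hN.le (by omega)))
  have h2 : v (p : K) = ((Ideal.absNorm Q : ℝ) ^ m)⁻¹ := eq_inv_of_mul_eq_one_left (by
    simpa using h1)
  rw [h2, hn]
  calc (Ideal.absNorm Q : ℝ) ^ n ≤ (Ideal.absNorm Q : ℝ) ^ (-1 : ℤ) := zpow_le_zpow_right₀ hN.le hn0
    _ = ((Ideal.absNorm Q : ℝ) ^ 1)⁻¹ := by rw [zpow_neg_one, pow_one]
    _ ≤ _ := by
      gcongr
      exact hN.le

lemma finite_places_gt (x : K) : {v : FinitePlace K | 1 < v x}.Finite := by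
  by_cases hx : x = 0
  · simp [hx, not_lt.2 (zero_le_one' ℝ)]
  · exact (FinitePlace.hasFiniteMulSupport hx).subset fun v hv h => by
      simp only [Set.mem_ofPred_eq] at hv
      linarith

/-- All sufficiently large primes are unramified and the given elements are integral there. -/
lemma exists_prime_bound {ι : Type*} [Finite ι] (r : ι → K) : ∃ P0 : ℕ, ∀ p : ℕ, p.Prime → P0 < p →
    ∀ v : FinitePlace K, v (p : K) < 1 →
      (∀ x : K, v x < 1 → v x ≤ v (p : K)) ∧ ∀ j, v (r j) ≤ 1 := by
  have h1 : {v : FinitePlace K | v.maximalIdeal.asIdeal ∣ differentIdeal ℤ (𝓞 K)}.Finite :=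
    (Ideal.finite_factors (I := differentIdeal ℤ (𝓞 K)) differentIdeal_ne_bot).preimage
      (f := FinitePlace.maximalIdeal) (FinitePlace.maximalIdeal_injective.injOn)
  have h2 : (⋃ j, {v : FinitePlace K | 1 < v (r j)}).Finite :=
    Set.finite_iUnion fun j => finite_places_gt (r j)
  obtain ⟨P0, hP0⟩ := ((h1.union h2).image fun v => Ideal.absNorm v.maximalIdeal.asIdeal).bddAbove
  refine ⟨P0, fun p hp hlt v hv => ?_⟩
  have hgood : v ∉ {v : FinitePlace K | v.maximalIdeal.asIdeal ∣ differentIdeal ℤ (𝓞 K)} ∪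
      ⋃ j, {v : FinitePlace K | 1 < v (r j)} := by
    intro hmem
    have h3 := hP0 (Set.mem_image_of_mem _ hmem)
    have h4 := Nat.le_of_dvd (by
      have := HeightOneSpectrum.one_lt_absNorm v.maximalIdeal
      omega) (dvd_absNorm_of_lt_one hp hv)
    omega
  rw [Set.mem_union, not_or, Set.mem_iUnion] at hgood
  refine ⟨le_natCast_of_not_dvd_different hp hgood.1, fun j => ?_⟩
  by_contra! h3
  exact hgood.2 ⟨j, h3⟩

end GoodPrimes

section PrimeChoice

/-- Bertrand's postulate iterated. -/
lemma exists_primes (Y : ℕ) (hY : Y ≠ 0) (r : ℕ) : ∃ S : Finset ℕ, S.card = r ∧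
    ∀ p ∈ S, p.Prime ∧ Y < p ∧ p ≤ 2 ^ r * Y := by
  induction r with
  | zero => exact ⟨∅, rfl, by simp⟩
  | succ r ih =>
    obtain ⟨S, hS, hp⟩ := ih
    obtain ⟨q, hq, hq1, hq2⟩ := Nat.exists_prime_lt_and_le_two_mul (2 ^ r * Y) (by positivity)
    have hqS : q ∉ S := fun h => absurd (hp q h).2.2 (by omega)
    refine ⟨insert q S, by rw [Finset.card_insert_of_notMem hqS, hS], fun p hpS => ?_⟩
    rw [Finset.mem_insert] at hpS
    have h1 : Y ≤ 2 ^ r * Y := Nat.le_mul_of_pos_left _ (by positivity)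
    rw [pow_succ]
    rcases hpS with rfl | h
    · exact ⟨hq, by omega, by linarith⟩
    · obtain ⟨h2, h3, h4⟩ := hp p h
      exact ⟨h2, h3, by linarith⟩

lemma exists_prime_not_dvd (Y r N : ℕ) (hY : Y ≠ 0) (hN : N ≠ 0) (h : N < Y ^ (r + 1)) :
    ∃ p : ℕ, p.Prime ∧ Y < p ∧ p ≤ 2 ^ (r + 1) * Y ∧ ¬ p ∣ N := by
  obtain ⟨S, hS, hp⟩ := exists_primes Y hY (r + 1)
  by_contra! hcon
  have hdvd : ∏ p ∈ S, p ∣ N := Finset.prod_primes_dvd N (fun p h => (hp p h).1.prime) fun p h =>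
    hcon p (hp p h).1 (hp p h).2.1 (hp p h).2.2
  have h1 := Nat.le_of_dvd (Nat.pos_of_ne_zero hN) hdvd
  have h2 : Y ^ (r + 1) ≤ ∏ p ∈ S, p := by
    rw [← hS, ← Finset.prod_const]
    exact Finset.prod_le_prod' fun p h => (hp p h).2.1.le
  omega

end PrimeChoice

section BadPlaces

open IsDedekindDomain

variable {k : Type*} [Field k] [NumberField k]

lemma below_self (w : FinitePlace k) : below k w = w.maximalIdeal := by
  ext x
  exact mem_below

lemma valuation_le_one_of_finitePlace (w : FinitePlace k) {x : k} (h : w x ≤ 1) :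
    w.maximalIdeal.valuation k x ≤ 1 := by
  by_contra! hc
  have hx : x ≠ 0 := fun h0 => by simp [h0] at hc
  have h1 : (below k w).valuation k x⁻¹ < 1 := by
    rw [below_self, map_inv₀]
    exact inv_lt_one_of_one_lt₀ hc
  have h2 : w x⁻¹ < 1 := below_lt_one w h1
  rw [map_inv₀] at h2
  have h3 : 0 < w x := nrm_pos (.inr w) hx
  exact absurd h (not_le.2 ((inv_lt_one₀ h3).1 h2))

lemma valuation_eq_one_of_finitePlace (w : FinitePlace k) {x : k} (h : w x = 1) :
    w.maximalIdeal.valuation k x = 1 := by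
  have hx : x ≠ 0 := fun h0 => by simp [h0] at h
  refine le_antisymm (valuation_le_one_of_finitePlace w h.le) ?_
  have h1 : w.maximalIdeal.valuation k x⁻¹ ≤ 1 :=
    valuation_le_one_of_finitePlace w (by rw [map_inv₀, h, inv_one])
  rw [map_inv₀] at h1
  exact (inv_le_one₀ (zero_lt_iff.2 ((map_ne_zero _).2 hx))).1 h1

lemma disc_le_one (c : Cf (𝓞 k)) (w : FinitePlace k) {s : k} (hs : w s ≤ 1) :
    w ((c.map (algebraMap (𝓞 k) k)).disc s) ≤ 1 := by
  have h1 := disc_toPlaceRing c w (s := s) hs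
  have h2 : w (((c.map (toPlaceRing k w)).disc ⟨algebraMap k k s, hs⟩ : placeRing w) : k) ≤ 1 :=
    ((c.map (toPlaceRing k w)).disc ⟨algebraMap k k s, hs⟩).2
  rw [h1] at h2
  exact h2

lemma prod_le_gprod {φ : Pl k → ℝ} (h : HasFiniteMulSupport φ) (h1 : ∀ ν, 1 ≤ φ ν)
    (T : Finset (Pl k)) : ∏ ν ∈ T, φ ν ≤ ∏ᶠ ν, φ ν := by
  classical
  rw [finprod_eq_prod_of_mulSupport_subset (s := T ∪ Set.Finite.toFinset h) φ
    (fun ν hν => Finset.mem_coe.2 (Finset.mem_union_right _ ((Set.Finite.mem_toFinset h).2 hν))), ← Finset.prod_sdiff (Finset.subset_union_left (s₁ := T))]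
  have h2 : 1 ≤ ∏ ν ∈ (T ∪ Set.Finite.toFinset h) \ T, φ ν := by
    rw [← Finset.prod_const_one (s := (T ∪ Set.Finite.toFinset h) \ T)]
    exact Finset.prod_le_prod (fun _ _ => zero_le_one) fun ν _ => h1 ν
  have h3 : 0 ≤ ∏ ν ∈ T, φ ν := Finset.prod_nonneg fun ν _ => zero_le_one.trans (h1 ν)
  nlinarith

lemma absNorm_le_of_one_lt (w : FinitePlace k) {x : k} (h : 1 < w x) :
    (Ideal.absNorm w.maximalIdeal.asIdeal : ℝ) ≤ w x := by
  have hx : x ≠ 0 := fun h0 => by simp [h0] at h; linarith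
  have hN : (1 : ℝ) < Ideal.absNorm w.maximalIdeal.asIdeal := by
    exact_mod_cast HeightOneSpectrum.one_lt_absNorm w.maximalIdeal
  obtain ⟨n, hn⟩ := exists_zpow_eq w hx
  have hn1 : 1 ≤ n := by
    by_contra! h2
    rw [hn] at h
    exact absurd h (not_lt.2 (zpow_le_one_of_nonpos₀ hN.le (by omega)))
  rw [hn]
  calc (Ideal.absNorm w.maximalIdeal.asIdeal : ℝ) = _ ^ (1 : ℤ) := (zpow_one _).symm
    _ ≤ _ := zpow_le_zpow_right₀ hN.le hn1

/-- An integer of controlled size divisible by the norms of all places where `s` is not integral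
or `D` is not a unit. -/
lemma exists_bad_norm (s D : k) (hD : D ≠ 0) : ∃ N : ℕ, N ≠ 0 ∧
    (N : ℝ) ≤ mulHeight₁ s * mulHeight₁ D ∧ ∀ w : FinitePlace k, (1 < w s ∨ w D < 1) →
      Ideal.absNorm w.maximalIdeal.asIdeal ∣ N := by
  classical
  have hfin : {w : FinitePlace k | 1 < w s ∨ w D < 1}.Finite := by
    refine ((finite_places_gt s).union (finite_places_gt D⁻¹)).subset fun w hw => ?_
    refine hw.imp id fun h => ?_
    have h0 : 0 < w D := nrm_pos (.inr w) hD
    change 1 < w D⁻¹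
    rw [map_inv₀]
    exact (one_lt_inv₀ h0).2 h
  refine ⟨∏ w ∈ hfin.toFinset, Ideal.absNorm w.maximalIdeal.asIdeal, ?_, ?_, ?_⟩
  · rw [Finset.prod_ne_zero_iff]
    intro w _ h
    have := HeightOneSpectrum.one_lt_absNorm w.maximalIdeal
    omega
  · have hs1 := hasFinite_max_one s
    have hD1 := hasFinite_max_one D⁻¹
    have hm : HasFiniteMulSupport fun ν : Pl k => max 1 (nrm ν s) * max 1 (nrm ν D⁻¹) := hs1.mul hD1
    rw [← mulHeight₁_inv D, mulHeight₁_eq_gprod, mulHeight₁_eq_gprod,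
      ← finprod_mul_distrib hs1 hD1]
    refine le_trans ?_ (prod_le_gprod hm (fun ν => ?_)
      (hfin.toFinset.map ⟨Sum.inr, Sum.inr_injective⟩))
    · rw [Finset.prod_map]
      push_cast
      refine Finset.prod_le_prod (fun _ _ => by positivity) fun w hw => ?_
      simp only [Embedding.coeFn_mk, nrm_inr]
      rcases (hfin.mem_toFinset.1 hw) with h | h
      · calc _ ≤ w s := absNorm_le_of_one_lt w h
          _ ≤ max 1 (w s) * 1 := by rw [mul_one]; exact le_max_right _ _
          _ ≤ _ := by gcongr; exact le_max_left _ _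
      · have h0 : 0 < w D := nrm_pos (.inr w) hD
        have h' : 1 < w D⁻¹ := by
          rw [map_inv₀]
          exact (one_lt_inv₀ h0).2 h
        calc _ ≤ w D⁻¹ := absNorm_le_of_one_lt w h'
          _ ≤ 1 * max 1 (w D⁻¹) := by rw [one_mul]; exact le_max_right _ _
          _ ≤ _ := by gcongr; exact le_max_left _ _
    · exact one_le_mul_of_one_le_of_one_le (le_max_left _ _) (le_max_left _ _)
  · intro w hw
    exact Finset.dvd_prod_of_mem _ (hfin.mem_toFinset.2 hw)

lemma absNorm_span_natCast (p : ℕ) : Ideal.absNorm (Ideal.span {(p : 𝓞 k)}) =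
    p ^ Module.finrank ℚ k := by
  rw [Ideal.absNorm_span_singleton]
  have h := Algebra.norm_algebraMap_of_basis (RingOfIntegers.basis k) (p : ℤ)
  rw [map_natCast] at h
  rw [h, Int.natAbs_pow, Int.natAbs_natCast, ← Module.finrank_eq_card_basis (RingOfIntegers.basis k),
    RingOfIntegers.rank]

/-- Labels at all primes above `p` of points on a conic with good reduction there. -/
lemma exists_prime_labels (c : Cf (𝓞 k)) (s : k) {p : ℕ} (hp : p.Prime)
    (hgood : ∀ w : FinitePlace k, w (p : k) < 1 →
      w s ≤ 1 ∧ ¬ w ((c.map (algebraMap (𝓞 k) k)).disc s) < 1) :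
    ∃ (S : Finset (HeightOneSpectrum (𝓞 k))) (T : Finset (S → ℕ)) (lab : (Fin 3 → k) → S → ℕ),
      T.card ≤ 9 ^ Module.finrank ℚ k * p ^ Module.finrank ℚ k ∧
      (∀ u, u ≠ 0 → (c.map (algebraMap (𝓞 k) k)).qv s u = 0 → lab u ∈ T) ∧
      ∀ v : HeightOneSpectrum (𝓞 k), (p : 𝓞 k) ∈ v.asIdeal →
        v.valuation k s ≤ 1 ∧ v.valuation k ((c.map (algebraMap (𝓞 k) k)).disc s) = 1 ∧
        ∀ u0, ∃ i : Fin 3, ∀ u u' : Fin 3 → k, u ≠ 0 → u' ≠ 0 →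
          (c.map (algebraMap (𝓞 k) k)).qv s u = 0 → (c.map (algebraMap (𝓞 k) k)).qv s u' = 0 →
          lab u = lab u0 → lab u' = lab u0 → u i ≠ 0 ∧ (∀ j, v.valuation k (u j / u i) ≤ 1) ∧
          ∀ j, v.valuation k (u j / u i - u' j / u' i) < 1 := by
  classical
  have hp0 : Ideal.span {(p : 𝓞 k)} ≠ ⊥ := by
    simpa using hp.ne_zero
  have hpow := absNorm_span_natCast (k := k) p
  set d := Module.finrank ℚ k with hd
  have hfin := Ideal.finite_factors hp0
  set S := hfin.toFinset with hS
  have hmem : ∀ v : HeightOneSpectrum (𝓞 k), v ∈ S ↔ (p : 𝓞 k) ∈ v.asIdeal := by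
    intro v
    rw [hS, Set.Finite.mem_toFinset]
    exact Ideal.dvd_span_singleton
  have hval : ∀ v : HeightOneSpectrum (𝓞 k), (p : 𝓞 k) ∈ v.asIdeal →
      v.valuation k s ≤ 1 ∧ v.valuation k ((c.map (algebraMap (𝓞 k) k)).disc s) = 1 := by
    intro v hv
    have hlt : (FinitePlace.mk v) (p : k) < 1 := by
      have := (finitePlace_lt_one_iff (FinitePlace.mk v) (p : 𝓞 k)).2
        (by rwa [FinitePlace.maximalIdeal_mk])
      simpa using this
    obtain ⟨h1, h2⟩ := hgood _ hlt
    have h3 := valuation_le_one_of_finitePlace _ h1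
    have h4 := valuation_eq_one_of_finitePlace _ (le_antisymm (disc_le_one c _ h1) (not_lt.1 h2))
    rw [FinitePlace.maximalIdeal_mk] at h3 h4
    exact ⟨h3, h4⟩
  have hdvd : ∏ v ∈ S, v.asIdeal ∣ Ideal.span {(p : 𝓞 k)} := by
    have h1 : ∏ v ∈ S, v.asIdeal = ∏ I ∈ S.image HeightOneSpectrum.asIdeal, I := by
      rw [Finset.prod_image fun v _ w _ h => HeightOneSpectrum.ext h]
    rw [h1]
    refine Finset.prod_primes_dvd _ (fun I hI => ?_) fun I hI => ?_
    · obtain ⟨v, _, rfl⟩ := Finset.mem_image.1 hI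
      exact v.prime
    · obtain ⟨v, hv, rfl⟩ := Finset.mem_image.1 hI
      exact hfin.mem_toFinset.1 hv
  have hnorm : ∏ v ∈ S, Ideal.absNorm v.asIdeal ≤ p ^ d := by
    rw [← map_prod, ← hpow]
    refine Nat.le_of_dvd ?_ (map_dvd Ideal.absNorm hdvd)
    rw [hpow]; exact pow_pos hp.pos _
  have hcard : S.card ≤ d := by
    have h1 : p ^ S.card ≤ ∏ v ∈ S, Ideal.absNorm v.asIdeal := by
      rw [← Finset.prod_const]
      refine Finset.prod_le_prod' fun v hv => ?_
      have h2 := dvd_absNorm_of_lt_one (v := FinitePlace.mk v) hp (by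
        have := (finitePlace_lt_one_iff (FinitePlace.mk v) (p : 𝓞 k)).2
          (by rw [FinitePlace.maximalIdeal_mk]; exact (hmem v).1 hv)
        simpa using this)
      rw [FinitePlace.maximalIdeal_mk] at h2
      refine Nat.le_of_dvd ?_ h2
      have := HeightOneSpectrum.one_lt_absNorm v
      omega
    exact (Nat.pow_le_pow_iff_right hp.one_lt).1 (h1.trans hnorm)
  choose! lab idx hlab using fun (v : S) => exists_prime_label v.1 c s
    (hval v.1 ((hmem v.1).1 v.2)).1 (hval v.1 ((hmem v.1).1 v.2)).2
  refine ⟨S, Fintype.piFinset fun v : S => Finset.range (9 * Ideal.absNorm v.1.asIdeal),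
    fun u v => lab v u, ?_, ?_, ?_⟩
  · rw [Fintype.card_piFinset]
    simp only [Finset.card_range]
    rw [Finset.prod_coe_sort S fun v => 9 * Ideal.absNorm v.asIdeal, Finset.prod_mul_distrib,
      Finset.prod_const]
    exact Nat.mul_le_mul (Nat.pow_le_pow_right (by norm_num) hcard) hnorm
  · intro u hu hq
    rw [Fintype.mem_piFinset]
    exact fun v => Finset.mem_range.2 (hlab v u hu hq).1
  · intro v hv
    refine ⟨(hval v hv).1, (hval v hv).2, fun u0 => ?_⟩
    set v' : S := ⟨v, (hmem v).2 hv⟩ with hv'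
    refine ⟨idx v' (lab v' u0), fun u u' hu hu' hq hq' hl hl' => ?_⟩
    obtain ⟨-, h2, h3, h4⟩ := hlab v' u hu hq
    have e1 : lab v' u = lab v' u0 := congrFun hl v'
    have e2 : lab v' u' = lab v' u0 := congrFun hl' v'
    have h5 := h4 u' hu' hq' (e1.trans e2.symm)
    rw [e1] at h2 h3 h5
    exact ⟨h2, h3, h5⟩

end BadPlaces

section FibreCount

lemma conic_det_ne {K : Type*} [Field K] (c : Cf K) {s : K} (hD : c.disc s ≠ 0) (y z : Fin 3 → K)
    (hq : ∀ i, c.q s 1 (y i) (z i) = 0) (hinj : Injective fun i => (y i, z i)) :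
    (colMat y z).det ≠ 0 := by
  set u : Fin 3 → Fin 3 → K := fun i => ![1, y i, z i] with hu
  have hqv : ∀ i, c.qv s (u i) = 0 := hq
  have hpol : ∀ i j, i ≠ j → c.polar s (u i) (u j) ≠ 0 := by
    intro i j hij hp
    have hdet : ∀ w, (Matrix.of ![u i, u j, w]).det = 0 := by
      intro w
      have h := c.gram s (u i) (u j) w
      rw [hqv, hqv, hp] at h
      have h2 : c.disc s * (Matrix.of ![u i, u j, w]).det ^ 2 = 0 := by rw [← h]; ring
      exact pow_eq_zero_iff (two_ne_zero) |>.1 ((mul_eq_zero.1 h2).resolve_left hD)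
    have h1 := hdet ![0, 0, 1]
    have h2 := hdet ![0, 1, 0]
    rw [Matrix.det_fin_three] at h1 h2
    simp [hu] at h1 h2
    exact hij (hinj (Prod.ext (by simp only; linear_combination -h1)
      (by simp only; linear_combination h2)))
  intro h0
  have h := c.gram s (u 0) (u 1) (u 2)
  have hdet : (Matrix.of ![u 0, u 1, u 2]).det = (colMat y z).det := by
    rw [Matrix.det_fin_three, Matrix.det_fin_three]
    simp [hu, colMat]
    ring
  rw [hdet, h0, hqv, hqv, hqv] at h
  have h1 := mul_ne_zero (mul_ne_zero (hpol 0 1 (by decide)) (hpol 0 2 (by decide)))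
    (hpol 1 2 (by decide))
  apply h1
  linear_combination h

variable {k : Type*} [Field k] [NumberField k] {K : Type*} [Field K] [NumberField K] [Algebra k K]

lemma card_le_of_prime {c : Cf (𝓞 k)}
    (P : Splitting ((c.map (algebraMap (𝓞 k) k)).map (algebraMap k K))) :
    ∃ (P0 : ℕ) (C : ℝ), 1 ≤ C ∧ ∀ (s : k) (B : ℝ) (p : ℕ), 1 ≤ B → p.Prime → P0 < p →
      (c.map (algebraMap (𝓞 k) k)).disc s ≠ 0 →
      (∀ w : FinitePlace k, w (p : k) < 1 →
        w s ≤ 1 ∧ ¬ w ((c.map (algebraMap (𝓞 k) k)).disc s) < 1) →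
      C * B ^ 3 < mulHeight₁ s ^ 5 * (p : ℝ) ^ (3 * Module.finrank ℚ k) →
      ∀ {α : Type} (T : Finset α) (lab : K → K → α), (∀ y z, lab y z ∈ T) →
        (∀ y z y' z', lab y z = lab y' z' → ∀ ν j,
          P.size ν j (algebraMap k K s) y z ≤ kap ν * P.size ν j (algebraMap k K s) y' z') →
        ∀ S : Finset (k × k), (∀ w ∈ S, (c.map (algebraMap (𝓞 k) k)).q s 1 w.1 w.2 = 0 ∧
          mulHeight (pt s w.1 w.2) ≤ B) →
        S.card ≤ 2 * (T.card * (9 ^ Module.finrank ℚ k * p ^ Module.finrank ℚ k)) := by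
  classical
  obtain ⟨P0, hP0⟩ := exists_prime_bound P.r
  obtain ⟨C, hC, hdet⟩ := P.det_inequality
  set m := Module.finrank k K with hm
  have : FiniteDimensional k K := Module.Finite.of_restrictScalars_finite ℚ k K
  have hm0 : 1 ≤ m := Module.finrank_pos
  have hn : Module.finrank ℚ K = Module.finrank ℚ k * m := (Module.finrank_mul_finrank ℚ k K).symm
  refine ⟨P0, max 1 C, le_max_left _ _, ?_⟩
  intro s B p hB hp hlt hD hgood hbig α T lab hlabT hlab S hS
  obtain ⟨Q, T', lab', hT', hlabT', hlab'⟩ := exists_prime_labels c s hp hgood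
  set f : k × k → α × (Q → ℕ) := fun w =>
    (lab (algebraMap k K w.1) (algebraMap k K w.2), lab' ![1, w.1, w.2]) with hf
  have hne1 : ∀ w : k × k, (![1, w.1, w.2] : Fin 3 → k) ≠ 0 := fun w h => by
    simpa using congrFun h 0
  have hDK : ((c.map (algebraMap (𝓞 k) k)).map (algebraMap k K)).disc (algebraMap k K s) ≠ 0 := by
    rw [Cf.map_disc]; exact (map_ne_zero _).2 hD
  have hsr : ∀ j, algebraMap k K s ≠ P.r j := fun j h => hDK (by rw [h]; exact P.disc_zero j)
  have hfib : ∀ t ∈ T ×ˢ T', (S.filter fun w => f w = t).card ≤ 2 := by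
    intro t _
    by_contra! h3
    obtain ⟨w0, h0, w1, h1, w2, h2, h01, h02, h12⟩ := Finset.two_lt_card.1 h3
    set w : Fin 3 → k × k := ![w0, w1, w2] with hw
    have hwm : ∀ i, w i ∈ S ∧ f (w i) = t := by
      intro i
      fin_cases i
      · simpa [hw] using h0
      · simpa [hw] using h1
      · simpa [hw] using h2
    have hwinj : Injective w := by
      intro i j
      fin_cases i <;> fin_cases j <;> simp [hw, h01, h02, h12, h01.symm, h02.symm, h12.symm]
    set y : Fin 3 → k := fun i => (w i).1 with hy
    set z : Fin 3 → k := fun i => (w i).2 with hz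
    have hq : ∀ i, (c.map (algebraMap (𝓞 k) k)).q s 1 (y i) (z i) = 0 := fun i =>
      (hS _ (hwm i).1).1
    have hqK : ∀ i, ((c.map (algebraMap (𝓞 k) k)).map (algebraMap k K)).q (algebraMap k K s) 1 (algebraMap k K (y i)) (algebraMap k K (z i)) = 0 := by
      intro i
      have := Cf.map_q (algebraMap k K) (c.map (algebraMap (𝓞 k) k)) s 1 (y i) (z i)
      rw [map_one, hq, map_zero] at this
      exact this
    have hl : ∀ i, lab (algebraMap k K (y i)) (algebraMap k K (z i)) = t.1 := fun i =>
      congrArg Prod.fst (hwm i).2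
    have hl' : ∀ i, lab' ![1, y i, z i] = t.2 := fun i => congrArg Prod.snd (hwm i).2
    have hdne : (colMat (fun i => algebraMap k K (y i)) fun i => algebraMap k K (z i)).det ≠ 0 := by
      refine conic_det_ne ((c.map (algebraMap (𝓞 k) k)).map (algebraMap k K)) hDK _ _ hqK fun i j hij => hwinj ?_
      rw [Prod.mk.injEq] at hij
      exact Prod.ext ((algebraMap k K).injective hij.1) ((algebraMap k K).injective hij.2)
    have hkey := hdet (algebraMap k K s) (fun i => algebraMap k K (y i))
      (fun i => algebraMap k K (z i)) p hp.ne_zero hsr hqK hdne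
      (fun ν j i i' => hlab _ _ _ _ ((hl i).trans (hl i').symm) ν j) (by
        intro v hv
        have hpv : (p : 𝓞 k) ∈ (below k v).asIdeal := by
          rw [mem_below, ← finitePlace_lt_one_iff]
          simpa using hv
        obtain ⟨hvs, hvd, hvl⟩ := hlab' _ hpv
        obtain ⟨hram, hrj⟩ := hP0 p hp hlt v hv
        obtain ⟨i, hi⟩ := hvl ![1, y 0, z 0]
        have hi' := fun a b => hi ![1, y a, z a] ![1, y b, z b] (hne1 (w a)) (hne1 (w b)) (hq a) (hq b)
          ((hl' a).trans (hl' 0).symm) ((hl' b).trans (hl' 0).symm)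
        refine ⟨det_le_of_labels c v hp.ne_zero hram hvs hvd y z i hq (fun a => (hi' a a).1)
          (fun a => (hi' a a).2.1) (fun a b => (hi' a b).2.2), below_le_one v hvs, fun j => ?_⟩
        exact sub_root_eq_one c v hvs hvd (hrj j) (P.disc_zero j))
    have hpt : ∀ i, mulHeight (pt (algebraMap k K s) (algebraMap k K (y i)) (algebraMap k K (z i))) ≤
        B ^ m := by
      intro i
      have h4 : pt (algebraMap k K s) (algebraMap k K (y i)) (algebraMap k K (z i)) =
          fun j => algebraMap k K (pt s (y i) (z i) j) := by
        ext j; fin_cases j <;> simp [pt]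
      rw [h4, mulHeight_algebraMap (pt_ne_zero _ _ _)]
      exact pow_le_pow_left₀ (mulHeight_pos _).le (hS _ (hwm i).1).2 m
    have h5 : ∏ i, mulHeight (pt (algebraMap k K s) (algebraMap k K (y i)) (algebraMap k K (z i))) ≤
        (B ^ m) ^ 3 := by
      calc _ ≤ ∏ _i : Fin 3, B ^ m := Finset.prod_le_prod (fun i _ => (mulHeight_pos _).le)
            fun i _ => hpt i
        _ = (B ^ m) ^ 3 := by simp
    rw [mulHeight₁_algebraMap, hn] at hkey
    have h6 : (mulHeight₁ s ^ 5 * (p : ℝ) ^ (3 * Module.finrank ℚ k)) ^ m ≤ (max 1 C * B ^ 3) ^ m := by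
      calc (mulHeight₁ s ^ 5 * (p : ℝ) ^ (3 * Module.finrank ℚ k)) ^ m =
          (mulHeight₁ s ^ m) ^ 5 * (p : ℝ) ^ (3 * (Module.finrank ℚ k * m)) := by
            rw [mul_pow]; ring
        _ ≤ C * (B ^ m) ^ 3 := hkey.trans (mul_le_mul_of_nonneg_left h5 hC.le)
        _ ≤ (max 1 C) ^ m * (B ^ m) ^ 3 := by
            refine mul_le_mul_of_nonneg_right ?_ (by positivity)
            calc C ≤ max 1 C := le_max_right _ _
              _ ≤ (max 1 C) ^ m := le_self_pow₀ (le_max_left _ _) (by omega)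
        _ = (max 1 C * B ^ 3) ^ m := by rw [mul_pow]; ring
    have h7 := lt_of_pow_lt_pow_left₀ m (by positivity) (h6.trans_lt (pow_lt_pow_left₀ hbig
      (by positivity) (by omega)))
    exact lt_irrefl _ h7
  have hmaps : ∀ w ∈ S, f w ∈ T ×ˢ T' := fun w hw =>
    Finset.mem_product.2 ⟨hlabT _ _, hlabT' _ (hne1 w) (hS w hw).1⟩
  calc S.card ≤ 2 * (T ×ˢ T').card := Finset.card_le_mul_card_image_of_maps_to hmaps 2 hfib
    _ ≤ _ := by
      rw [Finset.card_product]
      gcongr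

/-- Polynomially bounded growth of heights. -/
def HeightBounded (f : k → k) : Prop :=
  ∃ (C : ℝ) (n : ℕ), 0 < C ∧ ∀ s, mulHeight₁ (f s) ≤ C * mulHeight₁ s ^ n

namespace HeightBounded

variable {f g : k → k}

lemma const (a : k) : HeightBounded fun _ => a :=
  ⟨mulHeight₁ a, 0, mulHeight₁_pos _, fun s => by simp⟩

lemma id : HeightBounded fun s : k => s := ⟨1, 1, one_pos, fun s => by simp⟩

lemma mul (hf : HeightBounded f) (hg : HeightBounded g) : HeightBounded fun s => f s * g s := by
  obtain ⟨C, n, hC, h⟩ := hf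
  obtain ⟨C', n', hC', h'⟩ := hg
  refine ⟨C * C', n + n', by positivity, fun s => ?_⟩
  calc _ ≤ mulHeight₁ (f s) * mulHeight₁ (g s) := mulHeight₁_mul_le _ _
    _ ≤ (C * mulHeight₁ s ^ n) * (C' * mulHeight₁ s ^ n') :=
      mul_le_mul (h s) (h' s) (mulHeight₁_pos _).le ((mulHeight₁_pos _).le.trans (h s))
    _ = _ := by ring

lemma add (hf : HeightBounded f) (hg : HeightBounded g) : HeightBounded fun s => f s + g s := by
  obtain ⟨C, n, hC, h⟩ := hf
  obtain ⟨C', n', hC', h'⟩ := hg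
  refine ⟨2 ^ totalWeight k * (C * C'), n + n', by positivity, fun s => ?_⟩
  calc _ ≤ 2 ^ totalWeight k * mulHeight₁ (f s) * mulHeight₁ (g s) := mulHeight₁_add_le _ _
    _ = 2 ^ totalWeight k * (mulHeight₁ (f s) * mulHeight₁ (g s)) := by ring
    _ ≤ 2 ^ totalWeight k * ((C * mulHeight₁ s ^ n) * (C' * mulHeight₁ s ^ n')) := by
      refine mul_le_mul_of_nonneg_left ?_ (by positivity)
      exact mul_le_mul (h s) (h' s) (mulHeight₁_pos _).le ((mulHeight₁_pos _).le.trans (h s))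
    _ = _ := by ring

lemma neg (hf : HeightBounded f) : HeightBounded fun s => -f s := by
  obtain ⟨C, n, hC, h⟩ := hf
  exact ⟨C, n, hC, fun s => by rw [mulHeight₁_neg]; exact h s⟩

lemma sub (hf : HeightBounded f) (hg : HeightBounded g) : HeightBounded fun s => f s - g s := by
  simpa only [sub_eq_add_neg] using hf.add hg.neg

lemma pow (hf : HeightBounded f) (n : ℕ) : HeightBounded fun s => f s ^ n := by
  induction n with
  | zero => simpa using const (1 : k)
  | succ n ih => simpa only [pow_succ] using ih.mul hf

end HeightBounded

lemma heightBounded_disc (c : Cf k) : HeightBounded c.disc := by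
  have h : ∀ a b : k, HeightBounded fun s : k => a + b * s := fun a b =>
    (HeightBounded.const a).add ((HeightBounded.const b).mul .id)
  have h2 : ∀ a b e : k, HeightBounded fun s : k => a + b * s + e * s ^ 2 := fun a b e =>
    (h a b).add ((HeightBounded.const e).mul (HeightBounded.id.pow 2))
  have hA : HeightBounded c.A := (h2 _ _ _).add ((HeightBounded.const _).mul (HeightBounded.id.pow 3))
  have hB : HeightBounded c.B := h2 _ _ _
  have hC : HeightBounded c.C := h2 _ _ _
  have hD : HeightBounded c.D := h _ _
  have hE : HeightBounded c.E := h _ _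
  have hF : HeightBounded c.F := h _ _
  exact (((((HeightBounded.const 4).mul hA).mul hD).mul hF |>.add ((hB.mul hC).mul hE)).sub
    (hA.mul (hE.pow 2)) |>.sub ((hC.pow 2).mul hD)).sub ((hB.pow 2).mul hF)

end FibreCount

section ConicBound

/-- Choice of an auxiliary prime of suitable size avoiding a given integer. -/
lemma exists_good_prime (d P0 A : ℕ) (hd : d ≠ 0) {C C2 ε : ℝ} (hC : 1 ≤ C) (hC2 : 0 < C2)
    (hε : 0 < ε) : ∃ M : ℝ, 0 < M ∧ ∀ (B H : ℝ) (N : ℕ), 1 ≤ B → 1 ≤ H → N ≠ 0 → (N : ℝ) ≤ C2 * B ^ A →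
      ∃ p : ℕ, p.Prime ∧ P0 < p ∧ ¬ p ∣ N ∧ C * B ^ 3 < H ^ 5 * (p : ℝ) ^ (3 * d) ∧
        (p : ℝ) ^ d ≤ M * B ^ ε * (1 + B / H ^ ((5 : ℝ) / 3)) := by
  have hd0 : (0 : ℝ) < d := by positivity
  set δ := ε / d with hδ
  have hδ0 : 0 < δ := by positivity
  set r := ⌈A / δ⌉₊ with hr
  have hr1 : (A : ℝ) ≤ δ * (r + 1 : ℕ) := by
    have h1 : (A : ℝ) / δ ≤ r := Nat.le_ceil _
    rw [div_le_iff₀ hδ0] at h1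
    push_cast
    nlinarith
  set Q : ℝ := P0 + C2 + 2 with hQ
  have hQ1 : 1 ≤ Q := by rw [hQ]; have : (0 : ℝ) ≤ P0 := Nat.cast_nonneg _; linarith
  refine ⟨2 ^ ((r + 2) * d) * 2 ^ (d - 1) * (Q ^ d + C), by positivity, ?_⟩
  intro B H N hB hH hN hNle
  have hB0 : 0 < B := by linarith
  have hH0 : 0 < H := by linarith
  set W := B / H ^ ((5 : ℝ) / 3) with hW
  have hW0 : 0 < W := by positivity
  set Z := (C * W) ^ ((1 : ℝ) / d) with hZ
  have hZ0 : 0 < Z := by positivity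
  have hZd : Z ^ d = C * W := by
    rw [hZ, ← Real.rpow_natCast, ← Real.rpow_mul (by positivity), one_div, inv_mul_cancel₀ hd0.ne',
      Real.rpow_one]
  have hBδ : 1 ≤ B ^ δ := Real.one_le_rpow hB hδ0.le
  set Y := ⌈Q * B ^ δ + Z⌉₊ with hY
  have hY1 : Q * B ^ δ + Z ≤ Y := Nat.le_ceil _
  have hQB : Q ≤ Q * B ^ δ := le_mul_of_one_le_right (by linarith) hBδ
  have hY2 : (Y : ℝ) ≤ 2 * (Q * B ^ δ + Z) := by
    have := Nat.ceil_lt_add_one (a := Q * B ^ δ + Z) (by positivity)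
    linarith
  have hPY : P0 < Y := by
    have : (P0 : ℝ) < Y := by linarith
    exact_mod_cast this
  have hNY : N < Y ^ (r + 1) := by
    have h1 : (N : ℝ) < (Y : ℝ) ^ (r + 1) := by
      calc (N : ℝ) ≤ C2 * B ^ A := hNle
        _ < Q * B ^ A := by
          gcongr
          rw [hQ]; have : (0 : ℝ) ≤ P0 := Nat.cast_nonneg _; linarith
        _ ≤ Q ^ (r + 1) * (B ^ δ) ^ (r + 1) := by
          gcongr
          · exact le_self_pow₀ hQ1 (by omega)
          · rw [← Real.rpow_natCast B A, ← Real.rpow_natCast (B ^ δ), ← Real.rpow_mul hB0.le]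
            exact Real.rpow_le_rpow_of_exponent_le hB hr1
        _ = (Q * B ^ δ) ^ (r + 1) := by rw [mul_pow]
        _ ≤ (Y : ℝ) ^ (r + 1) := by
          gcongr
          linarith
    exact_mod_cast h1
  obtain ⟨p, hp, hYp, hpY, hdvd⟩ := exists_prime_not_dvd Y r N (by omega) hN hNY
  have hYp' : (Y : ℝ) < p := by exact_mod_cast hYp
  have hpY' : (p : ℝ) ≤ 2 ^ (r + 1) * Y := by exact_mod_cast hpY
  refine ⟨p, hp, by omega, hdvd, ?_, ?_⟩
  · have h1 : C * W < (p : ℝ) ^ d := by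
      rw [← hZd]
      exact pow_lt_pow_left₀ (by linarith) hZ0.le hd
    have h2 : (C * W) ^ 3 < (p : ℝ) ^ (3 * d) := by
      rw [mul_comm 3 d, pow_mul]
      exact pow_lt_pow_left₀ h1 (by positivity) (by norm_num)
    have h3 : H ^ 5 * W ^ 3 = B ^ 3 := by
      rw [hW, div_pow, ← Real.rpow_natCast (H ^ ((5 : ℝ) / 3)), ← Real.rpow_mul hH0.le]
      norm_num
      field_simp
    calc C * B ^ 3 ≤ C ^ 3 * B ^ 3 := by
          gcongr
          exact le_self_pow₀ hC (by norm_num)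
      _ = H ^ 5 * (C * W) ^ 3 := by rw [← h3]; ring
      _ < _ := by gcongr
  · have h1 : (p : ℝ) ≤ 2 ^ (r + 2) * (Q * B ^ δ + Z) := by
      calc (p : ℝ) ≤ 2 ^ (r + 1) * Y := hpY'
        _ ≤ 2 ^ (r + 1) * (2 * (Q * B ^ δ + Z)) := by gcongr
        _ = _ := by ring
    have h2 : (B ^ δ) ^ d = B ^ ε := by
      rw [← Real.rpow_natCast, ← Real.rpow_mul hB0.le, hδ, div_mul_cancel₀ _ hd0.ne']
    have hBε : 1 ≤ B ^ ε := Real.one_le_rpow hB hε.le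
    calc (p : ℝ) ^ d ≤ (2 ^ (r + 2) * (Q * B ^ δ + Z)) ^ d := by gcongr
      _ = 2 ^ ((r + 2) * d) * (Q * B ^ δ + Z) ^ d := by rw [mul_pow, ← pow_mul]
      _ ≤ 2 ^ ((r + 2) * d) * (2 ^ (d - 1) * ((Q * B ^ δ) ^ d + Z ^ d)) := by
        gcongr
        exact add_pow_le (by positivity) hZ0.le d
      _ = 2 ^ ((r + 2) * d) * 2 ^ (d - 1) * (Q ^ d * B ^ ε + C * W) := by
        rw [mul_pow, h2, hZd]; ring
      _ ≤ 2 ^ ((r + 2) * d) * 2 ^ (d - 1) * ((Q ^ d + C) * B ^ ε * (1 + W)) := by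
        gcongr
        have h4 : C * W ≤ C * W * B ^ ε := le_mul_of_one_le_right (by positivity) hBε
        have h5 : 0 ≤ Q ^ d * B ^ ε * W := by positivity
        have h6 : 0 ≤ C * B ^ ε := by positivity
        nlinarith
      _ = _ := by ring

variable {k : Type*} [Field k] [NumberField k] {K : Type*} [Field K] [NumberField K] [Algebra k K]

lemma mulHeight₁_le_mulHeight_pt (s y z : k) : mulHeight₁ s ≤ mulHeight (pt s y z) := by
  rw [mulHeight₁_eq_mulHeight]
  have h : (![s, 1] : Fin 2 → k) = pt s y z ∘ ![1, 0] := by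
    ext i; fin_cases i <;> simp [pt]
  rw [h]
  exact mulHeight_comp_le _ _

/-- Points of bounded height on the non-degenerate fibres of a conic bundle. -/
theorem conic_points_le {c : Cf (𝓞 k)}
    (P : Splitting ((c.map (algebraMap (𝓞 k) k)).map (algebraMap k K))) {ε : ℝ} (hε : 0 < ε) :
    ∃ M : ℝ, 0 < M ∧ ∀ (s : k) (B : ℝ), 1 ≤ B → (c.map (algebraMap (𝓞 k) k)).disc s ≠ 0 →
      ∀ S : Finset (k × k), (∀ w ∈ S, (c.map (algebraMap (𝓞 k) k)).q s 1 w.1 w.2 = 0 ∧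
        mulHeight (pt s w.1 w.2) ≤ B) →
        (S.card : ℝ) ≤ M * B ^ ε * (1 + B / mulHeight₁ s ^ ((5 : ℝ) / 3)) := by
  have : FiniteDimensional k K := Module.Finite.of_restrictScalars_finite ℚ k K
  set m := Module.finrank k K with hm
  have hm0 : 1 ≤ m := Module.finrank_pos
  have hmR : (0 : ℝ) < m := by positivity
  set d := Module.finrank ℚ k with hd
  have hd0 : d ≠ 0 := Module.finrank_pos.ne'
  obtain ⟨P0, C, hC, hcard⟩ := card_le_of_prime P
  obtain ⟨C1, hC1, hlabels⟩ := P.exists_labels (ε := ε / 2 / m) (by positivity)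
  obtain ⟨C2, A, hC2, hdisc⟩ := heightBounded_disc (c.map (algebraMap (𝓞 k) k))
  obtain ⟨M, hM, hprime⟩ := exists_good_prime d P0 (A + 1) hd0 hC hC2 (half_pos hε)
  refine ⟨2 * C1 * 9 ^ d * M, by positivity, ?_⟩
  intro s B hB hD S hS
  have hB0 : 0 < B := by linarith
  rcases S.eq_empty_or_nonempty with rfl | ⟨w0, hw0⟩
  · have := mulHeight₁_pos s
    simp only [Finset.card_empty, Nat.cast_zero]
    positivity
  have hHB : mulHeight₁ s ≤ B := (mulHeight₁_le_mulHeight_pt s w0.1 w0.2).trans (hS w0 hw0).2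
  have hH1 : 1 ≤ mulHeight₁ s := one_le_mulHeight₁ s
  have hsr : ∀ j, algebraMap k K s ≠ P.r j := fun j h => by
    have h1 := P.disc_zero j
    rw [← h, Cf.map_disc] at h1
    exact hD ((map_eq_zero _).1 h1)
  obtain ⟨T, lab, hT, hTcard, hlab⟩ := hlabels (algebraMap k K s) hsr
  obtain ⟨N, hN, hNle, hNdvd⟩ := exists_bad_norm s _ hD
  have hNle' : (N : ℝ) ≤ C2 * B ^ (A + 1) := by
    calc (N : ℝ) ≤ _ := hNle
      _ ≤ B * (C2 * B ^ A) := by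
        refine mul_le_mul hHB ((hdisc s).trans ?_) (mulHeight₁_pos _).le hB0.le
        gcongr
      _ = _ := by ring
  obtain ⟨p, hp, hP0p, hpN, hbig, hpd⟩ := hprime B (mulHeight₁ s) N hB hH1 hN hNle'
  have hgood : ∀ w : FinitePlace k, w (p : k) < 1 →
      w s ≤ 1 ∧ ¬ w ((c.map (algebraMap (𝓞 k) k)).disc s) < 1 := by
    intro w hw
    have h1 := dvd_absNorm_of_lt_one hp hw
    refine ⟨?_, fun h => hpN (h1.trans (hNdvd w (Or.inr h)))⟩
    by_contra! h
    exact hpN (h1.trans (hNdvd w (Or.inl h)))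
  classical
  have key : S.card ≤ 2 * (T.card * (9 ^ d * p ^ d)) := by
    obtain ⟨e⟩ : Nonempty (T ≃ Fin T.card) := ⟨T.equivFin⟩
    have := hcard s B p hB hp hP0p hD hgood hbig (Finset.univ : Finset (Fin T.card))
      (fun y z => e ⟨lab y z, hT y z⟩) (fun _ _ => Finset.mem_univ _)
      (fun y z y' z' h => hlab y z y' z' (congrArg Subtype.val (e.injective h))) S hS
    simpa using this
  have hTB : (T.card : ℝ) ≤ C1 * B ^ (ε / 2) := by
    refine hTcard.trans (mul_le_mul_of_nonneg_left ?_ hC1.le)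
    rw [mulHeight₁_algebraMap, ← Real.rpow_natCast, ← Real.rpow_mul (by positivity), ← hm,
      mul_div_cancel₀ _ hmR.ne']
    gcongr
  have hkey : (S.card : ℝ) ≤ 2 * (T.card * (9 ^ d * (p : ℝ) ^ d)) := by exact_mod_cast key
  have hBB : B ^ (ε / 2) * B ^ (ε / 2) = B ^ ε := by
    rw [← Real.rpow_add hB0, add_halves]
  calc (S.card : ℝ) ≤ 2 * (T.card * (9 ^ d * (p : ℝ) ^ d)) := hkey
    _ ≤ 2 * (C1 * B ^ (ε / 2) * (9 ^ d * (M * B ^ (ε / 2) *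
        (1 + B / mulHeight₁ s ^ ((5 : ℝ) / 3))))) := by gcongr
    _ = 2 * C1 * 9 ^ d * M * (B ^ (ε / 2) * B ^ (ε / 2)) *
        (1 + B / mulHeight₁ s ^ ((5 : ℝ) / 3)) := by ring
    _ = _ := by rw [hBB]

end ConicBound

section BundleBound

variable {k : Type*} [Field k] [NumberField k]

lemma card_height_le {ε : ℝ} (hε : 0 < ε) : ∃ C : ℝ, 0 < C ∧ ∀ R : ℝ, 1 ≤ R → ∀ I : Finset k,
    (∀ s ∈ I, mulHeight₁ s ≤ R) → (I.card : ℝ) ≤ C * R ^ (2 + ε) := by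
  obtain ⟨C, hC, h⟩ := count_height_le (k := k) hε
  refine ⟨C, hC, fun R hR I hI => le_trans ?_ (h R hR)⟩
  rw [← Set.ncard_coe_finset]
  exact_mod_cast Set.ncard_le_ncard (fun s hs => hI s hs) (finite_height_le R)

lemma sum_height_le {ε : ℝ} (hε : 0 < ε) : ∃ C : ℝ, 0 < C ∧ ∀ R : ℝ, 1 ≤ R → ∀ I : Finset k,
    (∀ s ∈ I, mulHeight₁ s ≤ R) →
      ∑ s ∈ I, 1 / mulHeight₁ s ^ ((5 : ℝ) / 3) ≤ C * R ^ (1 / 2 + ε) := by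
  classical
  obtain ⟨C, hC, hcard⟩ := card_height_le (k := k) hε
  refine ⟨(1 + 6 / Real.log 2) * (C * 2 ^ (2 + ε)), ?_, ?_⟩
  · have := Real.log_pos one_lt_two
    positivity
  intro R hR I hI
  have hlog2 := Real.log_pos one_lt_two
  have hR0 : 0 < R := by linarith
  set J := Nat.log 2 ⌊R⌋₊ with hJ
  have hfl : ⌊R⌋₊ ≠ 0 := (Nat.floor_pos.2 hR).ne'
  have hJR : (2 : ℝ) ^ J ≤ R := by
    have h1 : 2 ^ J ≤ ⌊R⌋₊ := Nat.pow_log_le_self 2 hfl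
    have h2 : ((2 ^ J : ℕ) : ℝ) ≤ ⌊R⌋₊ := by exact_mod_cast h1
    push_cast at h2
    exact h2.trans (Nat.floor_le hR0.le)
  have hJ1 : (J + 1 : ℝ) ≤ (1 + 6 / Real.log 2) * R ^ ((1 : ℝ) / 6) := by
    have h1 := Real.log_le_log (by positivity) hJR
    rw [Real.log_pow] at h1
    have h2 := Real.log_le_rpow_div hR0.le (ε := 1 / 6) (by norm_num)
    have h3 : (J : ℝ) ≤ 6 / Real.log 2 * R ^ ((1 : ℝ) / 6) := by
      rw [div_mul_eq_mul_div, le_div_iff₀ hlog2]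
      linarith
    have h4 : 1 ≤ R ^ ((1 : ℝ) / 6) := Real.one_le_rpow hR (by norm_num)
    linarith
  have hmaps : ∀ s ∈ I, Nat.log 2 ⌊mulHeight₁ s⌋₊ ∈ Finset.range (J + 1) := fun s hs =>
    Finset.mem_range.2 (Nat.lt_succ_of_le (Nat.log_mono_right (Nat.floor_le_floor (hI s hs))))
  rw [← Finset.sum_fiberwise_of_maps_to hmaps]
  have hterm : ∀ j ∈ Finset.range (J + 1), ∑ s ∈ I with Nat.log 2 ⌊mulHeight₁ s⌋₊ = j,
      1 / mulHeight₁ s ^ ((5 : ℝ) / 3) ≤ C * 2 ^ (2 + ε) * R ^ (1 / 3 + ε) := by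
    intro j hj
    set I' := I.filter fun s => Nat.log 2 ⌊mulHeight₁ s⌋₊ = j with hI'
    have hlow : ∀ s ∈ I', (2 : ℝ) ^ j ≤ mulHeight₁ s ∧ mulHeight₁ s ≤ 2 ^ (j + 1) := by
      intro s hs
      obtain ⟨_, h1⟩ := Finset.mem_filter.1 hs
      have hf0 : ⌊mulHeight₁ s⌋₊ ≠ 0 := (Nat.floor_pos.2 (one_le_mulHeight₁ s)).ne'
      constructor
      · have h2 : 2 ^ j ≤ ⌊mulHeight₁ s⌋₊ := by rw [← h1]; exact Nat.pow_log_le_self 2 hf0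
        have h3 : ((2 ^ j : ℕ) : ℝ) ≤ ⌊mulHeight₁ s⌋₊ := by exact_mod_cast h2
        push_cast at h3
        exact h3.trans (Nat.floor_le (mulHeight₁_pos s).le)
      · have h2 : ⌊mulHeight₁ s⌋₊ + 1 ≤ 2 ^ (j + 1) := by
          rw [← h1]; exact Nat.lt_pow_succ_log_self one_lt_two _
        have h3 : ((⌊mulHeight₁ s⌋₊ + 1 : ℕ) : ℝ) ≤ 2 ^ (j + 1) := by exact_mod_cast h2
        push_cast at h3
        exact (Nat.lt_floor_add_one _).le.trans h3
    have hjR : (2 : ℝ) ^ j ≤ R := le_trans (pow_le_pow_right₀ one_le_two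
      (Nat.lt_succ_iff.1 (Finset.mem_range.1 hj))) hJR
    have hc := hcard (2 ^ (j + 1)) (one_le_pow₀ one_le_two) I' fun s hs => (hlow s hs).2
    have h2j : (0 : ℝ) < 2 ^ j := by positivity
    calc ∑ s ∈ I', 1 / mulHeight₁ s ^ ((5 : ℝ) / 3) ≤
        ∑ _s ∈ I', 1 / ((2 : ℝ) ^ j) ^ ((5 : ℝ) / 3) := by
          refine Finset.sum_le_sum fun s hs => ?_
          have := (hlow s hs).1
          gcongr
      _ = I'.card * (1 / ((2 : ℝ) ^ j) ^ ((5 : ℝ) / 3)) := by rw [Finset.sum_const, nsmul_eq_mul]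
      _ ≤ (C * (2 ^ (j + 1)) ^ (2 + ε)) * (1 / ((2 : ℝ) ^ j) ^ ((5 : ℝ) / 3)) := by gcongr
      _ = C * 2 ^ (2 + ε) * ((2 : ℝ) ^ j) ^ (1 / 3 + ε) := by
        rw [pow_succ, Real.mul_rpow h2j.le zero_le_two,
          show (1 : ℝ) / 3 + ε = 2 + ε - 5 / 3 by ring, Real.rpow_sub h2j]
        ring
      _ ≤ _ := by gcongr
  calc _ ≤ ∑ _j ∈ Finset.range (J + 1), C * 2 ^ (2 + ε) * R ^ (1 / 3 + ε) := Finset.sum_le_sum hterm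
    _ = (J + 1 : ℝ) * (C * 2 ^ (2 + ε) * R ^ (1 / 3 + ε)) := by
      rw [Finset.sum_const, nsmul_eq_mul, Finset.card_range]; push_cast; ring
    _ ≤ (1 + 6 / Real.log 2) * R ^ ((1 : ℝ) / 6) * (C * 2 ^ (2 + ε) * R ^ (1 / 3 + ε)) := by gcongr
    _ = (1 + 6 / Real.log 2) * (C * 2 ^ (2 + ε)) * (R ^ ((1 : ℝ) / 6) * R ^ (1 / 3 + ε)) := by ring
    _ = _ := by
      rw [← Real.rpow_add hR0]
      congr 2
      ring

variable {K : Type*} [Field K] [NumberField K] [Algebra k K]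

/-- Points of bounded height on a conic bundle lying on fibres of small height. -/
theorem bundle_points_le {c : Cf (𝓞 k)}
    (P : Splitting ((c.map (algebraMap (𝓞 k) k)).map (algebraMap k K))) {ε a : ℝ} (hε : 0 < ε)
    (ha : 0 < a) :
    ∃ M : ℝ, 0 < M ∧ ∀ B : ℝ, 1 ≤ B → ∀ S : Finset (k × k × k),
      (∀ w ∈ S, (c.map (algebraMap (𝓞 k) k)).disc w.1 ≠ 0 ∧
        (c.map (algebraMap (𝓞 k) k)).q w.1 1 w.2.1 w.2.2 = 0 ∧
        mulHeight (pt w.1 w.2.1 w.2.2) ≤ B ∧ mulHeight₁ w.1 ≤ a * B ^ ((2 : ℝ) / 3)) →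
      (S.card : ℝ) ≤ M * B ^ ((4 : ℝ) / 3 + ε) := by
  classical
  set η := ε / 2 with hη
  have hη0 : 0 < η := by positivity
  obtain ⟨M1, hM1, hA⟩ := conic_points_le P hη0
  obtain ⟨M2, hM2, hcard⟩ := card_height_le (k := k) hη0
  obtain ⟨M3, hM3, hsum⟩ := sum_height_le (k := k) hη0
  refine ⟨M1 * (M2 * (a + 1) ^ (2 + η) + M3 * (a + 1) ^ (1 / 2 + η)), by positivity, ?_⟩
  intro B hB S hS
  have hB0 : 0 < B := by linarith
  set R := (a + 1) * B ^ ((2 : ℝ) / 3) with hR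
  have hBp : 1 ≤ B ^ ((2 : ℝ) / 3) := Real.one_le_rpow hB (by norm_num)
  have hR1 : 1 ≤ R := by nlinarith
  set I := S.image Prod.fst with hI
  have hIR : ∀ s ∈ I, mulHeight₁ s ≤ R := by
    intro s hs
    obtain ⟨w, hw, rfl⟩ := Finset.mem_image.1 hs
    exact (hS w hw).2.2.2.trans (by rw [hR]; nlinarith)
  have hfib : ∀ s ∈ I, ((S.filter fun w => w.1 = s).card : ℝ) ≤
      M1 * B ^ η * (1 + B / mulHeight₁ s ^ ((5 : ℝ) / 3)) := by
    intro s hs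
    obtain ⟨w0, hw0, hs0⟩ := Finset.mem_image.1 hs
    have h1 : (S.filter fun w => w.1 = s).card =
        ((S.filter fun w => w.1 = s).image Prod.snd).card := by
      rw [Finset.card_image_of_injOn]
      intro w hw w' hw' h
      rw [Finset.mem_coe, Finset.mem_filter] at hw hw'
      exact Prod.ext (hw.2.trans hw'.2.symm) h
    rw [h1]
    refine hA s B hB (hs0 ▸ (hS w0 hw0).1) _ fun u hu => ?_
    obtain ⟨w, hw, rfl⟩ := Finset.mem_image.1 hu
    obtain ⟨hw1, rfl⟩ := Finset.mem_filter.1 hw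
    exact ⟨(hS w hw1).2.1, (hS w hw1).2.2.1⟩
  have hmaps : ∀ w ∈ S, w.1 ∈ I := fun w hw => Finset.mem_image_of_mem _ hw
  have hpow : ∀ t : ℝ, 0 ≤ t → R ^ t = (a + 1) ^ t * B ^ (2 / 3 * t) := by
    intro t _
    rw [hR, Real.mul_rpow (by positivity) (by positivity), ← Real.rpow_mul hB0.le]
  have hb1 : B ^ η * B ^ (2 / 3 * (2 + η)) ≤ B ^ ((4 : ℝ) / 3 + ε) := by
    rw [← Real.rpow_add hB0]
    refine Real.rpow_le_rpow_of_exponent_le hB ?_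
    linarith
  have hb2 : B ^ η * (B * B ^ (2 / 3 * (1 / 2 + η))) ≤ B ^ ((4 : ℝ) / 3 + ε) := by
    have : B * B ^ (2 / 3 * (1 / 2 + η)) = B ^ (1 + 2 / 3 * (1 / 2 + η)) := by
      rw [Real.rpow_add hB0, Real.rpow_one]
    rw [this, ← Real.rpow_add hB0]
    refine Real.rpow_le_rpow_of_exponent_le hB ?_
    linarith
  calc (S.card : ℝ) = ∑ s ∈ I, ((S.filter fun w => w.1 = s).card : ℝ) := by
        rw [Finset.card_eq_sum_card_fiberwise hmaps]; push_cast; rfl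
    _ ≤ ∑ s ∈ I, M1 * B ^ η * (1 + B / mulHeight₁ s ^ ((5 : ℝ) / 3)) := Finset.sum_le_sum hfib
    _ = M1 * B ^ η * (I.card + B * ∑ s ∈ I, 1 / mulHeight₁ s ^ ((5 : ℝ) / 3)) := by
      rw [← Finset.mul_sum, Finset.sum_add_distrib, Finset.mul_sum]
      simp [div_eq_mul_inv]
    _ ≤ M1 * B ^ η * (M2 * R ^ (2 + η) + B * (M3 * R ^ (1 / 2 + η))) := by
      gcongr
      · exact hcard R hR1 I hIR
      · exact hsum R hR1 I hIR
    _ = M1 * (M2 * (a + 1) ^ (2 + η) * (B ^ η * B ^ (2 / 3 * (2 + η))) +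
        M3 * (a + 1) ^ (1 / 2 + η) * (B ^ η * (B * B ^ (2 / 3 * (1 / 2 + η))))) := by
      rw [hpow _ (by positivity), hpow _ (by positivity)]
      ring
    _ ≤ M1 * (M2 * (a + 1) ^ (2 + η) * B ^ ((4 : ℝ) / 3 + ε) +
        M3 * (a + 1) ^ (1 / 2 + η) * B ^ ((4 : ℝ) / 3 + ε)) := by gcongr
    _ = _ := by ring

end BundleBound

section Pencil

variable {Ω : Type*} [Field Ω] [IsAlgClosed Ω] [CharZero Ω]

omit [CharZero Ω] in
lemma exists_sq_root (x : Ω) : ∃ z, z ^ 2 = x := by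
  obtain ⟨z, hz⟩ := IsAlgClosed.exists_eq_mul_self x
  exact ⟨z, by rw [hz]; ring⟩

lemma exists_binary_zero (a b c : Ω) :
    ∃ l m : Ω, (l ≠ 0 ∨ m ≠ 0) ∧ a * l ^ 2 + b * l * m + c * m ^ 2 = 0 := by
  by_cases ha : a = 0
  · exact ⟨1, 0, Or.inl one_ne_zero, by rw [ha]; ring⟩
  · obtain ⟨w, hw⟩ := exists_sq_root (b ^ 2 - 4 * a * c)
    refine ⟨w - b, 2 * a, Or.inr (mul_ne_zero two_ne_zero ha), ?_⟩
    linear_combination a * hw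

/-- The conic `A x² + B x y + C x z + D y² + E y z + F z²` is singular at `(x, y, z)`. -/
def InKernel {R : Type*} [CommRing R] (A B C D E F x y z : R) : Prop :=
  2 * A * x + B * y + C * z = 0 ∧ B * x + 2 * D * y + E * z = 0 ∧ C * x + E * y + 2 * F * z = 0

lemma exists_kernel_zero_of_or {A B C D E F A' B' C' D' E' F' : Ω}
    (h : 4 * D * F - E ^ 2 ≠ 0 ∨ (A ≠ 0 ∧ 4 * D * F - E ^ 2 = 0 ∧ 4 * A * F - C ^ 2 = 0 ∧
      4 * A * D - B ^ 2 = 0))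
    (h0 : 4 * A * D * F + B * C * E - A * E ^ 2 - C ^ 2 * D - B ^ 2 * F = 0)
    (h1 : A' * (4 * D * F - E ^ 2) + D' * (4 * A * F - C ^ 2) + F' * (4 * A * D - B ^ 2) +
      B' * (C * E - 2 * B * F) + C' * (B * E - 2 * C * D) + E' * (B * C - 2 * A * E) = 0) :
    ∃ x y z : Ω, (x ≠ 0 ∨ y ≠ 0 ∨ z ≠ 0) ∧ InKernel A B C D E F x y z ∧
      A' * x ^ 2 + B' * x * y + C' * x * z + D' * y ^ 2 + E' * y * z + F' * z ^ 2 = 0 := by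
  rcases h with h | ⟨hA, ha, hb, hc⟩
  · refine ⟨4 * D * F - E ^ 2, C * E - 2 * B * F, B * E - 2 * C * D, Or.inl h, ⟨?_, ?_, ?_⟩, ?_⟩
    · linear_combination 2 * h0
    · ring
    · ring
    · linear_combination (4 * D * F - E ^ 2) * h1 - (4 * F * D' + 4 * D * F' - 2 * E * E') * h0
  · have hq : (B * C - 2 * A * E) ^ 2 = 0 := by
      linear_combination -4 * A * h0 + (4 * A * D - B ^ 2) * hb
    have hd : B * C - 2 * A * E = 0 := pow_eq_zero_iff (two_ne_zero) |>.1 hq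
    obtain ⟨l, m, hlm, hz⟩ := exists_binary_zero
      (A' * B ^ 2 - 2 * A * B * B' + 4 * A ^ 2 * D')
      (2 * A' * B * C - 2 * A * B' * C - 2 * A * B * C' + 4 * A ^ 2 * E')
      (A' * C ^ 2 - 2 * A * C * C' + 4 * A ^ 2 * F')
    refine ⟨-B * l - C * m, 2 * A * l, 2 * A * m, ?_, ⟨?_, ?_, ?_⟩, ?_⟩
    · rcases hlm with hl | hm
      · exact Or.inr (Or.inl (mul_ne_zero (mul_ne_zero two_ne_zero hA) hl))
      · exact Or.inr (Or.inr (mul_ne_zero (mul_ne_zero two_ne_zero hA) hm))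
    · ring
    · linear_combination l * hc - m * hd
    · linear_combination m * hb - l * hd
    · linear_combination hz

lemma exists_kernel_zero {A B C D E F A' B' C' D' E' F' : Ω}
    (h0 : 4 * A * D * F + B * C * E - A * E ^ 2 - C ^ 2 * D - B ^ 2 * F = 0)
    (h1 : A' * (4 * D * F - E ^ 2) + D' * (4 * A * F - C ^ 2) + F' * (4 * A * D - B ^ 2) +
      B' * (C * E - 2 * B * F) + C' * (B * E - 2 * C * D) + E' * (B * C - 2 * A * E) = 0) :
    ∃ x y z : Ω, (x ≠ 0 ∨ y ≠ 0 ∨ z ≠ 0) ∧ InKernel A B C D E F x y z ∧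
      A' * x ^ 2 + B' * x * y + C' * x * z + D' * y ^ 2 + E' * y * z + F' * z ^ 2 = 0 := by
  have kx := exists_kernel_zero_of_or (A := A) (B := B) (C := C) (D := D) (E := E) (F := F)
    (A' := A') (B' := B') (C' := C') (D' := D') (E' := E') (F' := F')
  have ky : _ → ∃ x y z : Ω, (x ≠ 0 ∨ y ≠ 0 ∨ z ≠ 0) ∧ InKernel A B C D E F x y z ∧
      A' * x ^ 2 + B' * x * y + C' * x * z + D' * y ^ 2 + E' * y * z + F' * z ^ 2 = 0 := fun h => by
    obtain ⟨x, y, z, hn, ⟨k1, k2, k3⟩, hz⟩ := exists_kernel_zero_of_or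
      (A := D) (B := B) (C := E) (D := A) (E := C) (F := F)
      (A' := D') (B' := B') (C' := E') (D' := A') (E' := C') (F' := F') h
      (by linear_combination h0) (by linear_combination h1)
    exact ⟨y, x, z, by tauto, ⟨by linear_combination k2, by linear_combination k1,
      by linear_combination k3⟩, by linear_combination hz⟩
  have kz : _ → ∃ x y z : Ω, (x ≠ 0 ∨ y ≠ 0 ∨ z ≠ 0) ∧ InKernel A B C D E F x y z ∧
      A' * x ^ 2 + B' * x * y + C' * x * z + D' * y ^ 2 + E' * y * z + F' * z ^ 2 = 0 := fun h => by
    obtain ⟨x, y, z, hn, ⟨k1, k2, k3⟩, hz⟩ := exists_kernel_zero_of_or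
      (A := F) (B := E) (C := C) (D := D) (E := B) (F := A)
      (A' := F') (B' := E') (C' := C') (D' := D') (E' := B') (F' := A') h
      (by linear_combination h0) (by linear_combination h1)
    exact ⟨z, y, x, by tauto, ⟨by linear_combination k3, by linear_combination k2,
      by linear_combination k1⟩, by linear_combination hz⟩
  by_cases ha : 4 * D * F - E ^ 2 = 0
  swap
  · exact kx (Or.inl ha) h0 h1
  by_cases hb : 4 * A * F - C ^ 2 = 0
  swap
  · exact ky (Or.inl hb)
  by_cases hc : 4 * A * D - B ^ 2 = 0
  swap
  · exact kz (Or.inl (by intro h; exact hc (by linear_combination h)))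
  by_cases hA : A = 0
  swap
  · exact kx (Or.inr ⟨hA, ha, hb, hc⟩) h0 h1
  by_cases hD : D = 0
  swap
  · exact ky (Or.inr ⟨hD, hb, ha, by linear_combination hc⟩)
  by_cases hF : F = 0
  swap
  · exact kz (Or.inr ⟨hF, by linear_combination hc, by linear_combination hb, by linear_combination ha⟩)
  subst hA hD hF
  have hB : B = 0 := by simpa using hc
  have hC : C = 0 := by simpa using hb
  have hE : E = 0 := by simpa using ha
  subst hB hC hE
  obtain ⟨l, m, hlm, hz⟩ := exists_binary_zero A' B' D'
  exact ⟨l, m, 0, by tauto, ⟨by ring, by ring, by ring⟩, by linear_combination hz⟩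

/-- A degenerate conic of rank two splits into two distinct lines. -/
lemma exists_factor_aux {A B C D E F : Ω} (h : 4 * D * F - E ^ 2 ≠ 0)
    (h0 : 4 * A * D * F + B * C * E - A * E ^ 2 - C ^ 2 * D - B ^ 2 * F = 0) :
    ∃ l m : Fin 3 → Ω, ∃ n : Fin 3 → Ω, (Matrix.of ![l, m, n]).det ≠ 0 ∧ ∀ x y z,
      A * x ^ 2 + B * x * y + C * x * z + D * y ^ 2 + E * y * z + F * z ^ 2 =
        (l 0 * x + l 1 * y + l 2 * z) * (m 0 * x + m 1 * y + m 2 * z) := by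
  obtain ⟨α, β, γ, δ, hn, h1, h2, h3⟩ : ∃ α β γ δ : Ω, α * δ - β * γ ≠ 0 ∧ α * γ = D ∧
      α * δ + β * γ = E ∧ β * δ = F := by
    obtain ⟨w, hw⟩ := exists_sq_root (E ^ 2 - 4 * D * F)
    by_cases hD : D = 0
    · refine ⟨0, 1, E, F, ?_, by rw [hD]; ring, by ring, by ring⟩
      intro h'
      apply h
      rw [hD]
      linear_combination E * h'
    · refine ⟨D, (E + w) / 2, 1, (E - w) / (2 * D), ?_, by ring, by field_simp; ring, ?_⟩
      · intro h'
        apply h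
        field_simp at h'
        linear_combination hw + w * h' / 2
      · field_simp
        linear_combination -hw
  set p := (C * E - 2 * B * F) / (4 * D * F - E ^ 2) with hp
  set q := (B * E - 2 * C * D) / (4 * D * F - E ^ 2) with hq
  have hp' : (4 * D * F - E ^ 2) * p = C * E - 2 * B * F := by rw [hp]; field_simp
  have hq' : (4 * D * F - E ^ 2) * q = B * E - 2 * C * D := by rw [hq]; field_simp
  have e1 : B + 2 * D * p + E * q = 0 := by
    apply mul_left_cancel₀ h
    linear_combination 2 * D * hp' + E * hq'
  have e2 : C + E * p + 2 * F * q = 0 := by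
    apply mul_left_cancel₀ h
    linear_combination E * hp' + 2 * F * hq'
  have e3 : 2 * A + B * p + C * q = 0 := by
    apply mul_left_cancel₀ h
    linear_combination 2 * h0 + B * hp' + C * hq'
  refine ⟨![-(α * p + β * q), α, β], ![-(γ * p + δ * q), γ, δ], ![1, 0, 0], ?_, ?_⟩
  · rw [Matrix.det_fin_three]
    simpa using hn
  · intro x y z
    simp
    have e1' : B = -(2 * (α * γ) * p + (α * δ + β * γ) * q) := by
      linear_combination e1 + 2 * p * h1 + q * h2
    have e2' : C = -((α * δ + β * γ) * p + 2 * (β * δ) * q) := by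
      linear_combination e2 + p * h2 + 2 * q * h3
    have e3' : A = (α * p + β * q) * (γ * p + δ * q) := by
      apply mul_left_cancel₀ (two_ne_zero (α := Ω))
      linear_combination e3 - p * e1' - q * e2'
    rw [e3', e1', e2', ← h1, ← h2, ← h3]
    ring

lemma exists_factor {A B C D E F : Ω}
    (h : 4 * D * F - E ^ 2 ≠ 0 ∨ 4 * A * F - C ^ 2 ≠ 0 ∨ 4 * A * D - B ^ 2 ≠ 0)
    (h0 : 4 * A * D * F + B * C * E - A * E ^ 2 - C ^ 2 * D - B ^ 2 * F = 0) :
    ∃ L : Matrix (Fin 3) (Fin 3) Ω, L.det ≠ 0 ∧ ∀ x y z,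
      A * x ^ 2 + B * x * y + C * x * z + D * y ^ 2 + E * y * z + F * z ^ 2 =
        L.mulVec ![x, y, z] 0 * L.mulVec ![x, y, z] 1 := by
  suffices hs : ∃ l m : Fin 3 → Ω, ∃ n : Fin 3 → Ω, (Matrix.of ![l, m, n]).det ≠ 0 ∧ ∀ x y z,
      A * x ^ 2 + B * x * y + C * x * z + D * y ^ 2 + E * y * z + F * z ^ 2 =
        (l 0 * x + l 1 * y + l 2 * z) * (m 0 * x + m 1 * y + m 2 * z) by
    obtain ⟨l, m, n, hd, hf⟩ := hs
    refine ⟨_, hd, fun x y z => ?_⟩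
    rw [hf]
    simp [Matrix.mulVec, dotProduct, Fin.sum_univ_three]
  rcases h with h | h | h
  · exact exists_factor_aux h h0
  · obtain ⟨l, m, n, hd, hf⟩ := exists_factor_aux (A := D) (B := B) (C := E) (D := A) (E := C) (F := F)
      h (by linear_combination h0)
    refine ⟨![l 1, l 0, l 2], ![m 1, m 0, m 2], ![n 1, n 0, n 2], ?_, fun x y z => ?_⟩
    · intro h'
      apply hd
      rw [Matrix.det_fin_three] at h' ⊢
      simp at h' ⊢
      linear_combination -h'
    · have := hf y x z
      simp
      linear_combination this
  · obtain ⟨l, m, n, hd, hf⟩ := exists_factor_aux (A := F) (B := E) (C := C) (D := D) (E := B) (F := A)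
      (by intro h'; exact h (by linear_combination h')) (by linear_combination h0)
    refine ⟨![l 2, l 1, l 0], ![m 2, m 1, m 0], ![n 2, n 1, n 0], ?_, fun x y z => ?_⟩
    · intro h'
      apply hd
      rw [Matrix.det_fin_three] at h' ⊢
      simp at h' ⊢
      linear_combination -h'
    · have := hf z y x
      simp
      linear_combination this

end Pencil

section Roots

namespace Cf

variable {R : Type*} [CommRing R] (c : Cf R)

/-- The derivative of `q_s(x, y, z)` with respect to the parameter `s`. -/
def dq (s x y z : R) : R :=
  (c.a1 + 2 * c.a2 * s + 3 * c.a3 * s ^ 2) * x ^ 2 + (c.b1 + 2 * c.b2 * s) * x * y +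
    (c.c1 + 2 * c.c2 * s) * x * z + c.d1 * y ^ 2 + c.e1 * y * z + c.f1 * z ^ 2

/-- Smoothness of the total space of a conic bundle along the singular points of its fibres. -/
structure Smooth : Prop where
  fin : ∀ s x y z, (x ≠ 0 ∨ y ≠ 0 ∨ z ≠ 0) →
    InKernel (c.A s) (c.B s) (c.C s) (c.D s) (c.E s) (c.F s) x y z → c.dq s x y z ≠ 0
  inf : ∀ x y z, (x ≠ 0 ∨ y ≠ 0 ∨ z ≠ 0) → InKernel c.a3 c.b2 c.c2 c.d1 c.e1 c.f1 x y z →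
    c.a2 * x ^ 2 + c.b1 * x * y + c.c1 * x * z + c.d0 * y ^ 2 + c.e0 * y * z + c.f0 * z ^ 2 ≠ 0

/-- The coefficients of the discriminant as a polynomial in the parameter. -/
def discCoef : ℕ → R
  | 0 => 4 * c.a0 * c.d0 * c.f0 + c.b0 * c.c0 * c.e0 - c.a0 * c.e0 * c.e0 - c.c0 * c.c0 * c.d0 - c.b0 * c.b0 * c.f0
  | 1 => 4 * c.a0 * c.d0 * c.f1 + 4 * c.a0 * c.d1 * c.f0 + 4 * c.a1 * c.d0 * c.f0 + c.b0 * c.c0 * c.e1 + c.b0 * c.c1 * c.e0 + c.b1 * c.c0 * c.e0 - c.a0 * c.e0 * c.e1 - c.a0 * c.e1 * c.e0 - c.a1 * c.e0 * c.e0 - c.c0 * c.c0 * c.d1 - c.c0 * c.c1 * c.d0 - c.c1 * c.c0 * c.d0 - c.b0 * c.b0 * c.f1 - c.b0 * c.b1 * c.f0 - c.b1 * c.b0 * c.f0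
  | 2 => 4 * c.a0 * c.d1 * c.f1 + 4 * c.a1 * c.d0 * c.f1 + 4 * c.a1 * c.d1 * c.f0 + 4 * c.a2 * c.d0 * c.f0 + c.b0 * c.c1 * c.e1 + c.b0 * c.c2 * c.e0 + c.b1 * c.c0 * c.e1 + c.b1 * c.c1 * c.e0 + c.b2 * c.c0 * c.e0 - c.a0 * c.e1 * c.e1 - c.a1 * c.e0 * c.e1 - c.a1 * c.e1 * c.e0 - c.a2 * c.e0 * c.e0 - c.c0 * c.c1 * c.d1 - c.c0 * c.c2 * c.d0 - c.c1 * c.c0 * c.d1 - c.c1 * c.c1 * c.d0 - c.c2 * c.c0 * c.d0 - c.b0 * c.b1 * c.f1 - c.b0 * c.b2 * c.f0 - c.b1 * c.b0 * c.f1 - c.b1 * c.b1 * c.f0 - c.b2 * c.b0 * c.f0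
  | 3 => 4 * c.a1 * c.d1 * c.f1 + 4 * c.a2 * c.d0 * c.f1 + 4 * c.a2 * c.d1 * c.f0 + 4 * c.a3 * c.d0 * c.f0 + c.b0 * c.c2 * c.e1 + c.b1 * c.c1 * c.e1 + c.b1 * c.c2 * c.e0 + c.b2 * c.c0 * c.e1 + c.b2 * c.c1 * c.e0 - c.a1 * c.e1 * c.e1 - c.a2 * c.e0 * c.e1 - c.a2 * c.e1 * c.e0 - c.a3 * c.e0 * c.e0 - c.c0 * c.c2 * c.d1 - c.c1 * c.c1 * c.d1 - c.c1 * c.c2 * c.d0 - c.c2 * c.c0 * c.d1 - c.c2 * c.c1 * c.d0 - c.b0 * c.b2 * c.f1 - c.b1 * c.b1 * c.f1 - c.b1 * c.b2 * c.f0 - c.b2 * c.b0 * c.f1 - c.b2 * c.b1 * c.f0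
  | 4 => 4 * c.a2 * c.d1 * c.f1 + 4 * c.a3 * c.d0 * c.f1 + 4 * c.a3 * c.d1 * c.f0 + c.b1 * c.c2 * c.e1 + c.b2 * c.c1 * c.e1 + c.b2 * c.c2 * c.e0 - c.a2 * c.e1 * c.e1 - c.a3 * c.e0 * c.e1 - c.a3 * c.e1 * c.e0 - c.c1 * c.c2 * c.d1 - c.c2 * c.c1 * c.d1 - c.c2 * c.c2 * c.d0 - c.b1 * c.b2 * c.f1 - c.b2 * c.b1 * c.f1 - c.b2 * c.b2 * c.f0
  | 5 => 4 * c.a3 * c.d1 * c.f1 + c.b2 * c.c2 * c.e1 - c.a3 * c.e1 * c.e1 - c.c2 * c.c2 * c.d1 - c.b2 * c.b2 * c.f1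
  | _ => 0

open Polynomial in
/-- The discriminant as a polynomial in the parameter. -/
noncomputable def discPoly : Polynomial R := ∑ i ∈ Finset.range 6, Polynomial.C (c.discCoef i) * X ^ i

lemma eval_discPoly (s : R) : c.discPoly.eval s = c.disc s := by
  simp [discPoly, Finset.sum_range_succ, discCoef, disc, A, B, C, D, E, F]
  ring

lemma eval_derivative_discPoly (s : R) : (Polynomial.derivative c.discPoly).eval s =
    (c.a1 + 2 * c.a2 * s + 3 * c.a3 * s ^ 2) * (4 * c.D s * c.F s - c.E s ^ 2) +
      c.d1 * (4 * c.A s * c.F s - c.C s ^ 2) + c.f1 * (4 * c.A s * c.D s - c.B s ^ 2) +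
      (c.b1 + 2 * c.b2 * s) * (c.C s * c.E s - 2 * c.B s * c.F s) +
      (c.c1 + 2 * c.c2 * s) * (c.B s * c.E s - 2 * c.C s * c.D s) +
      c.e1 * (c.B s * c.C s - 2 * c.A s * c.E s) := by
  simp only [discPoly, Finset.sum_range_succ, Finset.sum_range_zero, discCoef,
    A, B, C, D, E, F, Polynomial.derivative_add, Polynomial.derivative_mul,
    Polynomial.derivative_C, Polynomial.derivative_X_pow, Polynomial.eval_add,
    Polynomial.eval_mul, Polynomial.eval_C, Polynomial.eval_pow, Polynomial.eval_X,
    Polynomial.derivative_zero, Polynomial.eval_zero]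
  push_cast
  ring

lemma coeff_discPoly (i : ℕ) (hi : i < 6) : c.discPoly.coeff i = c.discCoef i := by
  rw [discPoly, Polynomial.finsetSum_coeff, Finset.sum_eq_single i]
  · simp
  · intro j _ hj
    rw [Polynomial.coeff_C_mul, Polynomial.coeff_X_pow, if_neg (Ne.symm hj), mul_zero]
  · intro h
    exact absurd (Finset.mem_range.2 hi) h

end Cf

variable {Ω : Type*} [Field Ω] [IsAlgClosed Ω] [CharZero Ω]

lemma Cf.Smooth.four_le_natDegree {c : Cf Ω} (h : c.Smooth) : 4 ≤ c.discPoly.natDegree := by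
  by_contra! hlt
  have h5 : c.discCoef 5 = 0 := by
    rw [← c.coeff_discPoly 5 (by norm_num)]
    exact Polynomial.coeff_eq_zero_of_natDegree_lt (by omega)
  have h4 : c.discCoef 4 = 0 := by
    rw [← c.coeff_discPoly 4 (by norm_num)]
    exact Polynomial.coeff_eq_zero_of_natDegree_lt (by omega)
  simp only [Cf.discCoef] at h4 h5
  obtain ⟨x, y, z, hn, hk, hz⟩ := exists_kernel_zero (A := c.a3) (B := c.b2) (C := c.c2)
    (D := c.d1) (E := c.e1) (F := c.f1) (A' := c.a2) (B' := c.b1) (C' := c.c1) (D' := c.d0)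
    (E' := c.e0) (F' := c.f0) (by linear_combination h5) (by linear_combination h4)
  exact h.inf x y z hn hk hz

lemma Cf.Smooth.derivative_ne {c : Cf Ω} (h : c.Smooth) {s : Ω} (hs : c.disc s = 0) :
    (Polynomial.derivative c.discPoly).eval s ≠ 0 := by
  intro h'
  rw [c.eval_derivative_discPoly] at h'
  obtain ⟨x, y, z, hn, hk, hz⟩ := exists_kernel_zero hs h'
  exact h.fin s x y z hn hk hz

lemma Cf.Smooth.exists_roots {c : Cf Ω} (h : c.Smooth) :
    ∃ r : Fin 4 → Ω, Injective r ∧ ∀ j, c.disc (r j) = 0 := by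
  classical
  have h0 : c.discPoly ≠ 0 := by
    intro h0
    have := h.four_le_natDegree
    simp [h0] at this
  have hnd : c.discPoly.roots.Nodup := by
    rw [Multiset.nodup_iff_count_le_one]
    intro s
    rw [Polynomial.count_roots]
    by_contra! hlt
    obtain ⟨h1, h2⟩ := (Polynomial.one_lt_rootMultiplicity_iff_isRoot h0).1 hlt
    rw [Polynomial.IsRoot, c.eval_discPoly] at h1
    exact h.derivative_ne h1 h2
  have hcard : 4 ≤ c.discPoly.roots.toFinset.card := by
    rw [Multiset.toFinset_card_of_nodup hnd, IsAlgClosed.card_roots_eq_natDegree]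
    exact h.four_le_natDegree
  obtain ⟨e⟩ : Nonempty (Fin 4 ↪ c.discPoly.roots.toFinset) :=
    Function.Embedding.nonempty_of_card_le (by simpa using hcard)
  refine ⟨fun j => e j, fun i j hij => e.injective (Subtype.ext hij), fun j => ?_⟩
  have := (e j).2
  rw [Multiset.mem_toFinset, Polynomial.mem_roots h0, Polynomial.IsRoot, c.eval_discPoly] at this
  exact this

lemma Cf.Smooth.nonempty_splitting {c : Cf Ω} (h : c.Smooth) : Nonempty (Splitting c) := by
  obtain ⟨r, hr, hd⟩ := h.exists_roots
  have : ∀ j, ∃ L : Matrix (Fin 3) (Fin 3) Ω, L.det ≠ 0 ∧ ∀ x y z,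
      c.q (r j) x y z = L.mulVec ![x, y, z] 0 * L.mulVec ![x, y, z] 1 := by
    intro j
    refine exists_factor ?_ (hd j)
    by_contra! hn
    obtain ⟨ha, hb, hc⟩ := hn
    have h0 := hd j
    simp only [Cf.disc] at h0
    refine h.derivative_ne (hd j) ?_
    rw [c.eval_derivative_discPoly, ha, hb, hc]
    have e1 : c.C (r j) * c.E (r j) - 2 * c.B (r j) * c.F (r j) = 0 := by
      rw [← pow_eq_zero_iff two_ne_zero]
      linear_combination (4 * c.A (r j) * c.F (r j) - c.C (r j) ^ 2) * ha - 4 * c.F (r j) * h0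
    have e2 : c.B (r j) * c.E (r j) - 2 * c.C (r j) * c.D (r j) = 0 := by
      rw [← pow_eq_zero_iff two_ne_zero]
      linear_combination (4 * c.A (r j) * c.D (r j) - c.B (r j) ^ 2) * ha - 4 * c.D (r j) * h0
    have e3 : c.B (r j) * c.C (r j) - 2 * c.A (r j) * c.E (r j) = 0 := by
      rw [← pow_eq_zero_iff two_ne_zero]
      linear_combination (4 * c.A (r j) * c.D (r j) - c.B (r j) ^ 2) * hb - 4 * c.A (r j) * h0
    rw [e1, e2, e3]
    ring
  choose L hL hf using this
  exact ⟨⟨r, hr, L, hL, hf, hd⟩⟩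

omit [IsAlgClosed Ω] [CharZero Ω] in
/-- A splitting over an algebraic extension is defined over a finite subextension. -/
lemma Splitting.descend {k : Type*} [Field k] [Algebra k Ω] [Algebra.IsIntegral k Ω] {c : Cf k}
    (P : Splitting (c.map (algebraMap k Ω))) : ∃ K : IntermediateField k Ω,
      FiniteDimensional k K ∧ Nonempty (Splitting (c.map (algebraMap k K))) := by
  let T : Set Ω := Set.range P.r ∪ Set.range fun t : Fin 4 × Fin 3 × Fin 3 => P.L t.1 t.2.1 t.2.2
  have hT : T.Finite := (Set.finite_range _).union (Set.finite_range _)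
  let K := IntermediateField.adjoin k T
  have : Finite T := hT
  have hr : ∀ j, P.r j ∈ K := fun j => IntermediateField.subset_adjoin _ _ (Or.inl ⟨j, rfl⟩)
  have hL : ∀ j i i', P.L j i i' ∈ K := fun j i i' =>
    IntermediateField.subset_adjoin _ _ (Or.inr ⟨(j, i, i'), rfl⟩)
  have hinj : Injective (algebraMap K Ω) := (algebraMap K Ω).injective
  have hc : c.map (algebraMap k Ω) = (c.map (algebraMap k K)).map (algebraMap K Ω) := by
    rw [Cf.map_map, ← IsScalarTower.algebraMap_eq]
  let r : Fin 4 → K := fun j => ⟨P.r j, hr j⟩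
  let L : Fin 4 → Matrix (Fin 3) (Fin 3) K := fun j => Matrix.of fun i i' => ⟨P.L j i i', hL j i i'⟩
  have hmap : ∀ j, P.L j = (algebraMap K Ω).mapMatrix (L j) := fun j => rfl
  refine ⟨K, IntermediateField.finiteDimensional_adjoin fun x _ => Algebra.IsIntegral.isIntegral x,
    ⟨⟨r, fun i j hij => P.inj (congrArg (algebraMap K Ω) hij), L, fun j h0 => ?_, fun j x y z => ?_,
      fun j => ?_⟩⟩⟩
  · refine P.det_ne j ?_
    rw [hmap, ← RingHom.map_det, h0, map_zero]
  · have h := P.fac j (algebraMap K Ω x) (algebraMap K Ω y) (algebraMap K Ω z)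
    apply hinj
    have hq : (c.map (algebraMap k Ω)).q (P.r j) (algebraMap K Ω x) (algebraMap K Ω y)
        (algebraMap K Ω z) = algebraMap K Ω ((c.map (algebraMap k K)).q (r j) x y z) := by
      have h' := Cf.map_q (algebraMap K Ω) (c.map (algebraMap k K)) (r j) x y z
      rw [← hc] at h'
      exact h'
    rw [← hq, h, map_mul]
    simp [Matrix.mulVec, dotProduct, Fin.sum_univ_three, hmap]
  · apply hinj
    have h' := Cf.map_disc (algebraMap K Ω) (c.map (algebraMap k K)) (r j)
    rw [← hc] at h'
    rw [map_zero, ← h']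
    exact P.disc_zero j

end Roots

section Number

variable {k : Type*} [Field k] [NumberField k]

lemma exists_splitting {c : Cf k} (h : (c.map (algebraMap k (AlgebraicClosure k))).Smooth) :
    ∃ K : IntermediateField k (AlgebraicClosure k), NumberField K ∧
      Nonempty (Splitting (c.map (algebraMap k K))) := by
  obtain ⟨P⟩ := h.nonempty_splitting
  obtain ⟨K, hK, hP⟩ := P.descend
  exact ⟨K, NumberField.of_module_finite k K, hP⟩

end Number

section Trilinear

open MvPolynomial

/-- The trilinear form with coefficients `u`. -/
def tri {R : Type*} [CommRing R] (u : Fin 4 → Fin 4 → Fin 4 → R) (x y z : Fin 4 → R) : R :=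
  ∑ i, ∑ j, ∑ l, u i j l * x i * y j * z l

section Ring

variable {R : Type*} [CommRing R] (u : Fin 4 → Fin 4 → Fin 4 → R)

lemma tri_add₁ (x x' y z) : tri u (x + x') y z = tri u x y z + tri u x' y z := by
  simp only [tri, Pi.add_apply, mul_add, add_mul, Finset.sum_add_distrib]

lemma tri_add₂ (x y y' z) : tri u x (y + y') z = tri u x y z + tri u x y' z := by
  simp only [tri, Pi.add_apply, mul_add, add_mul, Finset.sum_add_distrib]

lemma tri_add₃ (x y z z') : tri u x y (z + z') = tri u x y z + tri u x y z' := by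
  simp only [tri, Pi.add_apply, mul_add, Finset.sum_add_distrib]

lemma tri_smul₁ (a : R) (x y z) : tri u (a • x) y z = a * tri u x y z := by
  simp only [tri, Pi.smul_apply, smul_eq_mul, Finset.mul_sum]
  exact Finset.sum_congr rfl fun i _ => Finset.sum_congr rfl fun j _ =>
    Finset.sum_congr rfl fun l _ => by ring

lemma tri_smul₂ (a : R) (x y z) : tri u x (a • y) z = a * tri u x y z := by
  simp only [tri, Pi.smul_apply, smul_eq_mul, Finset.mul_sum]
  exact Finset.sum_congr rfl fun i _ => Finset.sum_congr rfl fun j _ =>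
    Finset.sum_congr rfl fun l _ => by ring

lemma tri_smul₃ (a : R) (x y z) : tri u x y (a • z) = a * tri u x y z := by
  simp only [tri, Pi.smul_apply, smul_eq_mul, Finset.mul_sum]
  exact Finset.sum_congr rfl fun i _ => Finset.sum_congr rfl fun j _ =>
    Finset.sum_congr rfl fun l _ => by ring

lemma map_tri {S : Type*} [CommRing S] (f : R →+* S) (x y z) :
    f (tri u x y z) = tri (fun i j l => f (u i j l)) (f ∘ x) (f ∘ y) (f ∘ z) := by
  simp [tri, map_sum]

/-- A cubic form in four variables comes from a trilinear form. -/
lemma exists_tri {F : MvPolynomial (Fin 4) R} (hF : F.IsHomogeneous 3) :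
    ∃ u : Fin 4 → Fin 4 → Fin 4 → R, F = ∑ i, ∑ j, ∑ l, C (u i j l) * (X i * X j * X l) := by
  have key : ∀ d ∈ F.support, ∃ u : Fin 4 → Fin 4 → Fin 4 → R,
      monomial d (F.coeff d) = ∑ i, ∑ j, ∑ l, C (u i j l) * (X i * X j * X l) := by
    intro d hd
    have h3 : d.degree = 3 := by
      have := hF (mem_support_iff.1 hd)
      rwa [Finsupp.degree_eq_weight_one]
    have hc : Multiset.card (Finsupp.toMultiset d) = 3 := by
      rw [Finsupp.card_toMultiset, ← h3, Finsupp.degree_eq_sum, Finsupp.sum_fintype _ _ (by simp)]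
      rfl
    obtain ⟨i, j, l, hm⟩ := Multiset.card_eq_three.1 hc
    have hd' : d = Finsupp.single i 1 + Finsupp.single j 1 + Finsupp.single l 1 := by
      apply LeftInverse.injective Finsupp.toMultiset_toFinsupp
      rw [hm]
      simp [Finsupp.toMultiset_single]
    refine ⟨fun i' j' l' => if i' = i then if j' = j then if l' = l then F.coeff d else 0
      else 0 else 0, ?_⟩
    have hmon : monomial d (F.coeff d) = C (F.coeff d) * (X i * X j * X l) := by
      conv_lhs => rw [← mul_one (F.coeff d)]
      rw [← C_mul_monomial]
      conv_lhs => rw [hd']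
      rw [X, X, X, monomial_mul, monomial_mul, one_mul, one_mul, ← hd']
    rw [hmon, Finset.sum_eq_single i, Finset.sum_eq_single j, Finset.sum_eq_single l]
    · simp
    all_goals simp +contextual
  have hs : ∃ u : Fin 4 → Fin 4 → Fin 4 → R, ∑ d ∈ F.support, monomial d (F.coeff d) =
      ∑ i, ∑ j, ∑ l, C (u i j l) * (X i * X j * X l) := by
    refine Finset.sum_induction (fun d => monomial d (F.coeff d))
      (fun p => ∃ u : Fin 4 → Fin 4 → Fin 4 → R,
        p = ∑ i, ∑ j, ∑ l, C (u i j l) * (X i * X j * X l)) ?_ ⟨0, by simp⟩ key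
    rintro _ _ ⟨u, rfl⟩ ⟨v, rfl⟩
    exact ⟨u + v, by simp only [Pi.add_apply, map_add, add_mul, Finset.sum_add_distrib]⟩
  obtain ⟨u, hu⟩ := hs
  exact ⟨u, by rw [← hu, support_sum_monomial_coeff]⟩

lemma eval_tri (z : Fin 4 → R) :
    eval z (∑ i, ∑ j, ∑ l, C (u i j l) * (X i * X j * X l)) = tri u z z z := by
  simp [tri, map_sum, mul_assoc]

lemma sum_pderiv_tri (z w : Fin 4 → R) :
    ∑ m, w m * eval z (pderiv m (∑ i, ∑ j, ∑ l, C (u i j l) * (X i * X j * X l))) =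
      tri u w z z + tri u z w z + tri u z z w := by
  have h : ∀ i j l : Fin 4, ∑ m, w m * eval z (pderiv m (C (u i j l) * (X i * X j * X l))) =
      u i j l * w i * z j * z l + u i j l * z i * w j * z l + u i j l * z i * z j * w l := by
    intro i j l
    have hp : ∀ m : Fin 4, w m * eval z (pderiv m (C (u i j l) * (X i * X j * X l))) =
        u i j l * z j * z l * (if i = m then w m else 0) +
        u i j l * z i * z l * (if j = m then w m else 0) +
        u i j l * z i * z j * (if l = m then w m else 0) := by
      intro m
      simp only [Derivation.leibniz, pderiv_C, pderiv_X, smul_eq_mul, Pi.single_apply]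
      split_ifs <;> simp <;> ring
    simp only [hp, Finset.sum_add_distrib, ← Finset.mul_sum, Finset.sum_ite_eq, Finset.mem_univ,
      if_true]
    ring
  simp only [map_sum, Finset.mul_sum]
  rw [Finset.sum_comm]
  simp only [tri, ← Finset.sum_add_distrib]
  refine Finset.sum_congr rfl fun i _ => ?_
  rw [Finset.sum_comm]
  refine Finset.sum_congr rfl fun j _ => ?_
  rw [Finset.sum_comm]
  exact Finset.sum_congr rfl fun l _ => h i j l

end Ring

end Trilinear

section NormalForm

namespace Cf

variable {R : Type*} [CommRing R] (c : Cf R)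

/-- The cubic form whose intersections with the planes `σ = s τ` are `τ = 0` and the conics `q_s`. -/
def cub (τ σ y z : R) : R :=
  c.a0 * τ ^ 3 + c.a1 * τ ^ 2 * σ + c.a2 * τ * σ ^ 2 + c.a3 * σ ^ 3 +
    (c.b0 * τ ^ 2 + c.b1 * τ * σ + c.b2 * σ ^ 2) * y +
    (c.c0 * τ ^ 2 + c.c1 * τ * σ + c.c2 * σ ^ 2) * z +
    (c.d0 * τ + c.d1 * σ) * y ^ 2 + (c.e0 * τ + c.e1 * σ) * y * z + (c.f0 * τ + c.f1 * σ) * z ^ 2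

/-- The partial derivatives of `cub`. -/
def grad (τ σ y z : R) : Fin 4 → R := ![
  3 * c.a0 * τ ^ 2 + 2 * c.a1 * τ * σ + c.a2 * σ ^ 2 + (2 * c.b0 * τ + c.b1 * σ) * y +
    (2 * c.c0 * τ + c.c1 * σ) * z + c.d0 * y ^ 2 + c.e0 * y * z + c.f0 * z ^ 2,
  c.a1 * τ ^ 2 + 2 * c.a2 * τ * σ + 3 * c.a3 * σ ^ 2 + (c.b1 * τ + 2 * c.b2 * σ) * y +
    (c.c1 * τ + 2 * c.c2 * σ) * z + c.d1 * y ^ 2 + c.e1 * y * z + c.f1 * z ^ 2,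
  c.b0 * τ ^ 2 + c.b1 * τ * σ + c.b2 * σ ^ 2 + 2 * (c.d0 * τ + c.d1 * σ) * y +
    (c.e0 * τ + c.e1 * σ) * z,
  c.c0 * τ ^ 2 + c.c1 * τ * σ + c.c2 * σ ^ 2 + (c.e0 * τ + c.e1 * σ) * y +
    2 * (c.f0 * τ + c.f1 * σ) * z]

lemma cub_mul (s τ y z : R) : c.cub τ (s * τ) y z = τ * c.q s τ y z := by
  simp only [cub, q, A, B, C, D, E, F]
  ring

lemma euler (τ σ y z : R) : τ * c.grad τ σ y z 0 + σ * c.grad τ σ y z 1 + y * c.grad τ σ y z 2 +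
    z * c.grad τ σ y z 3 = 3 * c.cub τ σ y z := by
  simp [grad, cub]
  ring

/-- The coefficients of the restriction of a trilinear form to the diagonal. -/
def ofTri (w : Fin 4 → Fin 4 → Fin 4 → R) : Cf R where
  a0 := w 0 0 0
  a1 := w 0 0 1 + w 0 1 0 + w 1 0 0
  a2 := w 0 1 1 + w 1 0 1 + w 1 1 0
  a3 := w 1 1 1
  b0 := w 0 0 2 + w 0 2 0 + w 2 0 0
  b1 := w 0 1 2 + w 0 2 1 + w 1 0 2 + w 1 2 0 + w 2 0 1 + w 2 1 0
  b2 := w 1 1 2 + w 1 2 1 + w 2 1 1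
  c0 := w 0 0 3 + w 0 3 0 + w 3 0 0
  c1 := w 0 1 3 + w 0 3 1 + w 1 0 3 + w 1 3 0 + w 3 0 1 + w 3 1 0
  c2 := w 1 1 3 + w 1 3 1 + w 3 1 1
  d0 := w 0 2 2 + w 2 0 2 + w 2 2 0
  d1 := w 1 2 2 + w 2 1 2 + w 2 2 1
  e0 := w 0 2 3 + w 0 3 2 + w 2 0 3 + w 2 3 0 + w 3 0 2 + w 3 2 0
  e1 := w 1 2 3 + w 1 3 2 + w 2 1 3 + w 2 3 1 + w 3 1 2 + w 3 2 1
  f0 := w 0 3 3 + w 3 0 3 + w 3 3 0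
  f1 := w 1 3 3 + w 3 1 3 + w 3 3 1

lemma map_ofTri {S : Type*} [CommRing S] (f : R →+* S) (w : Fin 4 → Fin 4 → Fin 4 → R) :
    (ofTri w).map f = ofTri fun i j l => f (w i j l) := by
  simp [ofTri, map]

/-- The trilinear form vanishes on the diagonal of the span of the last two basis vectors. -/
structure Vanishing (w : Fin 4 → Fin 4 → Fin 4 → R) : Prop where
  h222 : w 2 2 2 = 0
  h333 : w 3 3 3 = 0
  h223 : w 2 2 3 + w 2 3 2 + w 3 2 2 = 0
  h233 : w 2 3 3 + w 3 2 3 + w 3 3 2 = 0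

variable (u : Fin 4 → Fin 4 → Fin 4 → R) (h : Fin 4 → Fin 4 → R)

/-- A linear combination of four vectors. -/
def comb (τ σ y z : R) : Fin 4 → R := τ • h 0 + σ • h 1 + y • h 2 + z • h 3

variable {u h}

lemma tri_comb (hw : Vanishing fun i j l => tri u (h i) (h j) (h l)) (τ σ y z : R) :
    tri u (comb h τ σ y z) (comb h τ σ y z) (comb h τ σ y z) =
      (ofTri fun i j l => tri u (h i) (h j) (h l)).cub τ σ y z := by
  obtain ⟨h1, h2, h3, h4⟩ := hw
  simp only [comb, cub, ofTri, tri_add₁, tri_add₂, tri_add₃, tri_smul₁, tri_smul₂, tri_smul₃]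
  linear_combination y ^ 3 * h1 + z ^ 3 * h2 + y ^ 2 * z * h3 + y * z ^ 2 * h4

lemma dtri_comb (hw : Vanishing fun i j l => tri u (h i) (h j) (h l)) (τ σ y z : R) (i : Fin 4) :
    tri u (h i) (comb h τ σ y z) (comb h τ σ y z) + tri u (comb h τ σ y z) (h i) (comb h τ σ y z) +
      tri u (comb h τ σ y z) (comb h τ σ y z) (h i) =
      (ofTri fun i j l => tri u (h i) (h j) (h l)).grad τ σ y z i := by
  obtain ⟨h1, h2, h3, h4⟩ := hw
  simp only [comb, tri_add₁, tri_add₂, tri_add₃, tri_smul₁, tri_smul₂, tri_smul₃]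
  fin_cases i
  · simp [grad, ofTri]
    ring
  · simp [grad, ofTri]
    ring
  · simp [grad, ofTri]
    linear_combination 3 * y ^ 2 * h1 + 2 * y * z * h3 + z ^ 2 * h4
  · simp [grad, ofTri]
    linear_combination 3 * z ^ 2 * h2 + y ^ 2 * h3 + 2 * y * z * h4

end Cf

lemma Cf.smooth_of_grad_ne {Ω : Type*} [Field Ω] [CharZero Ω] {c : Cf Ω}
    (h : ∀ τ σ y z, (τ ≠ 0 ∨ σ ≠ 0 ∨ y ≠ 0 ∨ z ≠ 0) → ∃ i, c.grad τ σ y z i ≠ 0) : c.Smooth := by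
  constructor
  · rintro s x y z hn ⟨h1, h2, h3⟩ h0
    obtain ⟨i, hi⟩ := h x (s * x) y z (by tauto)
    apply hi
    simp only [grad, dq, A, B, C, D, E, F] at *
    fin_cases i
    · simp
      linear_combination -s * h0 + (3 * x * h1 + y * h2 + z * h3) / 2
    · simp
      linear_combination h0
    · simp
      linear_combination x * h2
    · simp
      linear_combination x * h3
  · rintro x y z hn ⟨h1, h2, h3⟩ h0
    obtain ⟨i, hi⟩ := h 0 x y z (by tauto)
    apply hi
    simp only [grad]
    fin_cases i
    · simp
      linear_combination h0
    · simp
      linear_combination (3 * x * h1 + y * h2 + z * h3) / 2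
    · simp
      linear_combination x * h2
    · simp
      linear_combination x * h3

end NormalForm

section Chart

open MvPolynomial

lemma Cf.comb_eq_vecMul {R : Type*} [CommRing R] (h : Fin 4 → Fin 4 → R) (τ σ y z : R) :
    Cf.comb h τ σ y z = Matrix.vecMul ![τ, σ, y, z] (Matrix.of h) := by
  ext i
  simp [Cf.comb, Matrix.vecMul, dotProduct, Fin.sum_univ_four]

/-- A cubic form vanishing on the span of the last two vectors of `h` becomes `c.cub` in the
coordinates given by `h`. -/
structure Chart {k : Type*} [Field k] (Ω : Type*) [Field Ω] [Algebra k Ω]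
    (F : MvPolynomial (Fin 4) k) (h : Fin 4 → Fin 4 → k) (c : Cf k) : Prop where
  eval_eq : ∀ τ σ y z, eval (Cf.comb (fun i j => algebraMap k Ω (h i j)) τ σ y z)
    (map (algebraMap k Ω) F) = (c.map (algebraMap k Ω)).cub τ σ y z
  inj : ∀ τ σ y z, Cf.comb (fun i j => algebraMap k Ω (h i j)) τ σ y z = 0 →
    τ = 0 ∧ σ = 0 ∧ y = 0 ∧ z = 0
  smooth : (c.map (algebraMap k Ω)).Smooth

lemma exists_chart {k : Type*} [Field k] (Ω : Type*) [Field Ω] [CharZero Ω] [Algebra k Ω]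
    {F : MvPolynomial (Fin 4) k} (hF : F.IsHomogeneous 3)
    (hsmooth : ∀ z : Fin 4 → Ω, z ≠ 0 → eval z (map (algebraMap k Ω) F) = 0 →
      (fun i => eval z (pderiv i (map (algebraMap k Ω) F))) ≠ 0)
    {h : Fin 4 → Fin 4 → k} {N : Matrix (Fin 4) (Fin 4) k} (hN : Matrix.of h * N = 1)
    (hvan : ∀ y z : k, eval (y • h 2 + z • h 3) F = 0) : ∃ c : Cf k, Chart Ω F h c := by
  have : CharZero k := (algebraMap k Ω).charZero
  obtain ⟨u, hu⟩ := exists_tri hF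
  set φ := algebraMap k Ω
  let w : Fin 4 → Fin 4 → Fin 4 → k := fun i j l => tri u (h i) (h j) (h l)
  have hw : Cf.Vanishing w := by
    have hv : ∀ y z : k, y ^ 3 * w 2 2 2 + y ^ 2 * z * (w 2 2 3 + w 2 3 2 + w 3 2 2) +
        y * z ^ 2 * (w 2 3 3 + w 3 2 3 + w 3 3 2) + z ^ 3 * w 3 3 3 = 0 := by
      intro y z
      have := hvan y z
      rw [hu, eval_tri] at this
      simp only [tri_add₁, tri_add₂, tri_add₃, tri_smul₁, tri_smul₂, tri_smul₃] at this
      simp only [w]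
      linear_combination this
    have h1 := hv 1 0
    have h2 := hv 0 1
    have h3 := hv 1 1
    have h4 := hv 1 (-1)
    constructor
    · linear_combination h1
    · linear_combination h2
    · linear_combination (h3 - h4) / 2 - h2
    · linear_combination (h3 + h4) / 2 - h1
  set h' : Fin 4 → Fin 4 → Ω := fun i j => φ (h i j)
  set u' : Fin 4 → Fin 4 → Fin 4 → Ω := fun i j l => φ (u i j l)
  have hw' : (fun i j l => tri u' (h' i) (h' j) (h' l)) = fun i j l => φ (w i j l) := by
    funext i j l
    exact (map_tri u φ (h i) (h j) (h l)).symm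
  have hv' : Cf.Vanishing fun i j l => tri u' (h' i) (h' j) (h' l) := by
    rw [hw']
    constructor
    · rw [hw.h222, map_zero]
    · rw [hw.h333, map_zero]
    · rw [← map_add, ← map_add, hw.h223, map_zero]
    · rw [← map_add, ← map_add, hw.h233, map_zero]
  have hu' : map φ F = ∑ i, ∑ j, ∑ l, C (u' i j l) * (X i * X j * X l) := by
    rw [hu]
    simp [u']
  have hc : (Cf.ofTri w).map φ = Cf.ofTri fun i j l => tri u' (h' i) (h' j) (h' l) := by
    rw [hw', Cf.map_ofTri]
  have heval : ∀ τ σ y z, eval (Cf.comb h' τ σ y z) (map φ F) =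
      ((Cf.ofTri w).map φ).cub τ σ y z := by
    intro τ σ y z
    rw [hu', eval_tri, hc, Cf.tri_comb hv']
  have hN' : Matrix.of h' * N.map φ = 1 := by
    have : Matrix.of h' = (Matrix.of h).map φ := rfl
    rw [this, ← Matrix.map_mul, hN]
    exact Matrix.map_one φ (map_zero φ) (map_one φ)
  have hN'' : N.map φ * Matrix.of h' = 1 := mul_eq_one_comm.1 hN'
  have hinj : ∀ τ σ y z, Cf.comb h' τ σ y z = 0 → τ = 0 ∧ σ = 0 ∧ y = 0 ∧ z = 0 := by
    intro τ σ y z h0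
    rw [Cf.comb_eq_vecMul] at h0
    have h1 : ![τ, σ, y, z] = 0 := by
      have := congrArg (fun v => Matrix.vecMul v (N.map φ)) h0
      simpa only [Matrix.vecMul_vecMul, hN', Matrix.vecMul_one, Matrix.zero_vecMul] using this
    exact ⟨congrFun h1 0, congrFun h1 1, congrFun h1 2, congrFun h1 3⟩
  refine ⟨Cf.ofTri w, heval, hinj, Cf.smooth_of_grad_ne fun τ σ y z hn => ?_⟩
  by_contra! h0
  have hz : Cf.comb h' τ σ y z ≠ 0 := by
    intro h0
    have := hinj _ _ _ _ h0
    tauto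
  have hf : eval (Cf.comb h' τ σ y z) (map φ F) = 0 := by
    have := ((Cf.ofTri w).map φ).euler τ σ y z
    rw [h0, h0, h0, h0] at this
    rw [heval]
    linear_combination -this / 3
  refine hsmooth _ hz hf (funext fun i => ?_)
  have hd : ∀ v : Fin 4 → Ω, ∑ m, v m * eval (Cf.comb h' τ σ y z) (pderiv m (map φ F)) = 0 := by
    intro v
    have hv : v = Cf.comb h' (Matrix.vecMul v (N.map φ) 0) (Matrix.vecMul v (N.map φ) 1)
        (Matrix.vecMul v (N.map φ) 2) (Matrix.vecMul v (N.map φ) 3) := by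
      rw [Cf.comb_eq_vecMul]
      have : ![Matrix.vecMul v (N.map φ) 0, Matrix.vecMul v (N.map φ) 1,
        Matrix.vecMul v (N.map φ) 2, Matrix.vecMul v (N.map φ) 3] = Matrix.vecMul v (N.map φ) := by
        ext i
        fin_cases i <;> rfl
      rw [this, Matrix.vecMul_vecMul, hN'', Matrix.vecMul_one]
    have hb : ∀ i, ∑ m, h' i m * eval (Cf.comb h' τ σ y z) (pderiv m (map φ F)) = 0 := by
      intro i
      rw [hu', sum_pderiv_tri, Cf.dtri_comb hv', ← hc, h0]
    rw [hv]
    generalize Matrix.vecMul v (N.map φ) = a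
    have e : ∀ m, Cf.comb h' (a 0) (a 1) (a 2) (a 3) m * eval (Cf.comb h' τ σ y z)
        (pderiv m (map φ F)) = a 0 * (h' 0 m * eval (Cf.comb h' τ σ y z) (pderiv m (map φ F))) +
        a 1 * (h' 1 m * eval (Cf.comb h' τ σ y z) (pderiv m (map φ F))) +
        a 2 * (h' 2 m * eval (Cf.comb h' τ σ y z) (pderiv m (map φ F))) +
        a 3 * (h' 3 m * eval (Cf.comb h' τ σ y z) (pderiv m (map φ F))) := by
      intro m
      rw [Cf.comb]
      simp only [Pi.add_apply, Pi.smul_apply, smul_eq_mul]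
      ring
    simp only [e, Finset.sum_add_distrib, ← Finset.mul_sum, hb]
    simp
  have := hd (Pi.single i 1)
  simpa [Pi.single_apply] using this

lemma Cf.comb_add {R : Type*} [CommRing R] (h : Fin 4 → Fin 4 → R) (s t τ σ y z τ' σ' y' z' : R) :
    s • Cf.comb h τ σ y z + t • Cf.comb h τ' σ' y' z' =
      Cf.comb h (s * τ + t * τ') (s * σ + t * σ') (s * y + t * y') (s * z + t * z') := by
  ext i
  simp only [Cf.comb, Pi.add_apply, Pi.smul_apply, smul_eq_mul]
  ring

section Lines

variable {k : Type*} [Field k] {Ω : Type*} [Field Ω] [Algebra k Ω]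
  {F : MvPolynomial (Fin 4) k} {h : Fin 4 → Fin 4 → k} {c : Cf k}

lemma Chart.line_of_cub_eq_zero (H : Chart Ω F h c) {τ σ y z τ' σ' y' z' : Ω}
    (hne : ∀ a : Ω, ¬ (τ' = a * τ ∧ σ' = a * σ ∧ y' = a * y ∧ z' = a * z))
    (h0 : ∀ s t, (c.map (algebraMap k Ω)).cub (s * τ + t * τ') (s * σ + t * σ') (s * y + t * y')
      (s * z + t * z') = 0) :
    liesOnLineIn (map (algebraMap k Ω) F)
      (Cf.comb (fun i j => algebraMap k Ω (h i j)) τ σ y z) := by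
  refine ⟨Cf.comb (fun i j => algebraMap k Ω (h i j)) τ' σ' y' z', fun a ha => ?_, fun s t => ?_⟩
  · have h1 : Cf.comb (fun i j => algebraMap k Ω (h i j)) (a * τ + (-1) * τ') (a * σ + (-1) * σ')
        (a * y + (-1) * y') (a * z + (-1) * z') = 0 := by
      rw [← Cf.comb_add, ha, neg_one_smul, add_neg_cancel]
    obtain ⟨e1, e2, e3, e4⟩ := H.inj _ _ _ _ h1
    exact hne a ⟨by linear_combination -e1, by linear_combination -e2, by linear_combination -e3,
      by linear_combination -e4⟩
  · rw [Cf.comb_add, H.eval_eq, h0]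

lemma Chart.liesOnLineIn_of_zero (H : Chart Ω F h c) (y z : Ω) (hn : y ≠ 0 ∨ z ≠ 0) :
    liesOnLineIn (map (algebraMap k Ω) F)
      (Cf.comb (fun i j => algebraMap k Ω (h i j)) 0 0 y z) := by
  by_cases hy : y = 0
  · have hz : z ≠ 0 := by tauto
    refine H.line_of_cub_eq_zero (τ' := 0) (σ' := 0) (y' := 1) (z' := 0) ?_ (by simp [Cf.cub])
    rintro a ⟨-, -, h1, -⟩
    rw [hy, mul_zero] at h1
    exact one_ne_zero h1
  · refine H.line_of_cub_eq_zero (τ' := 0) (σ' := 0) (y' := 0) (z' := 1) ?_ (by simp [Cf.cub])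
    rintro a ⟨-, -, h1, h2⟩
    rcases mul_eq_zero.1 h1.symm with h3 | h3
    · rw [h3, zero_mul] at h2
      exact one_ne_zero h2
    · exact hy h3

lemma Chart.liesOnLineIn_of_disc [IsAlgClosed Ω] [CharZero Ω] (H : Chart Ω F h c) {s y z : Ω}
    (hd : (c.map (algebraMap k Ω)).disc s = 0) (hq : (c.map (algebraMap k Ω)).q s 1 y z = 0) :
    liesOnLineIn (map (algebraMap k Ω) F)
      (Cf.comb (fun i j => algebraMap k Ω (h i j)) 1 s y z) := by
  have key : ∀ x' y' z', (∀ a, ¬ (x' = a ∧ y' = a * y ∧ z' = a * z)) →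
      (∀ a b, (c.map (algebraMap k Ω)).q s (a + b * x') (a * y + b * y') (a * z + b * z') = 0) →
      liesOnLineIn (map (algebraMap k Ω) F)
        (Cf.comb (fun i j => algebraMap k Ω (h i j)) 1 s y z) := by
    intro x' y' z' hne hv
    refine H.line_of_cub_eq_zero (τ' := x') (σ' := s * x') (y' := y') (z' := z') ?_ fun a b => ?_
    · rintro a ⟨h1, -, h3, h4⟩
      exact hne a ⟨by rw [h1, mul_one], h3, h4⟩
    · have := hv a b
      have e : a * s + b * (s * x') = s * (a * 1 + b * x') := by ring
      rw [e, Cf.cub_mul, mul_one, this, mul_zero]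
  generalize c.map (algebraMap k Ω) = C at *
  obtain ⟨x0, y0, z0, hn, ⟨k1, k2, k3⟩, -⟩ := exists_kernel_zero (A' := (0:Ω)) (B' := 0) (C' := 0)
    (D' := 0) (E' := 0) (F' := 0) hd (by ring)
  by_cases hpar : ∃ a, x0 = a ∧ y0 = a * y ∧ z0 = a * z
  · obtain ⟨a, rfl, rfl, rfl⟩ := hpar
    have hx : x0 ≠ 0 := by
      rintro rfl
      simp at hn
    have l1 : 2 * C.A s + C.B s * y + C.C s * z = 0 := by
      apply mul_left_cancel₀ hx; linear_combination k1
    have l2 : C.B s + 2 * C.D s * y + C.E s * z = 0 := by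
      apply mul_left_cancel₀ hx; linear_combination k2
    have l3 : C.C s + C.E s * y + 2 * C.F s * z = 0 := by
      apply mul_left_cancel₀ hx; linear_combination k3
    obtain ⟨l, m, hlm, hz⟩ := exists_binary_zero (C.D s) (C.E s) (C.F s)
    refine key 0 l m ?_ fun a b => ?_
    · rintro a ⟨rfl, h1, h2⟩
      simp at h1 h2
      tauto
    · simp only [Cf.q] at hq ⊢
      linear_combination a ^ 2 * hq + b ^ 2 * hz + a * b * (l * l2 + m * l3)
  · refine key x0 y0 z0 (fun a ha => hpar ⟨a, ha⟩) fun a b => ?_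
    simp only [Cf.q] at hq ⊢
    linear_combination a ^ 2 * hq + (a * b + b ^ 2 * x0 / 2) * k1 +
      (a * b * y + b ^ 2 * y0 / 2) * k2 + (a * b * z + b ^ 2 * z0 / 2) * k3

end Lines

end Chart

section Frame

variable {k : Type*} [Field k]

/-- Two independent linear forms are the first two coordinates in a suitable basis. -/
lemma exists_frame (φ₀ φ₁ : (Fin 4 → k) →ₗ[k] k)
    (h₀ : ∃ v, φ₀ v = 1 ∧ φ₁ v = 0) (h₁ : ∃ v, φ₀ v = 0 ∧ φ₁ v = 1) :
    ∃ (h : Fin 4 → Fin 4 → k) (N : Matrix (Fin 4) (Fin 4) k), Matrix.of h * N = 1 ∧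
      (∀ y z : k, φ₀ (y • h 2 + z • h 3) = 0 ∧ φ₁ (y • h 2 + z • h 3) = 0) ∧
      ∀ P, Matrix.vecMul P N 0 = φ₀ P ∧ Matrix.vecMul P N 1 = φ₁ P := by
  obtain ⟨v₀, a₀, b₀⟩ := h₀
  obtain ⟨v₁, a₁, b₁⟩ := h₁
  set π := φ₀.prod φ₁ with hπ
  have hsurj : LinearMap.range π = ⊤ := by
    rw [LinearMap.range_eq_top]
    rintro ⟨s, t⟩
    refine ⟨s • v₀ + t • v₁, ?_⟩
    simp [hπ, a₀, b₀, a₁, b₁]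
  have hrank : Module.finrank k (LinearMap.ker π) = 2 := by
    have := LinearMap.finrank_range_add_finrank_ker π
    rw [hsurj, finrank_top] at this
    simp at this
    omega
  let b := Module.finBasisOfFinrankEq k (LinearMap.ker π) hrank
  have hb : ∀ i, φ₀ (b i) = 0 ∧ φ₁ (b i) = 0 := by
    intro i
    have := (b i).2
    rw [LinearMap.mem_ker] at this
    exact ⟨congrArg Prod.fst this, congrArg Prod.snd this⟩
  let h : Fin 4 → Fin 4 → k := ![v₀, v₁, b 0, b 1]
  have hspan : ∀ P, ∃ y z, P = Matrix.vecMul ![φ₀ P, φ₁ P, y, z] (Matrix.of h) := by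
    intro P
    have hmem : P - φ₀ P • v₀ - φ₁ P • v₁ ∈ LinearMap.ker π := by
      rw [LinearMap.mem_ker]
      simp [hπ, a₀, b₀, a₁, b₁]
    have hr := b.sum_repr ⟨_, hmem⟩
    rw [Fin.sum_univ_two] at hr
    have hr' := congrArg Subtype.val hr
    refine ⟨b.repr ⟨_, hmem⟩ 0, b.repr ⟨_, hmem⟩ 1, ?_⟩
    rw [← Cf.comb_eq_vecMul, Cf.comb]
    simp only [Submodule.coe_add, Submodule.coe_smul] at hr'
    change P = φ₀ P • v₀ + φ₁ P • v₁ + _ • (b 0 : Fin 4 → k) + _ • (b 1 : Fin 4 → k)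
    rw [add_assoc, hr']
    abel
  have hN : ∃ N : Matrix (Fin 4) (Fin 4) k, N * Matrix.of h = 1 := by
    choose y z hyz using hspan
    refine ⟨Matrix.of fun i => ![φ₀ (Pi.single i 1), φ₁ (Pi.single i 1), y (Pi.single i 1),
      z (Pi.single i 1)], ?_⟩
    ext i j
    have := congrFun (hyz (Pi.single i 1)) j
    rw [Matrix.mul_apply_eq_vecMul]
    rw [Matrix.one_eq_pi_single]
    exact this.symm
  obtain ⟨N, hN⟩ := hN
  have hN' := mul_eq_one_comm.1 hN
  refine ⟨h, N, hN', fun y z => ?_, fun P => ?_⟩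
  · simp [h, hb]
  · obtain ⟨y, z, hP⟩ := hspan P
    have : Matrix.vecMul P N = ![φ₀ P, φ₁ P, y, z] := by
      conv_lhs => rw [hP]
      rw [Matrix.vecMul_vecMul, hN', Matrix.vecMul_one]
    rw [this]
    exact ⟨rfl, rfl⟩

/-- Multiply all coefficients by `d`. -/
def Cf.scale {R : Type*} [CommRing R] (d : R) (c : Cf R) : Cf R :=
  ⟨d * c.a0, d * c.a1, d * c.a2, d * c.a3, d * c.b0, d * c.b1, d * c.b2, d * c.c0, d * c.c1,
    d * c.c2, d * c.d0, d * c.d1, d * c.e0, d * c.e1, d * c.f0, d * c.f1⟩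

lemma Cf.q_scale {R : Type*} [CommRing R] (d : R) (c : Cf R) (s x y z : R) :
    (c.scale d).q s x y z = d * c.q s x y z := by
  simp only [scale, q, A, B, C, D, E, F]
  ring

lemma Cf.disc_scale {R : Type*} [CommRing R] (d : R) (c : Cf R) (s : R) :
    (c.scale d).disc s = d ^ 3 * c.disc s := by
  simp only [scale, disc, A, B, C, D, E, F]
  ring

lemma Cf.map_scale {R S : Type*} [CommRing R] [CommRing S] (f : R →+* S) (d : R) (c : Cf R) :
    (c.scale d).map f = (c.map f).scale (f d) := by
  simp [scale, map]

lemma Cf.map_cub {R S : Type*} [CommRing R] [CommRing S] (f : R →+* S) (c : Cf R) (τ σ y z : R) :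
    (c.map f).cub (f τ) (f σ) (f y) (f z) = f (c.cub τ σ y z) := by
  simp [map, cub]

lemma Cf.Smooth.scale {Ω : Type*} [Field Ω] {c : Cf Ω} (h : c.Smooth) {d : Ω} (hd : d ≠ 0) :
    (c.scale d).Smooth := by
  constructor
  · rintro s x y z hn ⟨h1, h2, h3⟩ h0
    simp only [Cf.scale, Cf.A, Cf.B, Cf.C, Cf.D, Cf.E, Cf.F, Cf.dq] at h0 h1 h2 h3
    refine h.fin s x y z hn ⟨?_, ?_, ?_⟩ ?_ <;> apply mul_left_cancel₀ hd <;>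
      simp only [Cf.A, Cf.B, Cf.C, Cf.D, Cf.E, Cf.F, Cf.dq]
    · linear_combination h1
    · linear_combination h2
    · linear_combination h3
    · linear_combination h0
  · rintro x y z hn ⟨h1, h2, h3⟩ h0
    simp only [Cf.scale] at h0 h1 h2 h3
    refine h.inf x y z hn ⟨?_, ?_, ?_⟩ ?_ <;> apply mul_left_cancel₀ hd
    · linear_combination h1
    · linear_combination h2
    · linear_combination h3
    · linear_combination h0

lemma liesOnLineIn_smul {m : ℕ} {P : MvPolynomial (Fin m) k} {ξ : Fin m → k} (h : liesOnLineIn P ξ)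
    (a : k) : liesOnLineIn P (a • ξ) := by
  obtain ⟨w, h1, h2⟩ := h
  refine ⟨w, fun c => ?_, fun s t => ?_⟩
  · rw [smul_smul]
    exact h1 _
  · rw [smul_smul]
    exact h2 _ _

end Frame

section Integral

variable {k : Type*} [Field k] [NumberField k]

lemma Cf.exists_integral (c : Cf k) : ∃ (d : k) (c' : Cf (𝓞 k)), d ≠ 0 ∧
    c'.map (algebraMap (𝓞 k) k) = c.scale d := by
  obtain ⟨d, y, hd, hy⟩ := exists_integral_scaling
    (![c.a0, c.a1, c.a2, c.a3, c.b0, c.b1, c.b2, c.c0, c.c1, c.c2, c.d0, c.d1, c.e0, c.e1, c.f0,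
      c.f1] : Fin 16 → k)
  refine ⟨d, ⟨y 0, y 1, y 2, y 3, y 4, y 5, y 6, y 7, y 8, y 9, y 10, y 11, y 12, y 13, y 14, y 15⟩,
    by simpa using hd, ?_⟩
  simp only [Cf.map, Cf.scale, Cf.mk.injEq]
  exact ⟨hy 0, hy 1, hy 2, hy 3, hy 4, hy 5, hy 6, hy 7, hy 8, hy 9, hy 10, hy 11, hy 12, hy 13,
    hy 14, hy 15⟩

lemma finite_and_ncard_le {α : Type*} {S : Set α} {N : ℝ}
    (h : ∀ I : Finset α, (∀ x ∈ I, x ∈ S) → (I.card : ℝ) ≤ N) : S.Finite ∧ (S.ncard : ℝ) ≤ N := by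
  have hf : S.Finite := by
    by_contra hinf
    obtain ⟨I, hI, hc⟩ := Set.Infinite.exists_subset_card_eq hinf (⌊N⌋₊ + 1)
    have h1 := h I fun x hx => hI hx
    rw [hc] at h1
    push_cast at h1
    linarith [Nat.lt_floor_add_one N]
  refine ⟨hf, ?_⟩
  rw [Set.ncard_eq_toFinset_card S hf]
  exact h _ fun x hx => by simpa using hx

end Integral

section Count

open MvPolynomial

variable {k : Type*} [Field k] [NumberField k]

/-- Points of height at most `B` on a surface, outside its lines, at which the ratio of two given
linear forms has height at most `R`. -/
def ratioSet (F : MvPolynomial (Fin 4) k) (φ₀ φ₁ : (Fin 4 → k) →ₗ[k] k) (B R : ℝ) :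
    Set (Projectivization k (Fin 4 → k)) :=
  {x | eval x.rep F = 0 ∧ ¬ liesOnLineIn (map (algebraMap k (AlgebraicClosure k)) F)
    (fun i => algebraMap k (AlgebraicClosure k) (x.rep i)) ∧ φ₀ x.rep ≠ 0 ∧
    mulHeight x.rep ≤ B ∧ mulHeight₁ (φ₁ x.rep / φ₀ x.rep) ≤ R}

omit [NumberField k] in
lemma comb_vecMul {h : Fin 4 → Fin 4 → k} {N : Matrix (Fin 4) (Fin 4) k}
    (hN : Matrix.of h * N = 1) (P : Fin 4 → k) :
    P = Cf.comb h (Matrix.vecMul P N 0) (Matrix.vecMul P N 1) (Matrix.vecMul P N 2)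
      (Matrix.vecMul P N 3) := by
  have : ![Matrix.vecMul P N 0, Matrix.vecMul P N 1, Matrix.vecMul P N 2, Matrix.vecMul P N 3] =
      Matrix.vecMul P N := by
    ext i
    fin_cases i <;> rfl
  rw [Cf.comb_eq_vecMul, this, Matrix.vecMul_vecMul, mul_eq_one_comm.1 hN, Matrix.vecMul_one]

omit [NumberField k] in
lemma algebraMap_comb (Ω : Type*) [Field Ω] [Algebra k Ω] (h : Fin 4 → Fin 4 → k) (τ σ y z : k) :
    (fun i => algebraMap k Ω (Cf.comb h τ σ y z i)) =
      Cf.comb (fun i j => algebraMap k Ω (h i j)) (algebraMap k Ω τ) (algebraMap k Ω σ)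
        (algebraMap k Ω y) (algebraMap k Ω z) := by
  ext i
  simp only [Cf.comb, Pi.add_apply, Pi.smul_apply, smul_eq_mul, map_add, map_mul]

omit [NumberField k] in
lemma Chart.eval_eq_cub {Ω : Type*} [Field Ω] [Algebra k Ω]
    {F : MvPolynomial (Fin 4) k} {h : Fin 4 → Fin 4 → k} {c : Cf k} (H : Chart Ω F h c)
    (τ σ y z : k) : eval (Cf.comb h τ σ y z) F = c.cub τ σ y z := by
  apply (algebraMap k Ω).injective
  rw [← Cf.map_cub, ← H.eval_eq, ← algebraMap_comb,
    eval_map (algebraMap k Ω) (fun i => algebraMap k Ω (Cf.comb h τ σ y z i)) F]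
  have := eval₂_comp_left (algebraMap k Ω) (RingHom.id k) (Cf.comb h τ σ y z) F
  rwa [eval₂_id] at this

lemma mulHeight_vecMul_le (N : Matrix (Fin 4) (Fin 4) k) : ∃ C : ℝ, 1 ≤ C ∧ ∀ P : Fin 4 → k,
    mulHeight (Matrix.vecMul P N) ≤ C * mulHeight P := by
  refine ⟨Nat.card (Fin 4) ^ totalWeight k * mulHeight fun p : Fin 4 × Fin 4 => N p.2 p.1, ?_,
    fun P => ?_⟩
  · refine one_le_mul_of_one_le_of_one_le (one_le_pow₀ ?_) (one_le_mulHeight _)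
    simp
  · have := mulHeight_linearMap_apply_le (fun p : Fin 4 × Fin 4 => N p.2 p.1) P
    refine le_trans (le_of_eq (congrArg mulHeight ?_)) this
    ext j
    simp [Matrix.vecMul, dotProduct, mul_comm]

omit [NumberField k] in
lemma eq_of_proportional {x x' : Projectivization k (Fin 4 → k)} {a : k}
    (h : a • x'.rep = x.rep) : x = x' := by
  rw [← x.mk_rep, ← x'.mk_rep, Projectivization.mk_eq_mk_iff']
  exact ⟨a, h⟩

variable {F : MvPolynomial (Fin 4) k} (hF : F.IsHomogeneous 3)
  (hsmooth : ∀ z : Fin 4 → AlgebraicClosure k, z ≠ 0 →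
      eval z (map (algebraMap k (AlgebraicClosure k)) F) = 0 →
      (fun i => eval z (pderiv i (map (algebraMap k (AlgebraicClosure k)) F))) ≠ 0)
  (φ₀ φ₁ : (Fin 4 → k) →ₗ[k] k)
  (h₀ : ∃ v, φ₀ v = 1 ∧ φ₁ v = 0) (h₁ : ∃ v, φ₀ v = 0 ∧ φ₁ v = 1)
  (hvan : ∀ v, φ₀ v = 0 → φ₁ v = 0 → eval v F = 0)

include hF hsmooth h₀ h₁ hvan

lemma liesOnLineIn_of_forms {P : Fin 4 → k} (hP : P ≠ 0) (hP0 : φ₀ P = 0) (hP1 : φ₁ P = 0) :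
    liesOnLineIn (map (algebraMap k (AlgebraicClosure k)) F)
      (fun i => algebraMap k (AlgebraicClosure k) (P i)) := by
  obtain ⟨h, N, hN, hker, hco⟩ := exists_frame φ₀ φ₁ h₀ h₁
  obtain ⟨c, H⟩ := exists_chart (AlgebraicClosure k) hF hsmooth hN
    fun y z => hvan _ (hker y z).1 (hker y z).2
  have hPc := comb_vecMul hN P
  rw [(hco P).1, (hco P).2, hP0, hP1] at hPc
  generalize Matrix.vecMul P N = v at hPc
  subst hPc
  rw [algebraMap_comb, map_zero]
  refine H.liesOnLineIn_of_zero _ _ ?_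
  by_contra! h'
  simp only [map_eq_zero] at h'
  apply hP
  simp [Cf.comb, h'.1, h'.2]

lemma ratioSet_ncard_le {ε a : ℝ} (hε : 0 < ε) (ha : 0 < a) : ∃ M : ℝ, 0 < M ∧ ∀ B : ℝ, 1 ≤ B →
    (ratioSet F φ₀ φ₁ B (a * B ^ ((2 : ℝ) / 3))).Finite ∧
      ((ratioSet F φ₀ φ₁ B (a * B ^ ((2 : ℝ) / 3))).ncard : ℝ) ≤ M * B ^ ((4 : ℝ) / 3 + ε) := by
  classical
  obtain ⟨h, N, hN, hker, hco⟩ := exists_frame φ₀ φ₁ h₀ h₁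
  obtain ⟨c, H⟩ := exists_chart (AlgebraicClosure k) hF hsmooth hN
    fun y z => hvan _ (hker y z).1 (hker y z).2
  obtain ⟨d, c', hd, hc'⟩ := c.exists_integral
  have hd' : algebraMap k (AlgebraicClosure k) d ≠ 0 := by simpa using hd
  have hs : ((c'.map (algebraMap (𝓞 k) k)).map (algebraMap k (AlgebraicClosure k))).Smooth := by
    rw [hc', Cf.map_scale]
    exact H.smooth.scale hd'
  obtain ⟨K, hK, ⟨S⟩⟩ := exists_splitting hs
  obtain ⟨M, hM, hcount⟩ := bundle_points_le S hε ha
  obtain ⟨C, hC, hht⟩ := mulHeight_vecMul_le N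
  have hC0 : 0 < C := by linarith
  refine ⟨M * C ^ ((4 : ℝ) / 3 + ε), by positivity, fun B hB => finite_and_ncard_le fun I hI => ?_⟩
  have hB0 : 0 < B := by linarith
  let V : Projectivization k (Fin 4 → k) → Fin 4 → k := fun x => Matrix.vecMul x.rep N
  let f : Projectivization k (Fin 4 → k) → k × k × k := fun x =>
    (V x 1 / V x 0, V x 2 / V x 0, V x 3 / V x 0)
  have hV0 : ∀ x ∈ I, V x 0 ≠ 0 := by
    intro x hx
    obtain ⟨-, -, h3, -⟩ := hI x hx
    change Matrix.vecMul x.rep N 0 ≠ 0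
    rwa [(hco _).1]
  have hrep : ∀ x ∈ I, x.rep = V x 0 • Cf.comb h 1 (f x).1 (f x).2.1 (f x).2.2 := by
    intro x hx
    have h0 := hV0 x hx
    have h1 : x.rep = Cf.comb h (V x 0) (V x 1) (V x 2) (V x 3) := comb_vecMul hN x.rep
    rw [h1]
    ext i
    simp only [Cf.comb, f, Pi.add_apply, Pi.smul_apply, smul_eq_mul]
    field_simp
  have hinj : Set.InjOn f I := by
    intro x hx x' hx' hxx
    have h1 := hrep x hx
    have h2 := hrep x' hx'
    rw [← hxx] at h2
    refine eq_of_proportional (a := V x 0 / V x' 0) ?_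
    have h3 := hV0 x' hx'
    rw [h2, smul_smul, div_mul_cancel₀ _ h3]
    exact h1.symm
  have hCB : 1 ≤ C * B := one_le_mul_of_one_le_of_one_le hC hB
  have hle := hcount (C * B) hCB (I.image f) ?_
  · rw [Finset.card_image_of_injOn hinj, Real.mul_rpow hC0.le hB0.le] at hle
    linarith
  intro w hw
  obtain ⟨x, hx, rfl⟩ := Finset.mem_image.1 hw
  obtain ⟨hx1, hx2, hx3, hx4, hx5⟩ := hI x hx
  have h0 := hV0 x hx
  have hq : c.q (f x).1 1 (f x).2.1 (f x).2.2 = 0 := by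
    have e1 : c.cub (V x 0) (V x 1) (V x 2) (V x 3) = 0 := by
      rw [← H.eval_eq_cub]
      change eval (Cf.comb h (Matrix.vecMul x.rep N 0) _ _ _) F = 0
      rw [← comb_vecMul hN, hx1]
    have e2 : V x 0 ^ 3 * c.q (f x).1 1 (f x).2.1 (f x).2.2 = 0 := by
      rw [← e1]
      simp only [f, Cf.q, Cf.cub, Cf.A, Cf.B, Cf.C, Cf.D, Cf.E, Cf.F]
      field_simp
    exact (mul_eq_zero.1 e2).resolve_left (pow_ne_zero _ h0)
  refine ⟨?_, ?_, ?_, ?_⟩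
  · rw [hc', Cf.disc_scale]
    refine mul_ne_zero (pow_ne_zero _ hd) fun hdisc => hx2 ?_
    have hl := H.liesOnLineIn_of_disc (s := algebraMap k _ (f x).1)
      (y := algebraMap k _ (f x).2.1) (z := algebraMap k _ (f x).2.2)
      (by rw [Cf.map_disc, hdisc, map_zero])
      (by rw [← map_one (algebraMap k (AlgebraicClosure k)), Cf.map_q, hq, map_zero])
    rw [← map_one (algebraMap k (AlgebraicClosure k)), ← algebraMap_comb] at hl
    have hl' := liesOnLineIn_smul hl (algebraMap k (AlgebraicClosure k) (V x 0))
    convert hl' using 1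
    ext i
    conv_lhs => rw [hrep x hx]
    simp
  · rw [hc', Cf.q_scale, hq, mul_zero]
  · have e : Matrix.vecMul x.rep N = V x 0 • pt (f x).1 (f x).2.1 (f x).2.2 := by
      ext i
      change V x i = _
      fin_cases i <;> simp [pt, f] <;> field_simp
    have h1 := hht x.rep
    rw [e] at h1
    have h2 := mulHeight_smul_eq_mulHeight (x := pt (f x).1 (f x).2.1 (f x).2.2) h0
    rw [h2] at h1
    exact h1.trans (by gcongr)
  · have e : (f x).1 = φ₁ x.rep / φ₀ x.rep := by
      rw [← (hco _).1, ← (hco _).2]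
    rw [e]
    refine hx5.trans ?_
    gcongr
    nlinarith

end Count

section Planes

open MvPolynomial

/-- A frame adapted to two lines in a plane: the lines are spanned by the last vector and one of
the middle vectors. -/
lemma exists_plane_frame {k : Type*} [Field k] {W L₁ L₂ : Submodule k (Fin 4 → k)}
    (hW : Module.finrank k W = 3) (h1 : Module.finrank k L₁ = 2) (h2 : Module.finrank k L₂ = 2)
    (h1W : L₁ ≤ W) (h2W : L₂ ≤ W) (hne : L₁ ≠ L₂) :
    ∃ (h : Fin 4 → Fin 4 → k) (N : Matrix (Fin 4) (Fin 4) k), Matrix.of h * N = 1 ∧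
      h 2 ∈ L₁ ∧ h 1 ∈ L₂ ∧ h 3 ∈ L₁ ∧ h 3 ∈ L₂ := by
  obtain ⟨e₀, he₀⟩ : ∃ e, e ∉ W := by
    by_contra! h
    rw [(Submodule.eq_top_iff'.2 h : W = ⊤), finrank_top] at hW
    simp at hW
  obtain ⟨e₂, he₂, he₂'⟩ : ∃ e ∈ L₁, e ∉ L₂ := by
    by_contra! h
    exact hne (Submodule.eq_of_le_of_finrank_eq h (h1.trans h2.symm))
  obtain ⟨e₁, he₁, he₁'⟩ : ∃ e ∈ L₂, e ∉ L₁ := by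
    by_contra! h
    exact hne (Submodule.eq_of_le_of_finrank_eq h (h2.trans h1.symm)).symm
  obtain ⟨e₃, he₃, he₃'⟩ : ∃ e ∈ L₁ ⊓ L₂, e ≠ 0 := by
    apply Submodule.exists_mem_ne_zero_of_ne_bot
    intro h
    have e := Submodule.finrank_sup_add_finrank_inf_eq L₁ L₂
    have := Submodule.finrank_mono (sup_le h1W h2W)
    rw [h, finrank_bot] at e
    omega
  have hli : LinearIndependent k ![e₀, e₁, e₂, e₃] := by
    refine linearIndependent_finCons.2 ⟨linearIndependent_finCons.2 ⟨linearIndependent_finCons.2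
      ⟨LinearIndependent.of_subsingleton 0 he₃', fun h => he₂' ?_⟩, fun h => he₁' ?_⟩,
      fun h => he₀ ?_⟩
    · refine Submodule.span_le.2 ?_ h
      rintro - ⟨i, rfl⟩
      fin_cases i
      exact he₃.2
    · refine Submodule.span_le.2 ?_ h
      rintro - ⟨i, rfl⟩
      fin_cases i
      exacts [he₂, he₃.1]
    · refine Submodule.span_le.2 ?_ h
      rintro - ⟨i, rfl⟩
      fin_cases i
      exacts [h2W he₁, h1W he₂, h1W he₃.1]
  have hu := Matrix.linearIndependent_rows_iff_isUnit.1
    (show LinearIndependent k (Matrix.of ![e₀, e₁, e₂, e₃]).row from hli)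
  obtain ⟨N, hN⟩ := hu.exists_right_inv
  exact ⟨_, N, hN, he₂, he₁, he₃.1, he₃.2⟩

/-- The residual linear form of a conic bundle whose cubic form contains two lines in the plane
`τ = 0` does not vanish identically. -/
lemma Cf.Smooth.residual_ne {k : Type*} [Field k] [CharZero k] {c : Cf k}
    (h : (c.map (algebraMap k (AlgebraicClosure k))).Smooth)
    (ha : c.a3 = 0) (hc : c.c2 = 0) (hf : c.f1 = 0) : c.b2 ≠ 0 ∨ c.d1 ≠ 0 ∨ c.e1 ≠ 0 := by
  by_contra! h0
  obtain ⟨hb, hd, he⟩ := h0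
  have := charZero_of_injective_algebraMap (algebraMap k (AlgebraicClosure k)).injective
  set c' := c.map (algebraMap k (AlgebraicClosure k)) with hc'
  obtain ⟨l, m, hlm, e⟩ := exists_binary_zero c'.a2 c'.b1 c'.d0
  refine h.inf l m 0 (by tauto) ?_ (by linear_combination e)
  simp [hc', Cf.map, InKernel, ha, hb, hc, hd, he, hf]

/-- A cubic form containing two lines in the plane `τ = 0` splits there into three linear
factors. -/
lemma Cf.cub_eq {R : Type*} [CommRing R] {c : Cf R} (ha : c.a3 = 0) (hc : c.c2 = 0)
    (hf : c.f1 = 0) (τ σ y z : R) : c.cub τ σ y z =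
      τ * (c.a0 * τ ^ 2 + c.a1 * τ * σ + c.a2 * σ ^ 2 + c.b0 * τ * y + c.b1 * σ * y +
        c.c0 * τ * z + c.c1 * σ * z + c.d0 * y ^ 2 + c.e0 * y * z + c.f0 * z ^ 2) +
      σ * y * (c.b2 * σ + c.d1 * y + c.e1 * z) := by
  rw [cub, ha, hc, hf]
  ring

variable {k : Type*} [Field k] [NumberField k]

lemma mulHeight₁_ratios_le {c : Cf k} (ha : c.a3 = 0) (hc : c.c2 = 0) (hf : c.f1 = 0) :
    ∃ C : ℝ, 1 ≤ C ∧ ∀ x : Fin 4 → k, x 0 ≠ 0 → c.cub (x 0) (x 1) (x 2) (x 3) = 0 →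
      mulHeight₁ (x 1 / x 0) * (mulHeight₁ (x 2 / x 0) *
        mulHeight₁ ((c.b2 * x 1 + c.d1 * x 2 + c.e1 * x 3) / x 0)) ≤ C * mulHeight x ^ 2 := by
  have key : ∀ a : Fin 2 × Fin 2 × Fin 2, ∃ A : Matrix (Fin 4) (Fin 4) k, ∀ x : Fin 4 → k,
      c.cub (x 0) (x 1) (x 2) (x 3) = 0 →
      ![x 1, x 0] a.1 * (![x 2, x 0] a.2.1 * ![c.b2 * x 1 + c.d1 * x 2 + c.e1 * x 3, x 0] a.2.2) =
        x 0 * ∑ p : Fin 4 × Fin 4, A p.1 p.2 * (x p.1 * x p.2) := by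
    simp_rw [Fintype.sum_prod_type, Fin.sum_univ_four, Cf.cub_eq ha hc hf]
    rintro ⟨i, j, l⟩
    fin_cases i <;> fin_cases j <;> fin_cases l
    · refine ⟨!![-c.a0, -c.a1, -c.b0, -c.c0; 0, -c.a2, -c.b1, -c.c1; 0, 0, -c.d0, -c.e0;
        0, 0, 0, -c.f0], fun x hx => ?_⟩
      simp [-mul_eq_mul_left_iff]
      linear_combination hx
    · refine ⟨!![0, 0, 0, 0; 0, 0, 1, 0; 0, 0, 0, 0; 0, 0, 0, 0], fun x _ => ?_⟩
      simp [-mul_eq_mul_left_iff]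
      ring
    · refine ⟨!![0, 0, 0, 0; 0, c.b2, c.d1, c.e1; 0, 0, 0, 0; 0, 0, 0, 0], fun x _ => ?_⟩
      simp [-mul_eq_mul_left_iff]
      ring
    · refine ⟨!![0, 1, 0, 0; 0, 0, 0, 0; 0, 0, 0, 0; 0, 0, 0, 0], fun x _ => ?_⟩
      simp [-mul_eq_mul_left_iff]
      ring
    · refine ⟨!![0, 0, 0, 0; 0, 0, c.b2, 0; 0, 0, c.d1, c.e1; 0, 0, 0, 0], fun x _ => ?_⟩
      simp [-mul_eq_mul_left_iff]
      ring
    · refine ⟨!![0, 0, 1, 0; 0, 0, 0, 0; 0, 0, 0, 0; 0, 0, 0, 0], fun x _ => ?_⟩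
      simp [-mul_eq_mul_left_iff]
      ring
    · refine ⟨!![0, c.b2, c.d1, c.e1; 0, 0, 0, 0; 0, 0, 0, 0; 0, 0, 0, 0], fun x _ => ?_⟩
      simp [-mul_eq_mul_left_iff]
      ring
    · refine ⟨!![1, 0, 0, 0; 0, 0, 0, 0; 0, 0, 0, 0; 0, 0, 0, 0], fun x _ => ?_⟩
      simp [-mul_eq_mul_left_iff]
  choose A hA using key
  let A' : (Fin 2 × Fin 2 × Fin 2) × (Fin 4 × Fin 4) → k := fun a => A a.1 a.2.1 a.2.2
  refine ⟨Nat.card (Fin 4 × Fin 4) ^ totalWeight k * mulHeight A', ?_, fun x h0 hx => ?_⟩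
  · refine one_le_mul_of_one_le_of_one_le (one_le_pow₀ ?_) (one_le_mulHeight _)
    simp
  have hx0 : x ≠ 0 := fun h => h0 (congrFun h 0)
  have hp : ∀ t : k, (![t, x 0] : Fin 2 → k) ≠ 0 := fun t h => h0 (congrFun h 1)
  have hv : (fun b : Fin 2 × Fin 2 => (![x 2, x 0] : Fin 2 → k) b.1 *
      (![c.b2 * x 1 + c.d1 * x 2 + c.e1 * x 3, x 0] : Fin 2 → k) b.2) ≠ 0 := fun h => by
    have := congrFun h (1, 1)
    simp [h0] at this
  have e := mulHeight_linearMap_apply_le A' fun p : Fin 4 × Fin 4 => x p.1 * x p.2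
  rw [mulHeight_fun_mul_eq hx0 hx0, ← mulHeight_smul_eq_mulHeight _ h0] at e
  rw [mulHeight₁_div_eq_mulHeight, mulHeight₁_div_eq_mulHeight, mulHeight₁_div_eq_mulHeight,
    ← mulHeight_fun_mul_eq (hp _) (hp _), ← mulHeight_fun_mul_eq (hp _) hv, sq]
  refine le_trans (le_of_eq (congrArg mulHeight ?_)) e
  ext a
  exact hA a x hx

end Planes

section Main

open MvPolynomial

variable {k : Type*} [Field k] [NumberField k] {F : MvPolynomial (Fin 4) k}

lemma rep_mk_conditions (hF : F.IsHomogeneous 3) {B : ℝ} {y : Fin 4 → 𝓞 k}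
    (hy : (fun i => (y i : k)) ≠ 0) (h0 : eval (fun i => (y i : k)) F = 0)
    (hl : ¬ liesOnLineIn (map (algebraMap k (AlgebraicClosure k)) F)
      (fun i => algebraMap k (AlgebraicClosure k) (y i : k))) (hB : heightFn y ≤ B) :
    eval (Projectivization.mk k _ hy).rep F = 0 ∧
    ¬ liesOnLineIn (map (algebraMap k (AlgebraicClosure k)) F)
      (fun i => algebraMap k (AlgebraicClosure k) ((Projectivization.mk k _ hy).rep i)) ∧
    mulHeight (Projectivization.mk k _ hy).rep ≤ B := by
  obtain ⟨a, ha⟩ := Projectivization.exists_smul_eq_mk_rep k _ hy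
  rw [← ha]
  have ha0 : (a : k) ≠ 0 := a.ne_zero
  refine ⟨?_, fun h => hl ?_, ?_⟩
  · obtain ⟨u, rfl⟩ := exists_tri hF
    rw [eval_tri] at h0 ⊢
    rw [Units.smul_def, tri_smul₁, tri_smul₂, tri_smul₃, h0]
    simp
  · have := liesOnLineIn_smul h (algebraMap k (AlgebraicClosure k) (a : k)⁻¹)
    convert this using 1
    ext i
    simp [Units.smul_def, ha0]
  · rw [Units.smul_def, mulHeight_smul_eq_mulHeight (x := fun i => (y i : k)) ha0]
    rwa [heightFn_eq_mulHeight] at hB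
    rintro rfl
    exact hy (by ext; simp)

/-- The linear form with coefficients `β` in the coordinates given by `N`. -/
def coordForm (N : Matrix (Fin 4) (Fin 4) k) (β : Fin 4 → k) : (Fin 4 → k) →ₗ[k] k where
  toFun P := ∑ i, β i * Matrix.vecMul P N i
  map_add' P P' := by simp [Matrix.add_vecMul, mul_add, Finset.sum_add_distrib]
  map_smul' a P := by
    simp only [Matrix.smul_vecMul, Pi.smul_apply, smul_eq_mul, Finset.mul_sum, RingHom.id_apply]
    exact Finset.sum_congr rfl fun i _ => by ring

omit [NumberField k] in
lemma coordForm_apply (N : Matrix (Fin 4) (Fin 4) k) (β P : Fin 4 → k) :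
    coordForm N β P = ∑ i, β i * Matrix.vecMul P N i := rfl

omit [NumberField k] in
lemma coordForm_frame {h : Fin 4 → Fin 4 → k} {N : Matrix (Fin 4) (Fin 4) k}
    (hN : Matrix.of h * N = 1) (β x : Fin 4 → k) :
    coordForm N β (Matrix.vecMul x (Matrix.of h)) = ∑ i, β i * x i := by
  rw [coordForm_apply, Matrix.vecMul_vecMul, hN, Matrix.vecMul_one]

lemma exists_le_of_mul_le {x y z C B : ℝ} (hC : 1 ≤ C) (hB : 1 ≤ B)
    (h : x * (y * z) ≤ C * B ^ 2) : x ≤ C * B ^ ((2 : ℝ) / 3) ∨ y ≤ C * B ^ ((2 : ℝ) / 3) ∨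
      z ≤ C * B ^ ((2 : ℝ) / 3) := by
  by_contra! hc
  have hB0 : 0 < B := by linarith
  set t := C * B ^ ((2 : ℝ) / 3) with ht
  have ht0 : 0 < t := by positivity
  have h3 : t ^ 3 = C ^ 3 * B ^ 2 := by
    rw [ht, mul_pow, ← Real.rpow_natCast (B ^ ((2 : ℝ) / 3)), ← Real.rpow_mul hB0.le]
    norm_num
  have h1 : t ^ 3 < x * (y * z) := by
    rw [pow_succ', sq]
    have := mul_lt_mul'' hc.2.1 hc.2.2 ht0.le ht0.le
    exact mul_lt_mul'' hc.1 this ht0.le (by positivity)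
  have h2 : C * B ^ 2 ≤ C ^ 3 * B ^ 2 := by
    gcongr
    exact le_self_pow₀ hC (by norm_num)
  linarith

lemma exists_ratioSet_cover (hF : F.IsHomogeneous 3)
    (hsmooth : ∀ z : Fin 4 → AlgebraicClosure k, z ≠ 0 →
      eval z (map (algebraMap k (AlgebraicClosure k)) F) = 0 →
      (fun i => eval z (pderiv i (map (algebraMap k (AlgebraicClosure k)) F))) ≠ 0)
    {W L₁ L₂ : Submodule k (Fin 4 → k)} (hW : Module.finrank k W = 3)
    (h1 : Module.finrank k L₁ = 2) (h2 : Module.finrank k L₂ = 2)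
    (h1W : L₁ ≤ W) (h2W : L₂ ≤ W) (hne : L₁ ≠ L₂)
    (hL₁ : ∀ y ∈ L₁, eval y F = 0) (hL₂ : ∀ y ∈ L₂, eval y F = 0) :
    ∃ (φ : (Fin 4 → k) →ₗ[k] k) (ψ : Fin 3 → (Fin 4 → k) →ₗ[k] k) (a : ℝ), 0 < a ∧
      (∀ i, (∃ v, φ v = 1 ∧ ψ i v = 0) ∧ (∃ v, φ v = 0 ∧ ψ i v = 1) ∧
        ∀ v, φ v = 0 → ψ i v = 0 → eval v F = 0) ∧
      ∀ (B : ℝ) (x : Projectivization k (Fin 4 → k)), 1 ≤ B → eval x.rep F = 0 →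
        ¬ liesOnLineIn (map (algebraMap k (AlgebraicClosure k)) F)
          (fun i => algebraMap k (AlgebraicClosure k) (x.rep i)) →
        mulHeight x.rep ≤ B → ∃ i, x ∈ ratioSet F φ (ψ i) B (a * B ^ ((2 : ℝ) / 3)) := by
  obtain ⟨h, N, hN, m2, m1, m3, m3'⟩ := exists_plane_frame hW h1 h2 h1W h2W hne
  obtain ⟨c, H⟩ := exists_chart (AlgebraicClosure k) hF hsmooth hN fun y z =>
    hL₁ _ (L₁.add_mem (L₁.smul_mem y m2) (L₁.smul_mem z m3))
  have hcub : ∀ P, eval P F = c.cub (Matrix.vecMul P N 0) (Matrix.vecMul P N 1)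
      (Matrix.vecMul P N 2) (Matrix.vecMul P N 3) := by
    intro P
    rw [← H.eval_eq_cub, ← comb_vecMul hN]
  have hv : ∀ y z : k, c.a3 * y ^ 3 + c.c2 * y ^ 2 * z + c.f1 * y * z ^ 2 = 0 := by
    intro y z
    have e := H.eval_eq_cub 0 y 0 z
    have e' := hL₂ _ (L₂.add_mem (L₂.smul_mem y m1) (L₂.smul_mem z m3'))
    have : Cf.comb h 0 y 0 z = y • h 1 + z • h 3 := by simp [Cf.comb]
    rw [this, e', Cf.cub] at e
    linear_combination -e
  have ha : c.a3 = 0 := by simpa using hv 1 0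
  have hf : c.f1 = 0 := by linear_combination (hv 1 1 + hv 1 (-1)) / 2 - ha
  have hc : c.c2 = 0 := by linear_combination hv 1 1 - ha - hf
  obtain ⟨C, hC, hprod⟩ := mulHeight₁_ratios_le ha hc hf
  obtain ⟨C', hC', hht⟩ := mulHeight_vecMul_le N
  let β : Fin 3 → Fin 4 → k := ![![0, 1, 0, 0], ![0, 0, 1, 0], ![0, c.b2, c.d1, c.e1]]
  have hβ0 : ∀ i, β i 0 = 0 := by intro i; fin_cases i <;> rfl
  have hβ : ∀ i, ∃ j, β i j ≠ 0 := by
    intro i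
    fin_cases i
    · exact ⟨1, one_ne_zero⟩
    · exact ⟨2, one_ne_zero⟩
    · rcases H.smooth.residual_ne ha hc hf with h' | h' | h'
      exacts [⟨1, h'⟩, ⟨2, h'⟩, ⟨3, h'⟩]
  have hφ : ∀ P, coordForm N (Pi.single 0 1) P = Matrix.vecMul P N 0 := by
    intro P
    simp [coordForm_apply, Pi.single_apply]
  have hψ0 : ∀ P, coordForm N (β 0) P = Matrix.vecMul P N 1 := by
    intro P
    simp [coordForm_apply, Fin.sum_univ_four, β]
  have hψ1 : ∀ P, coordForm N (β 1) P = Matrix.vecMul P N 2 := by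
    intro P
    simp [coordForm_apply, Fin.sum_univ_four, β]
  have hψ2 : ∀ P, coordForm N (β 2) P = c.b2 * Matrix.vecMul P N 1 +
      c.d1 * Matrix.vecMul P N 2 + c.e1 * Matrix.vecMul P N 3 := by
    intro P
    simp [coordForm_apply, Fin.sum_univ_four, β]
  have hforms : ∀ i, (∃ v, coordForm N (Pi.single 0 1) v = 1 ∧ coordForm N (β i) v = 0) ∧
      (∃ v, coordForm N (Pi.single 0 1) v = 0 ∧ coordForm N (β i) v = 1) ∧
      ∀ v, coordForm N (Pi.single 0 1) v = 0 → coordForm N (β i) v = 0 → eval v F = 0 := by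
    intro i
    refine ⟨⟨Matrix.vecMul (Pi.single 0 1) (Matrix.of h), ?_, ?_⟩, ?_, fun v hv0 hv1 => ?_⟩
    · rw [coordForm_frame hN]
      simp [Pi.single_apply]
    · rw [coordForm_frame hN]
      simp [Pi.single_apply, hβ0]
    · obtain ⟨j, hj⟩ := hβ i
      have hj0 : j ≠ 0 := by
        rintro rfl
        exact hj (hβ0 i)
      refine ⟨Matrix.vecMul (Pi.single j (β i j)⁻¹) (Matrix.of h), ?_, ?_⟩
      · rw [coordForm_frame hN]
        simp [Pi.single_apply, hj0]
      · rw [coordForm_frame hN]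
        simp [Pi.single_apply, hj]
    · rw [hφ] at hv0
      rw [hcub, Cf.cub_eq ha hc hf, hv0, zero_mul, zero_add]
      fin_cases i
      · have := (hψ0 v).symm.trans hv1
        rw [this]
        ring
      · have := (hψ1 v).symm.trans hv1
        rw [this]
        ring
      · have := (hψ2 v).symm.trans hv1
        rw [this]
        ring
  refine ⟨coordForm N (Pi.single 0 1), fun i => coordForm N (β i), C * C' ^ 2, by positivity,
    hforms, fun B x hB hx hl hxB => ?_⟩
  have hx0 : Matrix.vecMul x.rep N 0 ≠ 0 := by
    intro h0
    have e := hcub x.rep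
    rw [hx, Cf.cub_eq ha hc hf, h0, zero_mul, zero_add] at e
    have hno : ∀ i, coordForm N (β i) x.rep ≠ 0 := fun i hi =>
      hl (liesOnLineIn_of_forms hF hsmooth _ _ (hforms i).1 (hforms i).2.1 (hforms i).2.2
        x.rep_nonzero ((hφ _).trans h0) hi)
    have n0 := hno 0
    have n1 := hno 1
    have n2 := hno 2
    rw [hψ0] at n0
    rw [hψ1] at n1
    rw [hψ2] at n2
    exact mul_ne_zero (mul_ne_zero n0 n1) n2 e.symm
  have hle := hprod (Matrix.vecMul x.rep N) hx0 (by rw [← hcub, hx])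
  have hle' : C * mulHeight (Matrix.vecMul x.rep N) ^ 2 ≤ C * C' ^ 2 * B ^ 2 := by
    rw [mul_assoc, ← mul_pow]
    have := (hht x.rep).trans (mul_le_mul_of_nonneg_left hxB (by linarith : 0 ≤ C'))
    have h0 := (mulHeight_pos (Matrix.vecMul x.rep N)).le
    gcongr
  have hmem : ∀ i, mulHeight₁ (coordForm N (β i) x.rep / Matrix.vecMul x.rep N 0) ≤
      C * C' ^ 2 * B ^ ((2 : ℝ) / 3) →
      x ∈ ratioSet F (coordForm N (Pi.single 0 1)) (coordForm N (β i)) B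
        (C * C' ^ 2 * B ^ ((2 : ℝ) / 3)) := fun i hi =>
    ⟨hx, hl, by rwa [hφ], hxB, by rwa [hφ]⟩
  rcases exists_le_of_mul_le (one_le_mul_of_one_le_of_one_le hC (one_le_pow₀ hC')) hB
    (hle.trans hle') with h' | h' | h'
  · exact ⟨0, hmem 0 (by rwa [hψ0])⟩
  · exact ⟨1, hmem 1 (by rwa [hψ1])⟩
  · exact ⟨2, hmem 2 (by rwa [hψ2])⟩

end Main

end CubicSurface

/-- Theorem 1.2: cubic surfaces with three coplanar lines:  let
`X ⊂ ℙ³` be a non-singular cubic surface over a number field `k` (a del Pezzo surface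
of degree `3`), containing three coplanar lines defined over `k`.  Let `U ⊂ X` be the
complement of the `27` lines of `X`.  Then for every `ε > 0` there is a constant
`C = C(ε, X, k)` with `N(U, k, B) = #{x ∈ U(k) : H_k(x) ≤ B} ≤ C·B^{4/3+ε}` for all
`B ≥ 1`. -/
theorem dp3_point_count {k : Type*} [Field k] [NumberField k]
    (F : MvPolynomial (Fin 4) k)
    (hdeg : F.IsHomogeneous 3)
    -- `X = {F = 0}` is non-singular (Jacobian criterion over `k̄`):
    (hsmooth : ∀ z : Fin 4 → AlgebraicClosure k, z ≠ 0 →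
      MvPolynomial.eval z (MvPolynomial.map (algebraMap k (AlgebraicClosure k)) F) = 0 →
      (fun i => MvPolynomial.eval z (MvPolynomial.pderiv i
        (MvPolynomial.map (algebraMap k (AlgebraicClosure k)) F))) ≠ 0)
    -- `X` contains three (distinct) coplanar lines defined over `k`:
    (hlines : ∃ (W : Submodule k (Fin 4 → k)) (Lns : Fin 3 → Submodule k (Fin 4 → k)),
      Module.finrank k W = 3 ∧ Function.Injective Lns ∧
      ∀ i, Module.finrank k (Lns i) = 2 ∧ Lns i ≤ W ∧
        ∀ y ∈ Lns i, MvPolynomial.eval y F = 0)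
    (ε : ℝ) (hε : 0 < ε) :
    ∃ C : ℝ, 0 < C ∧ ∀ B : ℝ, 1 ≤ B →
      (let U : Set (Projectivization k (Fin 4 → k)) :=
        {x | ∃ (y : Fin 4 → 𝓞 k) (hy : (fun i => (y i : k)) ≠ 0),
          Projectivization.mk k (fun i => (y i : k)) hy = x ∧
          MvPolynomial.eval (fun i => (y i : k)) F = 0 ∧
          ¬ liesOnLineIn (MvPolynomial.map (algebraMap k (AlgebraicClosure k)) F)
            (fun i => algebraMap k (AlgebraicClosure k) (y i : k)) ∧
          heightFn y ≤ B};
      U.Finite ∧ (U.ncard : ℝ) ≤ C * B ^ ((4 : ℝ) / 3 + ε)) := by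
  obtain ⟨W, Lns, hW, hinj, hL⟩ := hlines
  obtain ⟨φ, ψ, a, ha, hforms, hcover⟩ := CubicSurface.exists_ratioSet_cover hdeg hsmooth hW
    (hL 0).1 (hL 1).1 (hL 0).2.1 (hL 1).2.1 (hinj.ne (by decide)) (hL 0).2.2 (hL 1).2.2
  choose M hM hcount using fun i => CubicSurface.ratioSet_ncard_le hdeg hsmooth φ (ψ i)
    (hforms i).1 (hforms i).2.1 (hforms i).2.2 hε ha
  refine ⟨∑ i, M i, Finset.sum_pos (fun i _ => hM i) Finset.univ_nonempty, fun B hB => ?_⟩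
  intro U
  have hsub : U ⊆ ⋃ i, CubicSurface.ratioSet F φ (ψ i) B (a * B ^ ((2 : ℝ) / 3)) := by
    rintro x ⟨y, hy, rfl, h0, hl, hyB⟩
    obtain ⟨h1, h2, h3⟩ := CubicSurface.rep_mk_conditions hdeg hy h0 hl hyB
    exact Set.mem_iUnion.2 (hcover B _ hB h1 h2 h3)
  have hfin := Set.finite_iUnion fun i => (hcount i B hB).1
  refine ⟨hfin.subset hsub, ?_⟩
  have h1 := (Set.ncard_le_ncard hsub hfin).trans (Set.ncard_iUnion_le_of_fintype _)
  calc (U.ncard : ℝ)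
    _ ≤ ∑ i, ((CubicSurface.ratioSet F φ (ψ i) B (a * B ^ ((2 : ℝ) / 3))).ncard : ℝ) := by
        exact_mod_cast h1
    _ ≤ ∑ i, M i * B ^ ((4 : ℝ) / 3 + ε) := Finset.sum_le_sum fun i _ => (hcount i B hB).2
    _ = _ := (Finset.sum_mul _ _ _).symm
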